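/- Let K₁ and K₂ be finitely generated fields that are elementarily equivalent. Then K₁ and K₂ have the same absolute transcendence degree: the transcendence degree of K₁ over its prime subfield equals the transcendence degree of K₂ over its prime subfield. -/

import Mathlib

open scoped TensorProduct
open Quaternion
set_option synthInstance.maxHeartbeats 1000000
set_option maxHeartbeats 1000000
noncomputable section

universe u v

/-- Upper-triangular coefficient matrix of a quadratic form on `Fin n → R`. -/
def coeffMatrix {R : Type*} [CommRing R] {n : ℕ} (q : QuadraticForm R (Fin n → R)) :
    Matrix (Fin n) (Fin n) R :=
  Matrix.of fun i j =>
    if i = j then q (Pi.single i 1)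
    else if i < j then QuadraticMap.polar q (Pi.single i 1) (Pi.single j 1)
    else 0

/-- Base change of a quadratic form on `Fin n → R` along `R → l`. -/
def extendQF {R : Type*} [CommRing R] {n : ℕ} (q : QuadraticForm R (Fin n → R))
    (l : Type*) [CommRing l] [Algebra R l] : QuadraticForm l (Fin n → l) :=
  ((coeffMatrix q).map (algebraMap R l)).toQuadraticMap'

/-- Gram matrix of the polar bilinear form of `q`. -/
def polarMatrix {R : Type*} [CommRing R] {n : ℕ} (q : QuadraticForm R (Fin n → R)) :
    Matrix (Fin n) (Fin n) R :=
  Matrix.of fun i j => QuadraticMap.polar q (Pi.single i 1) (Pi.single j 1)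

/-- Discriminant: determinant of the Gram matrix (well defined up to squares). -/
def discQF {R : Type*} [CommRing R] {n : ℕ} (q : QuadraticForm R (Fin n → R)) : R :=
  (polarMatrix q).det

/-- Nondegeneracy (char ≠ 2): the Gram determinant is nonzero. -/
def NondegQF {R : Type*} [CommRing R] {n : ℕ} (q : QuadraticForm R (Fin n → R)) : Prop :=
  discQF q ≠ 0

/-- Two quadratic forms are similar if one is isometric to a unit scaling of the other. -/
def SimilarQF {R : Type*} [CommRing R] {n : ℕ} (q q' : QuadraticForm R (Fin n → R)) : Prop :=
  ∃ c : R, IsUnit c ∧ QuadraticMap.Equivalent (c • q) q'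

/-- The polynomial `q(X₁, …, X_{n-1}, 1)` defining the affine quadric. -/
def affineQuadricPoly {R : Type*} [CommRing R] {n : ℕ} (q : QuadraticForm R (Fin n → R)) :
    MvPolynomial (Fin (n - 1)) R :=
  (extendQF q (MvPolynomial (Fin (n - 1)) R))
    (fun i => if h : (i : ℕ) < n - 1 then MvPolynomial.X ⟨i, h⟩ else 1)

/-- Affine coordinate ring `R[x₁,…,x_{n-1}]/(q(x₁,…,x_{n-1},1))` of the quadric. -/
abbrev quadricCoordRing {R : Type*} [CommRing R] {n : ℕ}
    (q : QuadraticForm R (Fin n → R)) : Type _ :=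
  MvPolynomial (Fin (n - 1)) R ⧸ Ideal.span {affineQuadricPoly q}

/-- Function field `k(q)` of the quadric hypersurface `q = 0`. -/
abbrev quadricFunctionField {R : Type*} [CommRing R] {n : ℕ}
    (q : QuadraticForm R (Fin n → R)) : Type _ :=
  FractionRing (quadricCoordRing q)

/-- Affine coordinate ring `k[x,y]/(ax²+by²-1)` of the conic `C_{a,b}`. -/
abbrev conicCoordRing (k : Type*) [Field k] (a b : k) : Type _ :=
  MvPolynomial (Fin 2) k ⧸
    Ideal.span {(MvPolynomial.C a * MvPolynomial.X 0 ^ 2 +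
      MvPolynomial.C b * MvPolynomial.X 1 ^ 2 - 1 : MvPolynomial (Fin 2) k)}

/-- The conic function field `k(C_{a,b})`. -/
abbrev conicFunctionField (k : Type*) [Field k] (a b : k) : Type _ :=
  FractionRing (conicCoordRing k a b)

/-- A `k`-algebra is split if it is isomorphic to a matrix algebra over `k`. -/
def IsSplitAlg (k A : Type*) [Field k] [Ring A] [Algebra k A] : Prop :=
  ∃ n : ℕ, 0 < n ∧ Nonempty (A ≃ₐ[k] Matrix (Fin n) (Fin n) k)

/-- `A` is split by the extension `K/k`: the class of `A` lies in the Brauer kernel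
`κ(K/k) = ker (Br k → Br K)`. -/
def SplitsIn (k : Type*) [Field k] (A : Type*) [Ring A] [Algebra k A]
    (K : Type*) [CommRing K] [Algebra k K] : Prop :=
  ∃ n : ℕ, 0 < n ∧ Nonempty ((K ⊗[k] A) ≃ₐ[K] Matrix (Fin n) (Fin n) K)

/-- Brauer equivalence of two `k`-algebras. -/
def BrauerEquiv (k A B : Type*) [Field k] [Ring A] [Algebra k A] [Ring B] [Algebra k B] :
    Prop :=
  ∃ n m : ℕ, 0 < n ∧ 0 < m ∧
    Nonempty (Matrix (Fin n) (Fin n) A ≃ₐ[k] Matrix (Fin m) (Fin m) B)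

/-- A field is finitely generated (over its prime subfield). -/
def FieldFG (K : Type*) [Field K] : Prop :=
  ∃ s : Finset K, Subfield.closure (s : Set K) = ⊤

/-- Elementary equivalence in the first-order language of rings. -/
def ElemEquivRing (K₁ : Type*) (K₂ : Type*) [CommRing K₁] [CommRing K₂] : Prop :=
  letI := FirstOrder.Ring.compatibleRingOfRing K₁
  letI := FirstOrder.Ring.compatibleRingOfRing K₂
  FirstOrder.Language.ring.ElementarilyEquivalent K₁ K₂

/-- The `m`-fold Pfister form `⟨⟨a₁,…,aₘ⟩⟩ = ⟨1,a₁⟩ ⊗ ⋯ ⊗ ⟨1,aₘ⟩`. -/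
def pfisterForm {k : Type*} [Field k] {m : ℕ} (a : Fin m → k) :
    QuadraticForm k (Fin (2 ^ m) → k) :=
  QuadraticMap.weightedSumSquares k
    (fun j : Fin (2 ^ m) => ∏ i : Fin m, if Nat.testBit (j : ℕ) (i : ℕ) then a i else 1)

/-- The diagonal quadratic form with weights `w`. -/
def diagForm {K ι : Type*} [CommRing K] [Fintype ι] (w x : ι → K) : K :=
  ∑ i, w i * x i ^ 2

/-- Index type of the diagonal entries of an `n`-fold Pfister form. -/
def PfisterIndex : ℕ → Type
  | 0 => Unit
  | n + 1 => PfisterIndex n ⊕ PfisterIndex n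

instance PfisterIndex.instFintype : (n : ℕ) → Fintype (PfisterIndex n)
  | 0 => inferInstanceAs (Fintype Unit)
  | n + 1 =>
    letI := PfisterIndex.instFintype n
    inferInstanceAs (Fintype (PfisterIndex n ⊕ PfisterIndex n))

theorem PfisterIndex.card (n : ℕ) : Fintype.card (PfisterIndex n) = 2 ^ n := by
  induction n with
  | zero => rfl
  | succ n ih =>
    have : Fintype.card (PfisterIndex (n + 1)) =
        Fintype.card (PfisterIndex n ⊕ PfisterIndex n) := rfl
    rw [this, Fintype.card_sum, ih]; ring

/-- Diagonal entries of the Pfister form `⟨1, -a₁⟩ ⊗ ⋯ ⊗ ⟨1, -aₙ⟩`. -/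
def pfisterWeight {K : Type*} [CommRing K] : (l : List K) → PfisterIndex l.length → K
  | [] => fun _ => 1
  | a :: l => Sum.elim (pfisterWeight l) (fun i => -a * pfisterWeight l i)

/-- `c` is a value of the diagonal form with weights `w`. -/
def Represents {K ι : Type*} [CommRing K] [Fintype ι] (w : ι → K) (c : K) : Prop :=
  ∃ x, diagForm w x = c

/-- The diagonal form with weights `w` has a nontrivial zero. -/
def Isotropic {K ι : Type*} [CommRing K] [Fintype ι] (w : ι → K) : Prop :=
  ∃ x, x ≠ 0 ∧ diagForm w x = 0

section Pfister

variable {K ι : Type*} [Field K] [Fintype ι]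

theorem diagForm_pfister_nil (x : PfisterIndex 0 → K) :
    diagForm (pfisterWeight []) x = x () ^ 2 := by
  have : diagForm (pfisterWeight []) x = ∑ i : Unit, 1 * x i ^ 2 := rfl
  rw [this]; simp

theorem diagForm_pfister_cons (a : K) (l : List K) (x y : PfisterIndex l.length → K) :
    diagForm (pfisterWeight (a :: l)) (Sum.elim x y : _ ⊕ _ → K) =
      diagForm (pfisterWeight l) x - a * diagForm (pfisterWeight l) y := by
  have : diagForm (pfisterWeight (a :: l)) (Sum.elim x y : _ ⊕ _ → K) =
    ∑ i : PfisterIndex l.length ⊕ PfisterIndex l.length,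
      Sum.elim (pfisterWeight l) (fun i => -a * pfisterWeight l i) i * Sum.elim x y i ^ 2 := rfl
  rw [this, Fintype.sum_sum_type]
  simp only [Sum.elim_inl, Sum.elim_inr, diagForm, Finset.mul_sum, sub_eq_add_neg,
    ← Finset.sum_neg_distrib]
  congr 1
  exact Finset.sum_congr rfl fun i _ => by ring

theorem diagForm_smul (w x : ι → K) (c : K) :
    diagForm w (c • x) = c ^ 2 * diagForm w x := by
  simp only [diagForm, Finset.mul_sum, Pi.smul_apply, smul_eq_mul]
  exact Finset.sum_congr rfl fun i _ => by ring

theorem diagForm_zero (w : ι → K) : diagForm w 0 = 0 := by simp [diagForm]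

theorem diagForm_rotate (w x y : ι → K) (a α β : K) :
    α * diagForm w (x + (a * β) • y) - a * β * diagForm w (x + α • y) =
      (α - a * β) * (diagForm w x - a * (α * β * diagForm w y)) := by
  simp only [diagForm, Finset.mul_sum, Pi.add_apply, Pi.smul_apply, smul_eq_mul,
    ← Finset.sum_sub_distrib]
  exact Finset.sum_congr rfl fun i _ => by ring

theorem represents_pfister_nil {c : K} :
    Represents (pfisterWeight ([] : List K)) c ↔ ∃ x, x ^ 2 = c := by
  constructor
  · rintro ⟨x, hx⟩
    exact ⟨x (), by rw [← hx, diagForm_pfister_nil]⟩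
  · rintro ⟨x, hx⟩
    exact ⟨fun _ => x, by rw [← hx]; exact diagForm_pfister_nil _⟩

theorem represents_pfister_cons {a : K} {l : List K} {c : K} :
    Represents (pfisterWeight (a :: l)) c ↔
      ∃ s t, Represents (pfisterWeight l) s ∧ Represents (pfisterWeight l) t ∧ s - a * t = c := by
  constructor
  · rintro ⟨x, hx⟩
    refine ⟨_, _, ⟨fun i => x (Sum.inl i), rfl⟩, ⟨fun i => x (Sum.inr i), rfl⟩, ?_⟩
    rw [← diagForm_pfister_cons, ← hx]
    congr 1
    funext i
    rcases i with i | i <;> rfl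
  · rintro ⟨_, _, ⟨x, rfl⟩, ⟨y, rfl⟩, rfl⟩
    exact ⟨_, diagForm_pfister_cons a l x y⟩

theorem not_isotropic_pfister_nil : ¬ Isotropic (pfisterWeight ([] : List K)) := by
  rintro ⟨x, hx, h⟩
  have h' : x () ^ 2 = 0 := by rw [← diagForm_pfister_nil]; exact h
  exact hx (funext fun i => by cases i; exact pow_eq_zero_iff (two_ne_zero) |>.1 h')

theorem isotropic_pfister_cons {a : K} {l : List K} :
    Isotropic (pfisterWeight (a :: l)) ↔ Isotropic (pfisterWeight l) ∨
      ∃ t, t ≠ 0 ∧ Represents (pfisterWeight l) t ∧ Represents (pfisterWeight l) (a * t) := by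
  constructor
  · rintro ⟨x, hx, h⟩
    by_cases hl : Isotropic (pfisterWeight l)
    · exact Or.inl hl
    right
    have h2 : diagForm (pfisterWeight l) (fun i => x (Sum.inl i)) -
        a * diagForm (pfisterWeight l) (fun i => x (Sum.inr i)) = 0 := by
      rw [← diagForm_pfister_cons, ← h]
      congr 1
      funext i
      rcases i with i | i <;> rfl
    refine ⟨_, ?_, ⟨fun i => x (Sum.inr i), rfl⟩, ⟨fun i => x (Sum.inl i), sub_eq_zero.1 h2⟩⟩
    intro h3
    rw [h3, mul_zero, sub_zero] at h2
    have h4 : (fun i => x (Sum.inl i)) = 0 := by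
      by_contra h5
      exact hl ⟨_, h5, h2⟩
    have h5 : (fun i => x (Sum.inr i)) = 0 := by
      by_contra h6
      exact hl ⟨_, h6, h3⟩
    refine hx (funext fun i => ?_)
    rcases i with i | i
    · exact congrFun h4 i
    · exact congrFun h5 i
  · rintro (⟨x, hx, h⟩ | ⟨t, ht, ⟨y, hy⟩, ⟨x, hx⟩⟩)
    · refine ⟨Sum.elim x 0, fun h0 => hx (funext fun i => congrFun h0 (Sum.inl i)), ?_⟩
      refine (diagForm_pfister_cons a l x 0).trans ?_
      rw [h, diagForm_zero]; ring
    · refine ⟨Sum.elim x y, fun h0 => ht ?_, ?_⟩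
      · rw [← hy, show y = 0 from funext fun i => congrFun h0 (Sum.inr i), diagForm_zero]
      · refine (diagForm_pfister_cons a l x y).trans ?_
        rw [hx, hy, sub_self]

/-- Pfister forms are round: multiplication by a nonzero value is a similarity. -/
theorem pfister_round (l : List K) {c : K} (hc : c ≠ 0)
    (h : Represents (pfisterWeight l) c) :
    ∃ S : (PfisterIndex l.length → K) → (PfisterIndex l.length → K),
      ∀ x, diagForm (pfisterWeight l) (S x) = c * diagForm (pfisterWeight l) x := by
  induction l generalizing c with
  | nil =>
    obtain ⟨y, hy⟩ := represents_pfister_nil.1 h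
    exact ⟨fun x => y • x, fun x => by rw [diagForm_smul, hy]⟩
  | cons a l ih =>
    obtain ⟨α, β, hα, hβ, rfl⟩ := represents_pfister_cons.1 h
    suffices H : ∀ x y : PfisterIndex l.length → K, ∃ x' y' : PfisterIndex l.length → K,
        diagForm (pfisterWeight l) x' - a * diagForm (pfisterWeight l) y' = (α - a * β) *
          (diagForm (pfisterWeight l) x - a * diagForm (pfisterWeight l) y) by
      choose X Y hXY using H
      refine ⟨fun z => Sum.elim (X (fun i => z (Sum.inl i)) (fun i => z (Sum.inr i)))
        (Y (fun i => z (Sum.inl i)) (fun i => z (Sum.inr i))), fun z => ?_⟩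
      refine (diagForm_pfister_cons a l _ _).trans ?_
      rw [hXY, ← diagForm_pfister_cons]
      congr 2
      funext i
      rcases i with i | i <;> rfl
    intro x y
    by_cases h0 : α = 0
    · subst h0
      have hβ0 : β ≠ 0 := fun h => hc (by rw [h]; ring)
      obtain ⟨S, hS⟩ := ih hβ0 hβ
      refine ⟨a • S y, S x, ?_⟩
      rw [diagForm_smul, hS, hS]; ring
    by_cases h1 : β = 0
    · subst h1
      obtain ⟨S, hS⟩ := ih h0 hα
      refine ⟨S x, S y, ?_⟩
      rw [hS, hS]; ring
    obtain ⟨S, hS⟩ := ih h0 hα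
    obtain ⟨T, hT⟩ := ih h1 hβ
    let y' := (α * β)⁻¹ • S (T y)
    have hy' : diagForm (pfisterWeight l) y = α * β * diagForm (pfisterWeight l) y' := by
      simp only [y']
      rw [diagForm_smul, hS, hT]
      field_simp
    refine ⟨S (x + (a * β) • y'), T (x + α • y'), ?_⟩
    rw [hS, hT, hy', ← diagForm_rotate]
    ring

theorem represents_zero (w : ι → K) : Represents w 0 := ⟨0, diagForm_zero w⟩

theorem Represents.mul_sq {w : ι → K} {c : K} (h : Represents w c) (d : K) :
    Represents w (d ^ 2 * c) := by
  obtain ⟨x, rfl⟩ := h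
  exact ⟨d • x, diagForm_smul _ _ _⟩

theorem Represents.pfister_mul {l : List K} {c d : K} (hc : Represents (pfisterWeight l) c)
    (hd : Represents (pfisterWeight l) d) : Represents (pfisterWeight l) (c * d) := by
  by_cases h : c = 0
  · rw [h, zero_mul]; exact represents_zero _
  obtain ⟨S, hS⟩ := pfister_round l h hc
  obtain ⟨x, rfl⟩ := hd
  exact ⟨S x, hS x⟩

theorem Represents.inv {w : ι → K} {c : K} (hc : Represents w c) : Represents w c⁻¹ := by
  by_cases h : c = 0
  · rw [h, inv_zero]; exact represents_zero _
  have := hc.mul_sq c⁻¹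
  rwa [show c⁻¹ ^ 2 * c = c⁻¹ by field_simp] at this

theorem Represents.pfister_div {l : List K} {c d : K} (hc : Represents (pfisterWeight l) c)
    (hd : Represents (pfisterWeight l) d) : Represents (pfisterWeight l) (c / d) := by
  rw [div_eq_mul_inv]; exact hc.pfister_mul hd.inv

theorem represents_pfister_cons_of_tail {a : K} {l : List K} {c : K}
    (h : Represents (pfisterWeight l) c) : Represents (pfisterWeight (a :: l)) c :=
  represents_pfister_cons.2 ⟨c, 0, h, represents_zero _, by ring⟩

theorem represents_pfister_sq (l : List K) (d : K) : Represents (pfisterWeight l) (d ^ 2) := by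
  induction l with
  | nil => exact represents_pfister_nil.2 ⟨d, rfl⟩
  | cons a l ih => exact represents_pfister_cons_of_tail ih

theorem represents_pfister_one (l : List K) : Represents (pfisterWeight l) 1 := by
  simpa using represents_pfister_sq l (1 : K)

theorem isotropic_pfister_cons_iff {a : K} {l : List K} :
    Isotropic (pfisterWeight (a :: l)) ↔
      Isotropic (pfisterWeight l) ∨ Represents (pfisterWeight l) a := by
  rw [isotropic_pfister_cons]
  refine or_congr Iff.rfl ⟨?_, fun h => ⟨1, one_ne_zero, represents_pfister_one l, by simpa⟩⟩
  rintro ⟨t, ht, h1, h2⟩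
  have := h2.pfister_div h1
  rwa [mul_div_assoc, div_self ht, mul_one] at this

variable {L : Type*} [Field L]

theorem Represents.pfister_map (f : K →+* L) {l : List K} {c : K}
    (h : Represents (pfisterWeight l) c) : Represents (pfisterWeight (l.map f)) (f c) := by
  induction l generalizing c with
  | nil =>
    obtain ⟨x, rfl⟩ := represents_pfister_nil.1 h
    exact represents_pfister_nil.2 ⟨f x, (map_pow f x 2).symm⟩
  | cons a l ih =>
    obtain ⟨s, t, hs, ht, rfl⟩ := represents_pfister_cons.1 h
    exact represents_pfister_cons.2 ⟨f s, f t, ih hs, ih ht, by simp⟩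

theorem Isotropic.pfister_map (f : K →+* L) {l : List K}
    (h : Isotropic (pfisterWeight l)) : Isotropic (pfisterWeight (l.map f)) := by
  induction l with
  | nil => exact absurd h not_isotropic_pfister_nil
  | cons a l ih =>
    rcases isotropic_pfister_cons_iff.1 h with h | h
    · exact isotropic_pfister_cons_iff.2 (Or.inl (ih h))
    · exact isotropic_pfister_cons_iff.2 (Or.inr (h.pfister_map f))

/-- An isotropic Pfister form is universal. -/
theorem Isotropic.pfister_universal (h2 : (2 : K) ≠ 0) {l : List K} (hl : ∀ a ∈ l, a ≠ 0)
    (h : Isotropic (pfisterWeight l)) (c : K) : Represents (pfisterWeight l) c := by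
  induction l generalizing c with
  | nil => exact absurd h not_isotropic_pfister_nil
  | cons a l ih =>
    rcases isotropic_pfister_cons_iff.1 h with h | h
    · exact represents_pfister_cons_of_tail (ih (fun b hb => hl b (List.mem_cons_of_mem _ hb)) h c)
    · have ha : a ≠ 0 := hl a List.mem_cons_self
      refine represents_pfister_cons.2 ⟨((c + 1) / 2) ^ 2, a⁻¹ * ((c - 1) / 2) ^ 2,
        represents_pfister_sq _ _, h.inv.pfister_mul (represents_pfister_sq _ _), ?_⟩
      field_simp
      ring

end Pfister

section NormPrinciple

open Polynomial

variable {F ι : Type*} [Field F] [Fintype ι]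

/-- The diagonal form with weights `w` acquires a nontrivial zero modulo `g`. -/
def IsotropicMod (w : ι → F) (g : F[X]) : Prop :=
  ∃ h : ι → F[X], (∃ i, ¬ g ∣ h i) ∧ g ∣ diagForm (fun i => C (w i)) h

theorem diagForm_poly_degree {w : ι → F} (hw : ¬ Isotropic w) {h : ι → F[X]} (hh : h ≠ 0) :
    ∃ M, (∃ i, h i ≠ 0 ∧ (h i).natDegree = M) ∧
      (diagForm (fun i => C (w i)) h).natDegree = 2 * M ∧
      Represents w (diagForm (fun i => C (w i)) h).leadingCoeff ∧
      diagForm (fun i => C (w i)) h ≠ 0 := by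
  classical
  obtain ⟨i₀, hi₀⟩ := Function.ne_iff.1 hh
  obtain ⟨i, hi, hmax⟩ := Finset.exists_max_image (Finset.univ.filter fun i => h i ≠ 0)
    (fun i => (h i).natDegree) ⟨i₀, by simpa using hi₀⟩
  have hi' : h i ≠ 0 := (Finset.mem_filter.1 hi).2
  have hdeg : ∀ j, (h j).natDegree ≤ (h i).natDegree := fun j => by
    by_cases hj : h j = 0
    · simp [hj]
    · exact hmax j (by simpa using hj)
  set M := (h i).natDegree with hM
  have hco : (diagForm (fun i => C (w i)) h).coeff (2 * M) =
      diagForm w (fun j => (h j).coeff M) := by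
    simp only [diagForm, finsetSum_coeff, coeff_C_mul]
    refine Finset.sum_congr rfl fun j _ => ?_
    rw [coeff_pow_of_natDegree_le (hdeg j)]
  have hle : (diagForm (fun i => C (w i)) h).natDegree ≤ 2 * M := by
    refine natDegree_sum_le_of_forall_le _ _ fun j _ => ?_
    refine (natDegree_C_mul_le _ _).trans (natDegree_pow_le.trans ?_)
    exact Nat.mul_le_mul_left 2 (hdeg j)
  have hne : diagForm w (fun j => (h j).coeff M) ≠ 0 := fun h0 =>
    hw ⟨_, fun h1 => hi' (leadingCoeff_eq_zero.1 (congrFun h1 i)), h0⟩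
  have hnat : (diagForm (fun i => C (w i)) h).natDegree = 2 * M :=
    natDegree_eq_of_le_of_coeff_ne_zero hle (by rwa [hco])
  refine ⟨M, ⟨i, hi', rfl⟩, hnat, ⟨_, by rw [leadingCoeff, hnat, hco]⟩, fun h0 => hne ?_⟩
  rw [← hco, h0, coeff_zero]

theorem represents_eval_of_factors {w : ι → F}
    (hmul : ∀ a b, Represents w a → Represents w b → Represents w (a * b))
    (hone : Represents w 1) (k : F[X]) (hk : k ≠ 0)
    (hf : ∀ q : F[X], q.Monic → Irreducible q → q ∣ k →
      Even q.natDegree ∧ Represents w (q.eval 0)) :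
    Even k.natDegree ∧ Represents w (k.leadingCoeff⁻¹ * k.eval 0) := by
  induction k using WfDvdMonoid.induction_on_irreducible with
  | zero => exact absurd rfl hk
  | unit u hu =>
    obtain ⟨c, hc, rfl⟩ := Polynomial.isUnit_iff.1 hu
    simpa [hc.ne_zero] using hone
  | mul a q ha hq ih =>
    obtain ⟨h1, h2⟩ := ih ha fun r hr hr' hd => hf r hr hr' (hd.mul_left q)
    have hq0 := hq.ne_zero
    have hl : q.leadingCoeff ≠ 0 := leadingCoeff_ne_zero.2 hq0
    obtain ⟨h3, h4⟩ := hf (q * C q.leadingCoeff⁻¹) (monic_mul_leadingCoeff_inv hq0)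
      ((irreducible_mul_leadingCoeff_inv).2 hq)
      (((associated_mul_unit_left q _
        (isUnit_C.2 (isUnit_iff_ne_zero.2 (inv_ne_zero hl)))).dvd).trans
        (dvd_mul_right q a))
    rw [natDegree_mul_leadingCoeff_inv _ hq0] at h3
    refine ⟨by rw [natDegree_mul hq0 ha]; exact h3.add h1, ?_⟩
    have := hmul _ _ h4 h2
    simp only [eval_mul, eval_C, leadingCoeff_mul, mul_inv] at this ⊢
    convert this using 1
    ring

/-- Norm principle for an anisotropic form with multiplicative value set. -/
theorem IsotropicMod.represents_eval {w : ι → F} (hw : ¬ Isotropic w)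
    (hmul : ∀ a b, Represents w a → Represents w b → Represents w (a * b))
    (hone : Represents w 1) {g : F[X]} (hg : g.Monic) (hirr : Irreducible g)
    (h : IsotropicMod w g) : Even g.natDegree ∧ Represents w (g.eval 0) := by
  classical
  induction hn : g.natDegree using Nat.strong_induction_on generalizing g with
  | _ n ih =>
  subst hn
  obtain ⟨h, ⟨i₀, hi₀⟩, hdvd⟩ := h
  have hprime : Prime g := hirr.prime
  -- reduce modulo `g`
  let h₁ : ι → F[X] := fun i => h i %ₘ g
  have hsub : ∀ i, g ∣ h i - h₁ i := fun i =>
    ⟨h i /ₘ g, by rw [sub_eq_iff_eq_add, add_comm]; exact (modByMonic_add_div (h i) g).symm⟩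
  have hi₁ : ¬ g ∣ h₁ i₀ := fun hd => hi₀ ((dvd_sub_left hd).1 (hsub i₀))
  have hdvd₁ : g ∣ diagForm (fun i => C (w i)) h₁ := by
    have : g ∣ diagForm (fun i => C (w i)) h - diagForm (fun i => C (w i)) h₁ := by
      simp only [diagForm, ← Finset.sum_sub_distrib]
      refine Finset.dvd_sum fun i _ => ?_
      rw [← mul_sub, sq_sub_sq]
      exact ((hsub i).mul_left _).mul_left _
    exact (dvd_sub_right hdvd).1 this
  have hdeg₁ : ∀ i, (h₁ i).natDegree < g.natDegree := fun i =>
    natDegree_modByMonic_lt _ hg hirr.ne_one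
  -- divide by the content
  let : NormalizedGCDMonoid F[X] := UniqueFactorizationMonoid.toNormalizedGCDMonoid _
  obtain ⟨h₂, hh₂, hgcd⟩ := Finset.extract_gcd h₁ ⟨i₀, Finset.mem_univ i₀⟩
  set d := Finset.univ.gcd h₁ with hd
  have hne₁ : h₁ i₀ ≠ 0 := fun h0 => hi₁ (h0 ▸ dvd_zero g)
  have hd0 : d ≠ 0 := fun h0 => hne₁ (by rw [hh₂ i₀ (Finset.mem_univ _), h0, zero_mul])
  have hgd : ¬ g ∣ d := fun hgd => hi₁ (hgd.trans (Finset.gcd_dvd (Finset.mem_univ _)))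
  have hform : diagForm (fun i => C (w i)) h₁ = d ^ 2 * diagForm (fun i => C (w i)) h₂ := by
    simp only [diagForm, Finset.mul_sum]
    refine Finset.sum_congr rfl fun i hi => ?_
    rw [hh₂ i hi]; ring
  have hdvd₂ : g ∣ diagForm (fun i => C (w i)) h₂ := by
    rw [hform] at hdvd₁
    exact (hprime.dvd_or_dvd hdvd₁).resolve_left fun h => hgd (hprime.dvd_of_dvd_pow h)
  have hdeg₂ : ∀ i, (h₂ i).natDegree < g.natDegree := fun i => by
    by_cases h0 : h₂ i = 0
    · rw [h0, natDegree_zero]; exact lt_of_le_of_lt (Nat.zero_le _) (hdeg₁ i)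
    · have := hdeg₁ i
      rw [hh₂ i (Finset.mem_univ _), natDegree_mul hd0 h0] at this
      omega
  have hne₂ : h₂ ≠ 0 := fun h0 => hne₁ (by
    rw [hh₂ i₀ (Finset.mem_univ _), h0, Pi.zero_apply, mul_zero])
  obtain ⟨M, ⟨j, hj0, hj⟩, hM, hlc, hne⟩ := diagForm_poly_degree hw hne₂
  obtain ⟨k, hk⟩ := hdvd₂
  have hk0 : k ≠ 0 := fun h0 => hne (by rw [hk, h0, mul_zero])
  have hkdeg : g.natDegree + k.natDegree = 2 * M := by
    rw [← hM, hk, natDegree_mul hirr.ne_zero hk0]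
  have hjlt := hdeg₂ j
  have hfac : ∀ q : F[X], q.Monic → Irreducible q → q ∣ k →
      Even q.natDegree ∧ Represents w (q.eval 0) := fun q hqm hqi hqk => by
    have hle := natDegree_le_of_dvd hqk hk0
    refine ih q.natDegree (by omega) hqm hqi ⟨h₂, ?_, hk ▸ hqk.mul_left g⟩ rfl
    by_contra hall
    push Not at hall
    exact hqi.not_isUnit (isUnit_of_dvd_one (hgcd ▸ Finset.dvd_gcd fun i _ => hall i))
  obtain ⟨hev, hrep⟩ := represents_eval_of_factors hmul hone k hk0 hfac
  have hX : k.eval 0 ≠ 0 := fun h0 => by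
    have := (hfac X monic_X irreducible_X (X_dvd_iff.2 (by rwa [coeff_zero_eq_eval_zero]))).1
    rw [natDegree_X] at this
    exact absurd this (by decide)
  refine ⟨?_, ?_⟩
  · have : Even (g.natDegree + k.natDegree) := hkdeg ▸ even_two_mul M
    exact (Nat.even_add.1 this).2 hev
  · have hlck : k.leadingCoeff = (diagForm (fun i => C (w i)) h₂).leadingCoeff := by
      rw [hk, leadingCoeff_mul, hg.leadingCoeff, one_mul]
    have hl0 : k.leadingCoeff ≠ 0 := leadingCoeff_ne_zero.2 hk0
    have h5 : Represents w (k.eval 0) := by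
      have := hmul _ _ (hlck ▸ hlc) hrep
      rwa [mul_inv_cancel_left₀ hl0] at this
    have h6 : Represents w (g.eval 0 * k.eval 0) := by
      refine ⟨fun i => (h₂ i).eval 0, ?_⟩
      rw [← eval_mul, ← hk]
      simp [diagForm, eval_finsetSum]
    have := hmul _ _ h6 h5.inv
    rwa [mul_inv_cancel_right₀ hX] at this

theorem isotropicMod_of_isotropic_adjoinRoot {l : List F} {g : F[X]} [Fact (Irreducible g)]
    (h : Isotropic (pfisterWeight (l.map (AdjoinRoot.of g)))) :
    Isotropic (pfisterWeight l) ∨ IsotropicMod (pfisterWeight l) g := by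
  have key : ∀ (l : List F) (c : AdjoinRoot g),
      Represents (pfisterWeight (l.map (AdjoinRoot.of g))) c →
      ∃ h : PfisterIndex l.length → F[X],
        AdjoinRoot.mk g (diagForm (fun i => C (pfisterWeight l i)) h) = c := by
    intro l
    induction l with
    | nil =>
      intro c hc
      obtain ⟨x, rfl⟩ := represents_pfister_nil.1 hc
      obtain ⟨y, rfl⟩ := AdjoinRoot.mk_surjective x
      refine ⟨fun _ => y, ?_⟩
      rw [← map_pow]
      congr 1
      have : diagForm (fun i => C (pfisterWeight ([] : List F) i)) (fun _ => y) =
        ∑ i : Unit, C 1 * y ^ 2 := rfl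
      rw [this]; simp
    | cons a l ih =>
      intro c hc
      obtain ⟨s, t, hs, ht, rfl⟩ := represents_pfister_cons.1 hc
      obtain ⟨x, rfl⟩ := ih s hs
      obtain ⟨y, rfl⟩ := ih t ht
      refine ⟨(Sum.elim x y : _ ⊕ _ → F[X]), ?_⟩
      have : diagForm (fun i => C (pfisterWeight (a :: l) i)) (Sum.elim x y : _ ⊕ _ → F[X]) =
        ∑ i : PfisterIndex l.length ⊕ PfisterIndex l.length,
          C (Sum.elim (pfisterWeight l) (fun i => -a * pfisterWeight l i) i) *
            Sum.elim x y i ^ 2 := rfl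
      rw [this, Fintype.sum_sum_type, ← AdjoinRoot.mk_C, ← map_mul, ← map_sub]
      congr 1
      simp only [Sum.elim_inl, Sum.elim_inr, diagForm, Finset.mul_sum, sub_eq_add_neg,
        ← Finset.sum_neg_distrib]
      congr 1
      exact Finset.sum_congr rfl fun i _ => by rw [C_mul, C_neg]; ring
  induction l with
  | nil => exact absurd h not_isotropic_pfister_nil
  | cons a l ih =>
    rcases isotropic_pfister_cons_iff.1 h with h | h
    · rcases ih h with h | ⟨x, ⟨i, hi⟩, hx⟩
      · exact Or.inl (isotropic_pfister_cons_iff.2 (Or.inl h))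
      · right
        refine ⟨(Sum.elim x 0 : _ ⊕ _ → F[X]), ⟨Sum.inl i, hi⟩, ?_⟩
        have : diagForm (fun i => C (pfisterWeight (a :: l) i)) (Sum.elim x 0 : _ ⊕ _ → F[X]) =
          ∑ i : PfisterIndex l.length ⊕ PfisterIndex l.length,
            C (Sum.elim (pfisterWeight l) (fun i => -a * pfisterWeight l i) i) *
              Sum.elim x 0 i ^ 2 := rfl
        rw [this, Fintype.sum_sum_type]
        simpa [diagForm] using hx
    · right
      obtain ⟨x, hx⟩ := key l _ h
      obtain ⟨y, hy⟩ := key l _ (represents_pfister_one _)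
      refine ⟨(Sum.elim x y : _ ⊕ _ → F[X]), ?_, ?_⟩
      · by_contra hall
        push Not at hall
        have h1 : AdjoinRoot.mk g (diagForm (fun i => C (pfisterWeight l i)) y) = 0 := by
          rw [AdjoinRoot.mk_eq_zero]
          exact Finset.dvd_sum fun i _ =>
            ((hall (Sum.inr i)).trans (dvd_pow_self _ two_ne_zero)).mul_left _
        rw [hy] at h1
        exact one_ne_zero h1
      · have : diagForm (fun i => C (pfisterWeight (a :: l) i)) (Sum.elim x y : _ ⊕ _ → F[X]) =
          ∑ i : PfisterIndex l.length ⊕ PfisterIndex l.length,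
            C (Sum.elim (pfisterWeight l) (fun i => -a * pfisterWeight l i) i) *
              Sum.elim x y i ^ 2 := rfl
        rw [this, ← AdjoinRoot.mk_eq_zero, Fintype.sum_sum_type]
        have h2 : AdjoinRoot.mk g (diagForm (fun i => C (pfisterWeight l i)) x -
            C a * diagForm (fun i => C (pfisterWeight l i)) y) = 0 := by
          rw [map_sub, map_mul, hx, hy, AdjoinRoot.mk_C, mul_one, sub_self]
        rw [← h2]
        congr 1
        simp only [Sum.elim_inl, Sum.elim_inr, diagForm, Finset.mul_sum, sub_eq_add_neg,
          ← Finset.sum_neg_distrib]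
        congr 1
        exact Finset.sum_congr rfl fun i _ => by rw [C_mul, C_neg]; ring

end NormPrinciple

section NormPrincipleFields

open Polynomial IntermediateField

theorem norm_represents_of_generator {k M : Type*} {F : Type u} [Field k] [Field M] [Field F]
    [Algebra k M] [FiniteDimensional k M] [Algebra k F] (h2 : (2 : F) ≠ 0) (l : List F)
    (hl : ∀ a ∈ l, a ≠ 0)
    (H : ∀ (E : Type u) [Field E] (ι : F →+* E) (τ : M →+* E),
      τ.comp (algebraMap k M) = ι.comp (algebraMap k F) → Isotropic (pfisterWeight (l.map ι)))
    (x : M) (hx : k⟮x⟯ = ⊤) :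
    Represents (pfisterWeight l) (algebraMap k F (Algebra.norm k x)) := by
  by_cases hw : Isotropic (pfisterWeight l)
  · exact hw.pfister_universal h2 hl _
  have hInt : IsIntegral k x := IsIntegral.of_finite k x
  have hmon := minpoly.monic hInt
  have hmap : ((minpoly k x).map (algebraMap k F)).Monic := hmon.map _
  have hfac := represents_eval_of_factors (w := pfisterWeight l)
    (fun a b ha hb => ha.pfister_mul hb) (represents_pfister_one l)
    ((minpoly k x).map (algebraMap k F)) hmap.ne_zero (fun q hq hirr hdvd => by
      refine IsotropicMod.represents_eval hw (fun a b ha hb => ha.pfister_mul hb)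
        (represents_pfister_one l) hq hirr ?_
      have : Fact (Irreducible q) := ⟨hirr⟩
      refine (isotropicMod_of_isotropic_adjoinRoot ?_).resolve_left hw
      let : Algebra k (AdjoinRoot q) := ((AdjoinRoot.of q).comp (algebraMap k F)).toAlgebra
      have hroot : aeval (AdjoinRoot.root q) (minpoly k x) = 0 := by
        rw [aeval_def]
        change eval₂ ((AdjoinRoot.of q).comp (algebraMap k F)) _ _ = 0
        rw [← eval₂_map]
        obtain ⟨r, hr⟩ := hdvd
        rw [hr, eval₂_mul, AdjoinRoot.eval₂_root, zero_mul]
      let τ₀ : k⟮x⟯ →ₐ[k] AdjoinRoot q :=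
        (adjoin.powerBasis hInt).lift (AdjoinRoot.root q) (by
          rw [adjoin.powerBasis_gen, minpoly_gen]
          exact hroot)
      let τ : M →ₐ[k] AdjoinRoot q :=
        τ₀.comp ((IntermediateField.topEquiv.symm.trans
          (IntermediateField.equivOfEq hx.symm)).toAlgHom)
      exact H (AdjoinRoot q) (AdjoinRoot.of q) τ (by ext a; exact τ.commutes a))
  obtain ⟨hev, hrep⟩ := hfac
  rw [hmap.leadingCoeff, inv_one, one_mul, eval_map] at hrep
  rw [hmon.natDegree_map] at hev
  have hnorm : Algebra.norm k x = (minpoly k x).coeff 0 := by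
    have hpb := Algebra.PowerBasis.norm_gen_eq_coeff_zero_minpoly
      ((adjoin.powerBasis hInt).map ((IntermediateField.equivOfEq hx).trans
        IntermediateField.topEquiv))
    have hgen : ((adjoin.powerBasis hInt).map ((IntermediateField.equivOfEq hx).trans
        IntermediateField.topEquiv)).gen = x := by
      simp [adjoin.powerBasis_gen]
    have hdim : ((adjoin.powerBasis hInt).map ((IntermediateField.equivOfEq hx).trans
        IntermediateField.topEquiv)).dim = (minpoly k x).natDegree := by
      simp [adjoin.powerBasis_dim]
    rw [hgen, hdim, hev.neg_one_pow, one_mul] at hpb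
    exact hpb
  rw [hnorm]
  rwa [eval₂_at_zero] at hrep

theorem exists_generator_mul {k M : Type*} [Field k] [Field M] [CharZero k]
    [Algebra k M] [FiniteDimensional k M] {x : M} (hx : x ≠ 0) :
    ∃ y : M, y ≠ 0 ∧ k⟮y⟯ = ⊤ ∧ k⟮x * y⟯ = ⊤ := by
  have : CharZero M := charZero_of_injective_algebraMap (algebraMap k M).injective
  obtain ⟨θ, hθ⟩ := Field.exists_primitive_element k M
  have : Finite (IntermediateField k M) :=
    Field.finite_intermediateField_of_exists_primitive_element k M ⟨θ, hθ⟩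
  obtain ⟨L, hL⟩ := Finite.exists_infinite_fiber
    (fun m : ℕ => k⟮x * (θ + (m : M))⟯)
  rw [Set.infinite_coe_iff] at hL
  have hfin : {m : ℕ | θ + (m : M) = 0}.Finite := by
    refine Set.Subsingleton.finite fun a ha b hb => ?_
    have : (a : M) = b := add_left_cancel (ha.trans hb.symm)
    exact_mod_cast this
  obtain ⟨a, ha, b, hb, hab⟩ := (hL.sdiff hfin).nontrivial
  have ha' : k⟮x * (θ + (a : M))⟯ = L := ha.1
  have hb' : k⟮x * (θ + (b : M))⟯ = L := hb.1
  refine ⟨θ + a, ha.2, ?_, ?_⟩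
  · rw [eq_top_iff, ← hθ, adjoin_simple_le_iff]
    have h1 : θ + (a : M) ∈ k⟮θ + (a : M)⟯ := mem_adjoin_simple_self k _
    have := sub_mem h1 (IntermediateField.natCast_mem k⟮θ + (a : M)⟯ a)
    rwa [add_sub_cancel_right] at this
  · rw [ha']
    have h1 : x * (θ + (a : M)) ∈ L := ha' ▸ mem_adjoin_simple_self k _
    have h2 : x * (θ + (b : M)) ∈ L := hb' ▸ mem_adjoin_simple_self k _
    have hab' : (a : M) - b ≠ 0 := sub_ne_zero.2 (by exact_mod_cast hab)
    have h3 : x ∈ L := by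
      have := div_mem (sub_mem h1 h2)
        (sub_mem (IntermediateField.natCast_mem L a) (IntermediateField.natCast_mem L b))
      rwa [show (x * (θ + (a : M)) - x * (θ + (b : M))) / ((a : M) - b) = x by
        field_simp; ring] at this
    rw [eq_top_iff, ← hθ, adjoin_simple_le_iff]
    have := sub_mem (div_mem h1 h3) (IntermediateField.natCast_mem L a)
    rwa [mul_div_cancel_left₀ _ hx, add_sub_cancel_right] at this

/-- Norm principle: if a Pfister form over `F` becomes isotropic over every common extension of
`F` and `M` compatible with `k`, then it represents all norms from `M` to `k`. -/
theorem norm_represents {k M : Type*} {F : Type u} [Field k] [Field M] [Field F] [CharZero k]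
    [Algebra k M] [FiniteDimensional k M] [Algebra k F] (l : List F)
    (hl : ∀ a ∈ l, a ≠ 0)
    (H : ∀ (E : Type u) [Field E] (ι : F →+* E) (τ : M →+* E),
      τ.comp (algebraMap k M) = ι.comp (algebraMap k F) → Isotropic (pfisterWeight (l.map ι)))
    (x : M) :
    Represents (pfisterWeight l) (algebraMap k F (Algebra.norm k x)) := by
  have : CharZero F := charZero_of_injective_algebraMap (algebraMap k F).injective
  by_cases hx : x = 0
  · rw [hx, Algebra.norm_zero, map_zero]; exact represents_zero _
  obtain ⟨y, hy0, hy, hxy⟩ := exists_generator_mul (k := k) hx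
  have h1 := norm_represents_of_generator two_ne_zero l hl H _ hy
  have h2 := norm_represents_of_generator two_ne_zero l hl H _ hxy
  have h3 := h2.pfister_div h1
  rwa [map_mul, map_mul, mul_div_cancel_right₀] at h3
  rw [Ne, map_eq_zero, Algebra.norm_eq_zero_iff]
  exact hy0

end NormPrincipleFields

section Legendre

theorem exists_short_congruent {A b : ℕ} (hA : 0 < A) (hb : 0 < b) (α : ZMod b) (β : ZMod A) :
    ∃ x y z : ℤ, (x, y, z) ≠ 0 ∧ x ^ 2 ≤ A * b ∧ y ^ 2 ≤ b ∧ z ^ 2 ≤ A ∧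
      (x : ZMod A) = β * z ∧ (x : ZMod b) = α * y := by
  have : NeZero A := ⟨hA.ne'⟩
  have : NeZero b := ⟨hb.ne'⟩
  let f : Fin (Nat.sqrt (A * b) + 1) × Fin (Nat.sqrt b + 1) × Fin (Nat.sqrt A + 1) →
      ZMod A × ZMod b := fun t => ((t.1 : ℕ) - β * (t.2.2 : ℕ), (t.1 : ℕ) - α * (t.2.1 : ℕ))
  have hcard : Fintype.card (ZMod A × ZMod b) <
      Fintype.card (Fin (Nat.sqrt (A * b) + 1) × Fin (Nat.sqrt b + 1) × Fin (Nat.sqrt A + 1)) := by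
    simp only [Fintype.card_prod, ZMod.card, Fintype.card_fin]
    have h1 := Nat.lt_succ_sqrt (A * b)
    have h2 := Nat.lt_succ_sqrt A
    have h3 := Nat.lt_succ_sqrt b
    simp only [Nat.succ_eq_add_one] at h1 h2 h3
    refine lt_of_pow_lt_pow_left₀ 2 (Nat.zero_le _) ?_
    have h23 := Nat.mul_lt_mul'' h2 h3
    have := Nat.mul_lt_mul'' h1 h23
    nlinarith [this]
  obtain ⟨s, t, hst, hf⟩ := Fintype.exists_ne_map_eq_of_card_lt f hcard
  have bound : ∀ {n : ℕ} (i j : Fin (Nat.sqrt n + 1)), ((i : ℤ) - j) ^ 2 ≤ n := by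
    intro n i j
    have hs : ((Nat.sqrt n : ℕ) : ℤ) ^ 2 ≤ n := by exact_mod_cast Nat.sqrt_le' n
    have hi : (i : ℤ) ≤ Nat.sqrt n := by exact_mod_cast Nat.lt_succ_iff.1 i.2
    have hj : (j : ℤ) ≤ Nat.sqrt n := by exact_mod_cast Nat.lt_succ_iff.1 j.2
    have hi0 : (0 : ℤ) ≤ i := by positivity
    have hj0 : (0 : ℤ) ≤ j := by positivity
    refine le_trans ?_ hs
    exact sq_le_sq' (by linarith) (by linarith)
  refine ⟨(s.1 : ℤ) - t.1, (s.2.1 : ℤ) - t.2.1, (s.2.2 : ℤ) - t.2.2, ?_, ?_, bound _ _,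
    bound _ _, ?_, ?_⟩
  · intro h
    simp only [Prod.mk_eq_zero, sub_eq_zero, Nat.cast_inj] at h
    exact hst (Prod.ext (Fin.ext h.1) (Prod.ext (Fin.ext h.2.1) (Fin.ext h.2.2)))
  · have := bound s.1 t.1
    push_cast at this
    exact this
  · have := congrArg Prod.fst hf
    simp only [f] at this
    push_cast
    linear_combination this
  · have := congrArg Prod.snd hf
    simp only [f] at this
    push_cast
    linear_combination this

/-- A Legendre-type criterion for the solvability of `x² - a y² = b z²`. -/
theorem exists_norm_form_eq {a : ℤ} {b : ℕ} (hb : 0 < b) (hab : IsCoprime a b)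
    (ha : ¬ IsSquare a.natAbs) (h1 : IsSquare (a : ZMod b))
    (h2 : IsSquare (b : ZMod a.natAbs)) :
    ∃ x y z : ℤ, z ≠ 0 ∧ x ^ 2 - a * y ^ 2 = b * z ^ 2 := by
  by_cases hbs : IsSquare b
  · obtain ⟨s, rfl⟩ := hbs
    exact ⟨s, 0, 1, one_ne_zero, by push_cast; ring⟩
  have ha0 : a ≠ 0 := fun h => ha (by rw [h]; exact ⟨0, rfl⟩)
  have hA : 0 < a.natAbs := Int.natAbs_pos.2 ha0
  obtain ⟨α, hα⟩ := h1
  obtain ⟨β, hβ⟩ := h2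
  obtain ⟨x, y, z, hne, hx, hy, hz, hxA, hxb⟩ := exists_short_congruent hA hb α β
  have hnsq : ∀ {n : ℕ}, ¬ IsSquare n → ∀ t : ℤ, t ^ 2 ≠ n := fun hn t ht =>
    hn ⟨t.natAbs, by zify; rw [← ht, ← sq, sq_abs]⟩
  have hz' : z ^ 2 < a.natAbs := lt_of_le_of_ne hz (hnsq ha z)
  have hy' : y ^ 2 < b := lt_of_le_of_ne hy (hnsq hbs y)
  have hnotzero : ∀ x y z : ℤ, (x, y, z) ≠ 0 → x ^ 2 - a * y ^ 2 = b * z ^ 2 → z ≠ 0 := by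
    rintro x y z hne h rfl
    have h : x ^ 2 = a * y ^ 2 := by linear_combination h
    by_cases hy0 : y = 0
    · subst hy0
      have : x = 0 := by
        have : x ^ 2 = 0 := by rw [h]; ring
        exact pow_eq_zero_iff two_ne_zero |>.1 this
      exact hne (by simp [this])
    · obtain ⟨c, rfl⟩ : y ∣ x := (Int.pow_dvd_pow_iff two_ne_zero).1 ⟨a, by rw [h]; ring⟩
      have : a = c ^ 2 := mul_right_cancel₀ (pow_ne_zero 2 hy0) (by linear_combination -h)
      exact ha ⟨c.natAbs, by rw [this, Int.natAbs_pow, sq]⟩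
  have hdvd : a * b ∣ x ^ 2 - a * y ^ 2 - b * z ^ 2 := by
    refine hab.mul_dvd ?_ ?_
    · rw [← Int.natAbs_dvd, ← ZMod.intCast_zmod_eq_zero_iff_dvd]
      have : ((a : ℤ) : ZMod a.natAbs) = 0 := by
        rw [ZMod.intCast_zmod_eq_zero_iff_dvd, Int.natAbs_dvd]
      push_cast
      rw [this, hxA, hβ]; ring
    · rw [← ZMod.intCast_zmod_eq_zero_iff_dvd]
      push_cast
      rw [hxb, hα, ZMod.natCast_self]; ring
  obtain ⟨c, hc⟩ := hdvd
  have hsol : x ^ 2 - a * y ^ 2 - b * z ^ 2 = 0 ∨ x ^ 2 - a * y ^ 2 - b * z ^ 2 = -(a * b) := by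
    have hb' : (0 : ℤ) < b := by exact_mod_cast hb
    have hxne : (x ^ 2 : ℤ) = a.natAbs * b → False := fun h => by
      have h' : x.natAbs ^ 2 = a.natAbs * b := by zify; rw [sq_abs, h]; simp
      have hcop : IsCoprime ((b : ℕ) : ℤ) ((a.natAbs : ℕ) : ℤ) := by
        rw [Nat.isCoprime_iff_coprime, Nat.coprime_comm]
        have := Int.isCoprime_iff_gcd_eq_one.1 hab
        simpa [Int.gcd] using this
      obtain ⟨d, hd⟩ := Int.sq_of_isCoprime hcop (c := x)
        (by rw [h]; ring)
      rcases hd with hd | hd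
      · exact hnsq hbs d hd.symm
      · nlinarith [sq_nonneg d]
    have hx' : x ^ 2 < a.natAbs * b := lt_of_le_of_ne hx fun h => hxne h
    rcases lt_trichotomy a 0 with hneg | h0 | hpos
    · have habs : ((a.natAbs : ℕ) : ℤ) = -a := by rw [Int.natCast_natAbs, abs_of_neg hneg]
      rw [habs] at hx' hz'
      have hab0 : 0 < -a * b := mul_pos (by linarith) hb'
      have l1 : a * b * c < 2 * (-a * b) := by
        rw [← hc]; nlinarith [sq_nonneg z]
      have l2 : -(-a * b) < a * b * c := by
        rw [← hc]; nlinarith [sq_nonneg x, sq_nonneg y]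
      have c1 : -2 < c := by nlinarith
      have c2 : c < 1 := by nlinarith
      have : c = 0 ∨ c = -1 := by omega
      rcases this with rfl | rfl
      · left; rw [hc]; ring
      · right; rw [hc]; ring
    · exact absurd h0 ha0
    · have habs : ((a.natAbs : ℕ) : ℤ) = a := by rw [Int.natCast_natAbs, abs_of_pos hpos]
      rw [habs] at hx' hz'
      have hab0 : 0 < a * b := mul_pos hpos hb'
      have l1 : a * b * c < a * b := by
        rw [← hc]; nlinarith [sq_nonneg z, sq_nonneg y]
      have l2 : -2 * (a * b) < a * b * c := by
        rw [← hc]; nlinarith [sq_nonneg x]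
      have c1 : -2 < c := by nlinarith
      have c2 : c < 1 := by nlinarith
      have : c = 0 ∨ c = -1 := by omega
      rcases this with rfl | rfl
      · left; rw [hc]; ring
      · right; rw [hc]; ring
  rcases hsol with h | h
  · have h' : x ^ 2 - a * y ^ 2 = b * z ^ 2 := by linarith
    exact ⟨x, y, z, hnotzero x y z hne h', h'⟩
  · refine ⟨x * z + a * y, x + y * z, z ^ 2 - a, fun h0 => ?_, ?_⟩
    · have : a = z ^ 2 := by linarith
      exact ha ⟨z.natAbs, by rw [this, Int.natAbs_pow, sq]⟩
    · linear_combination (z ^ 2 - a) * h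

end Legendre

section Certificates

theorem exists_auxiliary_prime {p n r : ℕ} [Fact p.Prime] (hp : p % 8 = 1) (hn : 0 < n)
    (hr : r.Prime) (hr2 : r ≠ 2) (hpn : ¬ p ∣ n) (hrn : ¬ r ∣ n) (N : ℕ) :
    ∃ q : ℕ, N < q ∧ q.Prime ∧ q ≡ p [MOD 8 * n] ∧ q ≡ 1 [MOD p * r] := by
  have hp' : p.Prime := Fact.out
  have hp2 : p ≠ 2 := by rintro rfl; omega
  have cop8 : ∀ {s : ℕ}, s.Prime → s ≠ 2 → ¬ s ∣ n → Nat.Coprime (8 * n) s := by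
    intro s hs hs2 hsn
    refine (Nat.Coprime.mul_left ?_ ((Nat.Prime.coprime_iff_not_dvd hs).2 hsn).symm)
    have : Nat.Coprime 2 s := (Nat.coprime_primes Nat.prime_two hs).2 (Ne.symm hs2)
    exact Nat.Coprime.pow_left 3 this
  have hcop : Nat.Coprime (8 * n) (p * r) :=
    Nat.Coprime.mul_right (cop8 hp' hp2 hpn) (cop8 hr hr2 hrn)
  obtain ⟨c, hc1, hc2⟩ := Nat.chineseRemainder hcop p 1
  have hN0 : (8 * n) * (p * r) ≠ 0 := by
    have := hp'.pos; have := hr.pos; positivity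
  have : NeZero ((8 * n) * (p * r)) := ⟨hN0⟩
  have hunit : IsUnit (c : ZMod ((8 * n) * (p * r))) := by
    rw [ZMod.isUnit_iff_coprime]
    refine Nat.Coprime.mul_right ?_ ?_
    · rw [Nat.Coprime, Nat.ModEq.gcd_eq hc1]
      exact (cop8 hp' hp2 hpn).symm
    · rw [Nat.Coprime, Nat.ModEq.gcd_eq hc2, Nat.gcd_one_left]
  obtain ⟨q, hqN, hq, hqc⟩ := Nat.forall_exists_prime_gt_and_eq_mod hunit N
  have hmod : q ≡ c [MOD (8 * n) * (p * r)] := (ZMod.natCast_eq_natCast_iff _ _ _).1 hqc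
  exact ⟨q, hqN, hq, (hmod.of_mul_right _).trans hc1, (hmod.of_mul_left _).trans hc2⟩

theorem ZMod.isSquare_natCast_mul {m n a : ℕ} (h : Nat.Coprime m n)
    (hm : IsSquare (a : ZMod m)) (hn : IsSquare (a : ZMod n)) : IsSquare (a : ZMod (m * n)) := by
  obtain ⟨x, hx⟩ := hm
  obtain ⟨y, hy⟩ := hn
  let e := ZMod.chineseRemainder h
  refine ⟨e.symm (x, y), e.injective ?_⟩
  rw [map_mul, RingEquiv.apply_symm_apply, map_natCast]
  exact Prod.ext hx hy

theorem Nat.Prime.not_isSquare_mul {p m : ℕ} (hp : p.Prime) (h : ¬ p ∣ m) :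
    ¬ IsSquare (p * m) := by
  rintro ⟨s, hs⟩
  obtain ⟨t, rfl⟩ : p ∣ s := by
    have : p ∣ s * s := ⟨m, hs.symm⟩
    exact (hp.dvd_mul.1 this).elim id id
  exact h ⟨t * t, Nat.eq_of_mul_eq_mul_left hp.pos (by rw [hs]; ring)⟩

/-- The norm equations solvable for suitable `q` when `n` is a quadratic residue modulo `p`. -/
theorem exists_certificate_of_residue {p r n : ℕ} [Fact p.Prime] (hp : p % 8 = 1)
    (hr : r.Prime) (hr2 : r ≠ 2) (hrp : r ≠ p) (hn : 0 < n) (hrn : ¬ r ∣ n)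
    (hnp : legendreSym p n = 1) :
    ∃ q : ℕ, 0 < q ∧ (∃ x y z : ℤ, z ≠ 0 ∧ x ^ 2 + p * y ^ 2 = q * z ^ 2) ∧
      (∃ x y z : ℤ, z ≠ 0 ∧ x ^ 2 + p * r * y ^ 2 = q * z ^ 2) ∧
      (∃ x y z : ℤ, z ≠ 0 ∧ x ^ 2 - p * q * y ^ 2 = n * z ^ 2) := by
  have hp' : p.Prime := Fact.out
  have : Fact r.Prime := ⟨hr⟩
  have hpn : ¬ p ∣ n := fun h => by
    have : legendreSym p n = 0 := (legendreSym.eq_zero_iff p n).2 (by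
      rw [Int.cast_natCast, ZMod.natCast_eq_zero_iff]; exact h)
    omega
  obtain ⟨q, hqN, hq, hq1, hq2⟩ := exists_auxiliary_prime hp hn hr hr2 hpn hrn (p * n * r)
  have : Fact q.Prime := ⟨hq⟩
  have hn1 : 1 ≤ n := hn
  have hp1 := hp'.one_lt
  have hr1 := hr.one_lt
  have hpq : p < q := by nlinarith [Nat.mul_le_mul hp1.le hn1, mul_pos hp'.pos hn]
  have hrq : r < q := by nlinarith [mul_pos hp'.pos hn]
  have hnq : n < q := by nlinarith [mul_pos hr.pos hn]
  have hq8 : q % 8 = 1 := by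
    have := hq1.of_mul_right n
    rw [Nat.ModEq, hp] at this; exact this
  have hp2 : p ≠ 2 := by rintro rfl; omega
  have hq2' : q ≠ 2 := by rintro rfl; omega
  have neg_sq : IsSquare (-1 : ZMod q) := ZMod.exists_sq_eq_neg_one_iff.2 (by omega)
  have sq_of : ∀ s : ℕ, s.Prime → s ≠ 2 → s < q → q ≡ 1 [MOD s] → IsSquare (s : ZMod q) := by
    intro s hs hs2 hsq hmod
    have : Fact s.Prime := ⟨hs⟩
    have h1 : legendreSym q s = 1 := by
      rw [← legendreSym.quadratic_reciprocity_one_mod_four (p := q) (q := s) (by omega) hs2]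
      rw [legendreSym.eq_one_iff' s]
      · rw [(ZMod.natCast_eq_natCast_iff _ _ _).2 hmod]; exact ⟨1, by simp⟩
      · rw [(ZMod.natCast_eq_natCast_iff _ _ _).2 hmod]; simp
    refine (legendreSym.eq_one_iff' q ?_).1 h1
    rw [Ne, ZMod.natCast_eq_zero_iff]
    exact fun h => absurd (Nat.le_of_dvd hs.pos h) (by omega)
  have sqp := sq_of p hp' hp2 hpq (hq2.of_mul_right r)
  have sqr := sq_of r hr hr2 hrq (hq2.of_mul_left p)
  have cop : ∀ s : ℕ, 0 < s → s < q → Nat.Coprime s q := fun s hs hsq =>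
    (Nat.Coprime.symm ((Nat.Prime.coprime_iff_not_dvd hq).2
      fun h => absurd (Nat.le_of_dvd hs h) (by omega)))
  refine ⟨q, hq.pos, ?_, ?_, ?_⟩
  · obtain ⟨x, y, z, hz, h⟩ := exists_norm_form_eq (a := -(p : ℤ)) (b := q) hq.pos
      (by rw [IsCoprime.neg_left_iff, Nat.isCoprime_iff_coprime]; exact cop p hp'.pos hpq)
      (by
        rw [Int.natAbs_neg, Int.natAbs_natCast]
        have := hp'.not_isSquare_mul (m := 1) (by simpa using hp'.ne_one)
        rwa [mul_one] at this)
      (by push_cast; rw [neg_eq_neg_one_mul]; exact neg_sq.mul sqp)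
      (by
        rw [Int.natAbs_neg, Int.natAbs_natCast,
          (ZMod.natCast_eq_natCast_iff _ _ _).2 (hq2.of_mul_right r)]
        exact ⟨1, by simp⟩)
    exact ⟨x, y, z, hz, by rw [← h]; ring⟩
  · obtain ⟨x, y, z, hz, h⟩ := exists_norm_form_eq (a := -((p * r : ℕ) : ℤ)) (b := q) hq.pos
      (by
        rw [IsCoprime.neg_left_iff, Nat.isCoprime_iff_coprime]
        exact (cop p hp'.pos hpq).mul_left (cop r hr.pos hrq))
      (by
        rw [Int.natAbs_neg, Int.natAbs_natCast]
        exact hp'.not_isSquare_mul fun h => hrp ((Nat.prime_dvd_prime_iff_eq hp' hr).1 h).symm)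
      (by push_cast; rw [neg_eq_neg_one_mul]; exact neg_sq.mul (sqp.mul sqr))
      (by
        rw [Int.natAbs_neg, Int.natAbs_natCast, (ZMod.natCast_eq_natCast_iff _ _ _).2 hq2]
        exact ⟨1, by simp⟩)
    exact ⟨x, y, z, hz, by rw [← h]; push_cast; ring⟩
  · have hcopn : Nat.Coprime p n := (Nat.Prime.coprime_iff_not_dvd hp').2 hpn
    obtain ⟨x, y, z, hz, h⟩ := exists_norm_form_eq (a := ((p * q : ℕ) : ℤ)) (b := n) hn
      (by
        rw [Nat.isCoprime_iff_coprime]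
        exact hcopn.mul_left (cop n hn hnq).symm)
      (by
        rw [Int.natAbs_natCast]
        exact hp'.not_isSquare_mul fun h =>
          absurd ((Nat.prime_dvd_prime_iff_eq hp' hq).1 h) hpq.ne)
      (by
        push_cast
        rw [(ZMod.natCast_eq_natCast_iff q p n).2 (hq1.of_mul_left 8)]
        exact ⟨_, rfl⟩)
      (by
        rw [Int.natAbs_natCast]
        refine ZMod.isSquare_natCast_mul (cop p hp'.pos hpq) ?_ ?_
        · refine (legendreSym.eq_one_iff' p ?_).1 hnp
          rwa [Ne, ZMod.natCast_eq_zero_iff]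
        · refine (legendreSym.eq_one_iff' q ?_).1 ?_
          · rw [Ne, ZMod.natCast_eq_zero_iff]
            exact fun h => absurd (Nat.le_of_dvd hn h) (by omega)
          · rw [jacobiSym.legendreSym.to_jacobiSym,
              jacobiSym.mod_right _ (Nat.odd_iff.2 (by omega))]
            have : q % (4 * (n : ℤ).natAbs) = p % (4 * (n : ℤ).natAbs) := by
              rw [Int.natAbs_natCast]
              have : q ≡ p [MOD 2 * (4 * n)] := by rwa [show 2 * (4 * n) = 8 * n by ring]
              exact this.of_mul_left 2
            rw [this, ← jacobiSym.mod_right _ (Nat.odd_iff.2 (by omega)),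
              ← jacobiSym.legendreSym.to_jacobiSym]
            exact hnp)
    exact ⟨x, y, z, hz, by rw [← h]; push_cast; ring⟩

/-- Certificates for a quadratic nonresidue `u`, up to sign and squares. -/
theorem exists_certificate {p u₁ u₂ : ℕ} [Fact p.Prime] (hp : p % 8 = 1)
    (hu₁ : u₁.Prime) (hu₂ : u₂.Prime) (h2 : u₁ ≠ 2) (hne : u₁ ≠ u₂)
    (hl₁ : legendreSym p u₁ = -1) (hl₂ : legendreSym p u₂ = -1) {u : ℤ}
    (hu : legendreSym p u = -1) :
    ∃ ε q n : ℕ, (ε = u₁ ∨ ε = u₂) ∧ 0 < q ∧ 0 < n ∧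
      (∃ s t : ℕ, s ≠ 0 ∧ t ≠ 0 ∧ ε * n * s ^ 2 = u.natAbs * t ^ 2) ∧
      (∃ x y z : ℤ, z ≠ 0 ∧ x ^ 2 + p * y ^ 2 = q * z ^ 2) ∧
      (∃ x y z : ℤ, z ≠ 0 ∧ x ^ 2 + p * u₁ * y ^ 2 = q * z ^ 2) ∧
      (∃ x y z : ℤ, z ≠ 0 ∧ x ^ 2 - p * q * y ^ 2 = n * z ^ 2) := by
  have hp' : p.Prime := Fact.out
  have hu0 : u ≠ 0 := by rintro rfl; simp at hu
  have hu₁p : u₁ ≠ p := by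
    rintro rfl
    have : legendreSym u₁ u₁ = 0 := (legendreSym.eq_zero_iff u₁ u₁).2 (by simp)
    omega
  obtain ⟨k, m, hm, hkm⟩ := Nat.exists_eq_pow_mul_and_not_dvd
    (Int.natAbs_pos.2 hu0).ne' u₁ hu₁.ne_one
  have hm0 : 0 < m := Nat.pos_of_ne_zero (by rintro rfl; exact hm (dvd_zero _))
  have hneg : legendreSym p (-1) = 1 := by
    rw [legendreSym.eq_one_iff p (by simp)]
    push_cast
    exact ZMod.exists_sq_eq_neg_one_iff.2 (by omega)
  have habs : legendreSym p (u.natAbs : ℤ) = -1 := by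
    rcases Int.natAbs_eq u with h | h
    · rw [← h]; exact hu
    · have : ((u.natAbs : ℕ) : ℤ) = -1 * u := by omega
      rw [this, legendreSym.mul, hneg, hu, one_mul]
  have hmul : (-1) ^ k * legendreSym p m = -1 := by
    have : ∀ j : ℕ, legendreSym p ((u₁ : ℤ) ^ j) = (-1) ^ j := fun j => by
      induction j with
      | zero => simp
      | succ j ih => rw [pow_succ, legendreSym.mul, ih, hl₁, pow_succ]
    rw [← this, ← legendreSym.mul, ← habs, hkm]
    push_cast
    rfl
  rcases Nat.even_or_odd k with hk | hk
  · rw [hk.neg_one_pow, one_mul] at hmul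
    have hn : ¬ u₁ ∣ m * u₂ := fun h => (hu₁.dvd_mul.1 h).elim hm
      fun h => hne ((Nat.prime_dvd_prime_iff_eq hu₁ hu₂).1 h)
    have hleg : legendreSym p ((m * u₂ : ℕ) : ℤ) = 1 := by
      push_cast
      rw [legendreSym.mul, hmul, hl₂]; norm_num
    obtain ⟨q, hq, h⟩ := exists_certificate_of_residue hp hu₁ h2 hu₁p
      (Nat.mul_pos hm0 hu₂.pos) hn hleg
    obtain ⟨j, rfl⟩ := hk
    refine ⟨u₂, q, m * u₂, Or.inr rfl, hq, Nat.mul_pos hm0 hu₂.pos,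
      ⟨u₁ ^ j, u₂, pow_ne_zero _ hu₁.ne_zero, hu₂.ne_zero, ?_⟩, h⟩
    rw [hkm]; ring
  · rw [hk.neg_one_pow] at hmul
    obtain ⟨q, hq, h⟩ := exists_certificate_of_residue hp hu₁ h2 hu₁p hm0 hm (by omega)
    obtain ⟨j, rfl⟩ := hk
    refine ⟨u₁, q, m, Or.inl rfl, hq, hm0,
      ⟨u₁ ^ j, 1, pow_ne_zero _ hu₁.ne_zero, one_ne_zero, ?_⟩, h⟩
    rw [hkm]; ring

end Certificates

section Definability

open FirstOrder FirstOrder.Language FirstOrder.Ring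

/-- Terms in the language of rings in `n` variables. -/
abbrev RingTerm (n : ℕ) := Language.ring.Term (Empty ⊕ Fin n)

/-- Bounded formulas in the language of rings in `n` variables. -/
abbrev RingFormula (n : ℕ) := Language.ring.BoundedFormula Empty n

/-- The term `1 + ⋯ + 1`. -/
def RingTerm.nat {n : ℕ} : ℕ → RingTerm n
  | 0 => 0
  | k + 1 => RingTerm.nat k + 1

/-- The `k`-th power of a term. -/
def RingTerm.pow {n : ℕ} (t : RingTerm n) : ℕ → RingTerm n
  | 0 => 1
  | k + 1 => RingTerm.pow t k * t

/-- The `i`-th variable. -/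
def RingTerm.x {n : ℕ} (i : Fin n) : RingTerm n := Term.var (Sum.inr i)

/-- View a term in `n` variables as a term in `n + j` variables. -/
def RingTerm.lift {n : ℕ} (j : ℕ) (t : RingTerm n) : RingTerm (n + j) :=
  t.relabel (Sum.map id (Fin.castAdd j))

/-- A formula expressing that `c` is a value of the Pfister form with slots `T`. -/
def representsFormula {n : ℕ} : List (RingTerm n) → (j : ℕ) → RingTerm (n + j) →
    RingFormula (n + j)
  | [], j, c => BoundedFormula.ex (n := n + j)
      (Term.bdEqual (RingTerm.pow (RingTerm.x (Fin.last (n + j))) 2) (RingTerm.lift 1 c))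
  | a :: T, j, c => BoundedFormula.ex (n := n + j) <| BoundedFormula.ex (n := n + j + 1)
      (representsFormula T (j + 2) (RingTerm.x (Fin.last (n + j)).castSucc) ⊓
        representsFormula T (j + 2) (RingTerm.x (Fin.last (n + j + 1))) ⊓
        Term.bdEqual (RingTerm.x (Fin.last (n + j)).castSucc +
          -(RingTerm.lift (j + 2) a * RingTerm.x (Fin.last (n + j + 1)))) (RingTerm.lift 2 c))

/-- A formula expressing that the Pfister form with slots `T` is isotropic. -/
def isotropicFormula {n : ℕ} : List (RingTerm n) → RingFormula n
  | [] => ⊥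
  | a :: T => isotropicFormula T ⊔ representsFormula T 0 a

/-- Membership in the span of `l` over the subring of `p`-th powers. -/
def InPowSpan {K : Type*} [CommRing K] (p : ℕ) : List K → K → Prop
  | [], c => c = 0
  | a :: l, c => ∃ x, InPowSpan p l (c - x ^ p * a)

/-- A formula expressing `InPowSpan`. -/
def powSpanFormula (p : ℕ) {n : ℕ} : List (RingTerm n) → (j : ℕ) → RingTerm (n + j) →
    RingFormula (n + j)
  | [], _, c => Term.bdEqual c 0
  | a :: T, j, c => BoundedFormula.ex (n := n + j)
      (powSpanFormula p T (j + 1) (RingTerm.lift 1 c +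
        -(RingTerm.pow (RingTerm.x (Fin.last (n + j))) p * RingTerm.lift (j + 1) a)))

/-- Data witnessing that `n` is, up to squares, a norm from the unramified side at `p`. -/
def Certificate {K : Type*} [CommRing K] (p u₁ q n : K) : Prop :=
  q ≠ 0 ∧ n ≠ 0 ∧ Represents (pfisterWeight [-p]) q ∧
    Represents (pfisterWeight [-(p * u₁)]) q ∧ Represents (pfisterWeight [p * q]) n

/-- Every `m`-fold Pfister form becomes isotropic after multiplication by `⟨⟨ε n, p⟩⟩` for some
certified `n` and some `ε` among `u₁, u₂`. -/
def KillsPfister (K : Type*) [CommRing K] (p u₁ u₂ : ℕ) (m : ℕ) : Prop :=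
  ∀ f : Fin m → K, (∀ i, f i ≠ 0) → ∃ q n : K, Certificate (p : K) u₁ q n ∧
    (Isotropic (pfisterWeight ((u₁ : K) * n :: (p : K) :: List.ofFn f)) ∨
      Isotropic (pfisterWeight ((u₂ : K) * n :: (p : K) :: List.ofFn f)))

/-- A formula expressing `Certificate` for the last two variables. -/
def certificateFormula (m p u₁ : ℕ) : RingFormula (m + 1 + 1) :=
  let q : RingTerm (m + 1 + 1) := RingTerm.x (Fin.last m).castSucc
  let n : RingTerm (m + 1 + 1) := RingTerm.x (Fin.last (m + 1))
  (Term.bdEqual q 0).not ⊓ ((Term.bdEqual n 0).not ⊓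
    (representsFormula [-RingTerm.nat p] 0 q ⊓
      (representsFormula [-(RingTerm.nat p * RingTerm.nat u₁)] 0 q ⊓
        representsFormula [RingTerm.nat p * q] 0 n)))

/-- A sentence expressing `KillsPfister`. -/
def killsPfisterSentence (p u₁ u₂ m : ℕ) : Language.ring.Sentence :=
  let n : RingTerm (m + 1 + 1) := RingTerm.x (Fin.last (m + 1))
  let T : List (RingTerm (m + 1 + 1)) :=
    RingTerm.nat p :: List.ofFn fun i : Fin m => RingTerm.x i.castSucc.castSucc
  BoundedFormula.alls (n := m) <|
    (BoundedFormula.iInf fun i : Fin m => (Term.bdEqual (RingTerm.x i) 0).not).imp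
      (BoundedFormula.ex (n := m) <| BoundedFormula.ex (n := m + 1) <|
        certificateFormula m p u₁ ⊓ (isotropicFormula (RingTerm.nat u₁ * n :: T) ⊔
          isotropicFormula (RingTerm.nat u₂ * n :: T)))

/-- A sentence expressing that some `N` elements span over the subring of `p`-th powers. -/
def powSpanSentence (p N : ℕ) : Language.ring.Sentence :=
  BoundedFormula.exs (n := N) <| BoundedFormula.all (n := N) <|
    powSpanFormula p (List.ofFn fun i : Fin N => RingTerm.x i.castSucc) 0
      (RingTerm.x (Fin.last N))

variable {K : Type*} [Field K] [CompatibleRing K] {n : ℕ}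

theorem RingTerm.realize_nat (v : Empty ⊕ Fin n → K) (k : ℕ) :
    (RingTerm.nat k : RingTerm n).realize v = (k : K) := by
  induction k with
  | zero => simp [RingTerm.nat]
  | succ k ih => simp [RingTerm.nat, ih]

theorem RingTerm.realize_pow (v : Empty ⊕ Fin n → K) (t : RingTerm n) (k : ℕ) :
    (RingTerm.pow t k).realize v = t.realize v ^ k := by
  induction k with
  | zero => simp [RingTerm.pow]
  | succ k ih => simp [RingTerm.pow, ih, pow_succ]

theorem RingTerm.realize_x (e : Empty → K) (v : Fin n → K) (i : Fin n) :
    (RingTerm.x i).realize (Sum.elim e v) = v i := rfl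

theorem RingTerm.realize_lift (e : Empty → K) (j : ℕ) (v : Fin (n + j) → K) (t : RingTerm n) :
    (RingTerm.lift j t).realize (Sum.elim e v) =
      t.realize (Sum.elim e (fun i => v (Fin.castAdd j i))) := by
  rw [RingTerm.lift, Term.realize_relabel]
  congr 1
  funext i
  rcases i with i | i <;> rfl

theorem snoc_castAdd_succ {α : Type*} (j : ℕ) (v : Fin (n + j) → α) (x : α) (i : Fin n) :
    (Fin.snoc v x : Fin (n + j + 1) → α) (Fin.castAdd (j + 1) i) = v (Fin.castAdd j i) :=
  Fin.snoc_castSucc (α := fun _ => α) x v (Fin.castAdd j i)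

theorem realize_representsFormula (e : Empty → K) (T : List (RingTerm n)) (j : ℕ)
    (c : RingTerm (n + j)) (v : Fin (n + j) → K) :
    (representsFormula T j c).Realize e v ↔
      Represents (pfisterWeight
        (T.map fun t => t.realize (Sum.elim e (fun i => v (Fin.castAdd j i)))))
        (c.realize (Sum.elim e v)) := by
  induction T generalizing j with
  | nil =>
    rw [representsFormula, BoundedFormula.realize_ex, List.map_nil, represents_pfister_nil]
    refine exists_congr fun x => ?_
    rw [BoundedFormula.realize_bdEqual, RingTerm.realize_pow, RingTerm.realize_x, Fin.snoc_last,
      RingTerm.realize_lift]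
    have : (fun i => (Fin.snoc v x : Fin (n + j + 1) → K) (Fin.castAdd 1 i)) = v :=
      funext fun i => Fin.snoc_castSucc (α := fun _ => K) x v i
    rw [this]
  | cons a T ih =>
    rw [representsFormula, BoundedFormula.realize_ex, List.map_cons, represents_pfister_cons]
    refine exists_congr fun x => ?_
    rw [BoundedFormula.realize_ex]
    refine exists_congr fun y => ?_
    have h0 : (fun i => (Fin.snoc (Fin.snoc v x : Fin (n + j + 1) → K) y : Fin (n + j + 1 + 1) → K)
        (Fin.castAdd (j + 2) i)) = fun i => v (Fin.castAdd j i) := funext fun i =>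
      (snoc_castAdd_succ (j + 1) _ y i).trans (snoc_castAdd_succ j v x i)
    have h1 : (fun i => (Fin.snoc (Fin.snoc v x : Fin (n + j + 1) → K) y : Fin (n + j + 1 + 1) → K)
        (Fin.castAdd 2 i)) = v := funext fun i =>
      (Fin.snoc_castSucc (α := fun _ => K) y _ i.castSucc).trans
        (Fin.snoc_castSucc (α := fun _ => K) x v i)
    have hx : (Fin.snoc (Fin.snoc v x : Fin (n + j + 1) → K) y : Fin (n + j + 1 + 1) → K)
        (Fin.last (n + j)).castSucc = x := by
      rw [Fin.snoc_castSucc, Fin.snoc_last]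
    have hy : (Fin.snoc (Fin.snoc v x : Fin (n + j + 1) → K) y : Fin (n + j + 1 + 1) → K)
        (Fin.last (n + j + 1)) = y := Fin.snoc_last _ _
    rw [BoundedFormula.realize_inf, BoundedFormula.realize_inf]
    refine (and_congr (and_congr (ih (j + 2) _ _) (ih (j + 2) _ _)) Iff.rfl).trans ?_
    rw [h0, RingTerm.realize_x, RingTerm.realize_x, hx, hy, BoundedFormula.realize_bdEqual,
      and_assoc, realize_add, realize_neg, realize_mul, RingTerm.realize_x, RingTerm.realize_x,
      hx, hy]
    have h2 := RingTerm.realize_lift e (j + 2)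
      (Fin.snoc (Fin.snoc v x : Fin (n + j + 1) → K) y : Fin (n + j + 1 + 1) → K) a
    have h3 := RingTerm.realize_lift e 2
      (Fin.snoc (Fin.snoc v x : Fin (n + j + 1) → K) y : Fin (n + j + 1 + 1) → K) c
    rw [h0] at h2
    rw [h1] at h3
    erw [h2, h3]
    rw [sub_eq_add_neg]

theorem realize_isotropicFormula (e : Empty → K) (T : List (RingTerm n)) (v : Fin n → K) :
    (isotropicFormula T).Realize e v ↔
      Isotropic (pfisterWeight (T.map fun t => t.realize (Sum.elim e v))) := by
  induction T with
  | nil =>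
    rw [isotropicFormula, List.map_nil, BoundedFormula.realize_bot]
    exact iff_of_false id not_isotropic_pfister_nil
  | cons a T ih =>
    rw [isotropicFormula, BoundedFormula.realize_sup, ih, List.map_cons,
      isotropic_pfister_cons_iff]
    exact or_congr Iff.rfl (realize_representsFormula e T 0 a v)

theorem realize_powSpanFormula (p : ℕ) (e : Empty → K) (T : List (RingTerm n)) (j : ℕ)
    (c : RingTerm (n + j)) (v : Fin (n + j) → K) :
    (powSpanFormula p T j c).Realize e v ↔
      InPowSpan p (T.map fun t => t.realize (Sum.elim e (fun i => v (Fin.castAdd j i))))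
        (c.realize (Sum.elim e v)) := by
  induction T generalizing j with
  | nil =>
    rw [powSpanFormula, List.map_nil, InPowSpan, BoundedFormula.realize_bdEqual, realize_zero]
  | cons a T ih =>
    rw [powSpanFormula, BoundedFormula.realize_ex, List.map_cons, InPowSpan]
    refine exists_congr fun x => ?_
    refine (ih (j + 1) _ _).trans ?_
    have h0 : (fun i => (Fin.snoc v x : Fin (n + j + 1) → K) (Fin.castAdd (j + 1) i)) =
        fun i => v (Fin.castAdd j i) := funext fun i => snoc_castAdd_succ j v x i
    have h1 : (fun i => (Fin.snoc v x : Fin (n + j + 1) → K) (Fin.castAdd 1 i)) = v :=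
      funext fun i => Fin.snoc_castSucc (α := fun _ => K) x v i
    rw [h0, sub_eq_add_neg, realize_add, realize_neg, realize_mul, RingTerm.realize_pow,
      RingTerm.realize_x, Fin.snoc_last]
    have h2 := RingTerm.realize_lift e (j + 1) (Fin.snoc v x : Fin (n + j + 1) → K) a
    have h3 := RingTerm.realize_lift e 1 (Fin.snoc v x : Fin (n + j + 1) → K) c
    rw [h0] at h2
    rw [h1] at h3
    erw [h2, h3]

theorem realize_certificateFormula (p u₁ m : ℕ) (e : Empty → K) (v : Fin m → K) (a b : K) :
    (certificateFormula m p u₁).Realize e (Fin.snoc (Fin.snoc v a : Fin (m + 1) → K) b) ↔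
      Certificate (p : K) u₁ a b := by
  have ha : (Fin.snoc (Fin.snoc v a : Fin (m + 1) → K) b : Fin (m + 1 + 1) → K)
      (Fin.last m).castSucc = a := by
    rw [Fin.snoc_castSucc, Fin.snoc_last]
  have hb : (Fin.snoc (Fin.snoc v a : Fin (m + 1) → K) b : Fin (m + 1 + 1) → K)
      (Fin.last (m + 1)) = b := Fin.snoc_last _ _
  rw [certificateFormula, Certificate, BoundedFormula.realize_inf, BoundedFormula.realize_inf,
    BoundedFormula.realize_inf, BoundedFormula.realize_inf, BoundedFormula.realize_not,
    BoundedFormula.realize_not, BoundedFormula.realize_bdEqual, BoundedFormula.realize_bdEqual,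
    realize_zero, RingTerm.realize_x, RingTerm.realize_x, ha, hb]
  have key := realize_representsFormula (n := m + 1 + 1) e (j := 0)
    (v := (Fin.snoc (Fin.snoc v a : Fin (m + 1) → K) b : Fin (m + 1 + 1) → K))
  refine and_congr Iff.rfl (and_congr Iff.rfl (and_congr ((key _ _).trans ?_)
    (and_congr ((key _ _).trans ?_) ((key _ _).trans ?_))))
  · rw [RingTerm.realize_x, ha, List.map_singleton, realize_neg, RingTerm.realize_nat]
  · rw [RingTerm.realize_x, ha, List.map_singleton, realize_neg, realize_mul,
      RingTerm.realize_nat, RingTerm.realize_nat]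
  · rw [RingTerm.realize_x, hb, List.map_singleton, realize_mul, RingTerm.realize_nat]
    erw [RingTerm.realize_x]
    have ha' : (Fin.snoc (Fin.snoc v a : Fin (m + 1) → K) b : Fin (m + 1 + 1) → K)
      (Fin.castAdd 0 (Fin.last m).castSucc) = a := ha
    rw [ha']

theorem realize_killsPfisterSentence (p u₁ u₂ m : ℕ) :
    K ⊨ killsPfisterSentence p u₁ u₂ m ↔ KillsPfister K p u₁ u₂ m := by
  rw [killsPfisterSentence, Sentence.Realize, BoundedFormula.realize_alls, KillsPfister]
  refine forall_congr' fun f => ?_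
  rw [BoundedFormula.realize_imp, BoundedFormula.realize_iInf]
  refine imp_congr (forall_congr' fun i => ?_) ?_
  · rw [BoundedFormula.realize_not, BoundedFormula.realize_bdEqual, realize_zero,
      RingTerm.realize_x]
  rw [BoundedFormula.realize_ex]
  refine exists_congr fun a => ?_
  rw [BoundedFormula.realize_ex]
  refine exists_congr fun b => ?_
  have hb : (Fin.snoc (Fin.snoc f a : Fin (m + 1) → K) b : Fin (m + 1 + 1) → K)
      (Fin.last (m + 1)) = b := Fin.snoc_last _ _
  rw [BoundedFormula.realize_inf, BoundedFormula.realize_sup, realize_certificateFormula,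
    realize_isotropicFormula, realize_isotropicFormula]
  have hlist : ∀ u : ℕ, List.map (fun t : RingTerm (m + 1 + 1) => t.realize
      (Sum.elim (default : Empty → K) (Fin.snoc (Fin.snoc f a : Fin (m + 1) → K) b)))
      (RingTerm.nat u * RingTerm.x (Fin.last (m + 1)) :: RingTerm.nat p ::
        List.ofFn fun i : Fin m => RingTerm.x i.castSucc.castSucc) =
      (u : K) * b :: (p : K) :: List.ofFn f := fun u => by
    simp only [List.map_cons, List.map_ofFn, Function.comp_def, realize_mul,
      RingTerm.realize_nat, RingTerm.realize_x, hb, Fin.snoc_castSucc]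
  rw [hlist, hlist]

theorem realize_powSpanSentence (p N : ℕ) :
    K ⊨ powSpanSentence p N ↔ ∃ b : Fin N → K, ∀ x, InPowSpan p (List.ofFn b) x := by
  rw [powSpanSentence, Sentence.Realize, BoundedFormula.realize_exs]
  refine exists_congr fun b => ?_
  rw [BoundedFormula.realize_all]
  refine forall_congr' fun x => ?_
  refine (realize_powSpanFormula p _ _ 0 _ _).trans ?_
  rw [RingTerm.realize_x, Fin.snoc_last, List.map_ofFn]
  have : ∀ i : Fin N, (Fin.snoc b x : Fin (N + 1) → K) (Fin.castAdd 0 i.castSucc) = b i :=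
    fun i => Fin.snoc_castSucc (α := fun _ => K) x b i
  simp only [Function.comp_def, RingTerm.realize_x, this]

end Definability

/-- Every system of `r` quadratic forms in more than `r * N` variables over `F` has a
nontrivial common zero. -/
def QuadraticSystemsSolvable (N : ℕ) (F : Type*) [CommRing F] : Prop :=
  ∀ (ρ ι : Type) [Fintype ρ] [Fintype ι], Fintype.card ρ * N < Fintype.card ι →
    ∀ Q : ρ → ι → ι → F, ∃ x : ι → F, x ≠ 0 ∧ ∀ j, ∑ a, ∑ b, Q j a b * (x a * x b) = 0

theorem QuadraticSystemsSolvable.mono {N M : ℕ} {F : Type*} [CommRing F]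
    (h : QuadraticSystemsSolvable N F) (hNM : N ≤ M) : QuadraticSystemsSolvable M F :=
  fun ρ _ _ _ hc Q => h ρ _ (lt_of_le_of_lt (Nat.mul_le_mul_left _ hNM) hc) Q

/-- All points of affine space over a field have the same height. -/
theorem MvPolynomial.height_vanishingIdeal_singleton {F ι : Type*} [Field F] [Finite ι]
    (x : ι → F) :
    (MvPolynomial.vanishingIdeal F {x}).height =
      (MvPolynomial.vanishingIdeal F {(0 : ι → F)}).height := by
  have hmul : (MvPolynomial.aeval fun i =>
        (MvPolynomial.X i - MvPolynomial.C (x i) : MvPolynomial ι F)).comp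
      (MvPolynomial.aeval fun i =>
        (MvPolynomial.X i + MvPolynomial.C (x i) : MvPolynomial ι F)) = AlgHom.id F _ := by
    ext i; simp
  have hmul' : (MvPolynomial.aeval fun i =>
        (MvPolynomial.X i + MvPolynomial.C (x i) : MvPolynomial ι F)).comp
      (MvPolynomial.aeval fun i =>
        (MvPolynomial.X i - MvPolynomial.C (x i) : MvPolynomial ι F)) = AlgHom.id F _ := by
    ext i; simp
  let e : MvPolynomial ι F ≃ₐ[F] MvPolynomial ι F := AlgEquiv.ofAlgHom _ _ hmul hmul'
  rw [← RingEquiv.height_comap e.toRingEquiv (MvPolynomial.vanishingIdeal F {x})]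
  congr 1
  ext P
  have key : MvPolynomial.aeval x (e P) = MvPolynomial.aeval (0 : ι → F) P := by
    have : (MvPolynomial.aeval x).comp e.toAlgHom = MvPolynomial.aeval (0 : ι → F) := by
      ext i
      simp [e]
    exact DFunLike.congr_fun this P
  rw [Ideal.mem_comap, MvPolynomial.mem_vanishingIdeal_singleton_iff,
    MvPolynomial.mem_vanishingIdeal_singleton_iff, ← key]
  rfl

theorem MvPolynomial.height_vanishingIdeal_zero {F ι : Type*} [Field F] [IsAlgClosed F]
    [Fintype ι] : (MvPolynomial.vanishingIdeal F {(0 : ι → F)}).height = Fintype.card ι := by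
  have hdim : ringKrullDim (MvPolynomial ι F) = Fintype.card ι := by
    rw [MvPolynomial.ringKrullDim_of_isNoetherianRing, ringKrullDim_eq_zero_of_field]
    simp
  have : FiniteRingKrullDim (MvPolynomial ι F) := by
    rw [finiteRingKrullDim_iff_ne_bot_and_top, hdim]
    exact ⟨by simp, fun h => by
      have : ((Fintype.card ι : ℕ∞) : WithBot ℕ∞) = ((⊤ : ℕ∞) : WithBot ℕ∞) := h
      exact ENat.natCast_ne_top _ (WithBot.coe_injective this)⟩
  obtain ⟨m, hm, hh⟩ := Ideal.exists_isMaximal_height (R := MvPolynomial ι F)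
  obtain ⟨x, rfl⟩ := MvPolynomial.isMaximal_iff_eq_vanishingIdeal_singleton.1 hm
  rw [MvPolynomial.height_vanishingIdeal_singleton, hdim] at hh
  exact_mod_cast hh

theorem quadraticSystemsSolvable_of_isAlgClosed (F : Type*) [Field F] [IsAlgClosed F] :
    QuadraticSystemsSolvable 1 F := by
  classical
  intro ρ ι _ _ hc Q
  by_contra! hno
  let q : ρ → MvPolynomial ι F := fun j =>
    ∑ a, ∑ b, MvPolynomial.C (Q j a b) * (MvPolynomial.X a * MvPolynomial.X b)
  have hq : ∀ j x, MvPolynomial.aeval x (q j) = ∑ a, ∑ b, Q j a b * (x a * x b) := by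
    intro j x; simp [q]
  have hz : MvPolynomial.zeroLocus F (Ideal.span (Finset.univ.image q : Set (MvPolynomial ι F)))
      = {0} := by
    rw [MvPolynomial.zeroLocus_span]
    ext x
    simp only [Finset.coe_image, Finset.coe_univ, Set.image_univ, Set.mem_range,
      forall_exists_index, forall_apply_eq_imp_iff, hq, Set.mem_ofPred_eq, Set.mem_singleton_iff]
    constructor
    · intro h
      by_contra hx
      obtain ⟨j, hj⟩ := hno x hx
      exact hj (h j)
    · rintro rfl; simp
  have hmin : MvPolynomial.vanishingIdeal F {(0 : ι → F)} ∈
      (Ideal.span (Finset.univ.image q : Set (MvPolynomial ι F))).minimalPrimes := by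
    rw [← Ideal.radical_minimalPrimes, ← MvPolynomial.vanishingIdeal_zeroLocus_eq_radical (K := F),
      hz, Ideal.minimalPrimes_eq_subsingleton_self]
    rfl
  have := Ideal.height_le_card_of_mem_minimalPrimes_span_finset hmin
  rw [MvPolynomial.height_vanishingIdeal_zero] at this
  have h2 : Fintype.card ι ≤ (Finset.univ.image q).card := by exact_mod_cast this
  have h3 := Finset.card_image_le (s := Finset.univ) (f := q)
  rw [Finset.card_univ] at h3
  omega

theorem sum_mul_sum_smul_prod {F A ι κ : Type*} [CommRing F] [CommRing A] [Algebra F A]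
    [Fintype ι] [Fintype κ] (Q : ι → ι → A) (v : κ → A) (y : ι × κ → F) :
    ∑ a, ∑ b, Q a b * ((∑ k, y (a, k) • v k) * ∑ k, y (b, k) • v k) =
      ∑ p : ι × κ, ∑ p' : ι × κ, (y p * y p') • (Q p.1 p'.1 * (v p.2 * v p'.2)) := by
  simp only [Fintype.sum_prod_type]
  refine Finset.sum_congr rfl fun a _ => ?_
  rw [Finset.sum_comm]
  refine Finset.sum_congr rfl fun b _ => ?_
  rw [Finset.sum_mul_sum, Finset.mul_sum]
  refine Finset.sum_congr rfl fun k _ => ?_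
  rw [Finset.mul_sum]
  refine Finset.sum_congr rfl fun k' _ => ?_
  simp only [Algebra.smul_def, map_mul]
  ring

theorem QuadraticSystemsSolvable.of_finiteDimensional {N : ℕ} {F E : Type*} [Field F] [Field E]
    [Algebra F E] [FiniteDimensional F E] (h : QuadraticSystemsSolvable N F) :
    QuadraticSystemsSolvable N E := by
  classical
  intro ρ ι _ _ hc Q
  let b := Module.finBasis F E
  have hpos : 0 < Module.finrank F E := Module.finrank_pos
  obtain ⟨y, hy, hy'⟩ := h (ρ × Fin (Module.finrank F E)) (ι × Fin (Module.finrank F E))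
    (by simp only [Fintype.card_prod, Fintype.card_fin]; nlinarith)
    (fun j a a' => b.repr (Q j.1 a.1 a'.1 * (b a.2 * b a'.2)) j.2)
  refine ⟨fun a => ∑ k, y (a, k) • b k, ?_, fun j => ?_⟩
  · intro h0
    apply hy
    ext ⟨a, k⟩
    have := congrArg (fun v => b.repr v k) (congrFun h0 a)
    simpa [Finsupp.single_apply] using this
  · apply b.repr.injective
    ext m
    rw [map_zero, Finsupp.zero_apply, ← hy' (j, m)]
    rw [sum_mul_sum_smul_prod]
    simp only [map_sum, Finsupp.coe_finsetSum, Finset.sum_apply, map_smul, Finsupp.smul_apply,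
      smul_eq_mul, mul_comm]

theorem QuadraticSystemsSolvable.of_isAlgebraic {N : ℕ} {F L : Type*} [Field F] [Field L]
    [Algebra F L] [Algebra.IsAlgebraic F L] (h : QuadraticSystemsSolvable N F) :
    QuadraticSystemsSolvable N L := by
  intro ρ ι _ _ hc Q
  let S : Set L := Set.range fun t : ρ × ι × ι => Q t.1 t.2.1 t.2.2
  have : Finite S := Set.finite_range _
  let E := IntermediateField.adjoin F S
  have : FiniteDimensional F E :=
    IntermediateField.finiteDimensional_adjoin fun x _ =>
      (Algebra.IsAlgebraic.isAlgebraic x).isIntegral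
  have hQ : ∀ j a b, Q j a b ∈ E := fun j a b =>
    IntermediateField.subset_adjoin F S ⟨(j, a, b), rfl⟩
  obtain ⟨x, hx, hx'⟩ := (h.of_finiteDimensional (E := E)) ρ ι hc
    fun j a b => ⟨Q j a b, hQ j a b⟩
  refine ⟨fun a => x a, fun h0 => hx ?_, fun j => ?_⟩
  · ext a; exact congrFun h0 a
  · have := congrArg (algebraMap E L) (hx' j)
    simpa [map_sum, map_mul, IntermediateField.algebraMap_apply] using this

open Polynomial in
theorem QuadraticSystemsSolvable.of_isFractionRing {N : ℕ} {F K : Type*} [Field F] [Field K]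
    [Algebra F[X] K] [IsFractionRing F[X] K] (h : QuadraticSystemsSolvable N F) :
    QuadraticSystemsSolvable (N * 2) K := by
  classical
  intro ρ ι _ _ hc Q
  obtain ⟨⟨d, hd⟩, hdQ⟩ := IsLocalization.exist_integer_multiples_of_finite
    (nonZeroDivisors F[X]) fun t : ρ × ι × ι => Q t.1 t.2.1 t.2.2
  choose P hP using hdQ
  obtain ⟨D, hD⟩ : ∃ D, ∀ t, (P t).natDegree ≤ D :=
    ⟨Finset.univ.sup fun t => (P t).natDegree, fun t =>
      Finset.le_sup (f := fun t => (P t).natDegree)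
      (Finset.mem_univ t)⟩
  set s := Fintype.card ρ * N * D with hs
  obtain ⟨y, hy, hy'⟩ := h (ρ × Fin (D + 2 * s + 1)) (ι × Fin (s + 1))
    (by simp only [Fintype.card_prod, Fintype.card_fin]; nlinarith)
    (fun j a a' => (P (j.1, a.1, a'.1) * (X ^ (a.2 : ℕ) * X ^ (a'.2 : ℕ))).coeff j.2)
  let z : ι → F[X] := fun a => ∑ k : Fin (s + 1), C (y (a, k)) * X ^ (k : ℕ)
  have hzdeg : ∀ a, (z a).natDegree ≤ s := fun a =>
    natDegree_sum_le_of_forall_le _ _ fun k _ => (natDegree_C_mul_X_pow_le _ _).trans (by omega)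
  have hz : ∀ a, ∀ k : Fin (s + 1), (z a).coeff k = y (a, k) := by
    intro a k
    simp [z, coeff_C_mul, coeff_X_pow, Fin.val_inj]
  have hz0 : z ≠ 0 := by
    intro h0
    apply hy
    ext ⟨a, k⟩
    rw [← hz, h0]; simp
  have hsum : ∀ j, ∑ a, ∑ b, P (j, a, b) * (z a * z b) = 0 := by
    intro j
    ext m
    by_cases hm : m < D + 2 * s + 1
    · have := hy' (j, ⟨m, hm⟩)
      rw [coeff_zero, ← this]
      have hz' : ∀ a, z a = ∑ k : Fin (s + 1), y (a, k) • (X ^ (k : ℕ) : F[X]) := fun a => by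
        simp only [z, smul_eq_C_mul]
      simp only [hz']
      rw [sum_mul_sum_smul_prod (fun a b => P (j, a, b))]
      simp only [finsetSum_coeff, coeff_smul, smul_eq_mul, mul_comm]
    · rw [coeff_zero]
      apply coeff_eq_zero_of_natDegree_lt
      refine lt_of_le_of_lt (natDegree_sum_le_of_forall_le _ _ (n := D + 2 * s) fun a _ =>
        natDegree_sum_le_of_forall_le _ _ fun b _ => ?_) (by omega)
      refine natDegree_mul_le.trans ?_
      have h1 := natDegree_mul_le (p := z a) (q := z b)
      have h2 := hzdeg a
      have h3 := hzdeg b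
      have h4 := hD (j, a, b)
      omega
  refine ⟨fun a => algebraMap F[X] K (z a), fun h0 => hz0 ?_, fun j => ?_⟩
  · ext1 a
    exact IsFractionRing.injective F[X] K (by simpa using congrFun h0 a)
  · have hd0 : algebraMap F[X] K d ≠ 0 := by
      simpa using nonZeroDivisors.ne_zero hd
    apply mul_left_cancel₀ hd0
    have := congrArg (algebraMap F[X] K) (hsum j)
    simp only [map_sum, map_mul, map_zero, hP, Algebra.smul_def] at this
    rw [mul_zero, ← this, Finset.mul_sum]
    refine Finset.sum_congr rfl fun a _ => ?_
    rw [Finset.mul_sum]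
    exact Finset.sum_congr rfl fun b _ => by ring

theorem pfisterWeight_map {K L : Type*} [CommRing K] [CommRing L] (f : K →+* L) :
    ∀ l : List K, ∃ e : PfisterIndex l.length ≃ PfisterIndex (l.map f).length,
      ∀ i, pfisterWeight (l.map f) (e i) = f (pfisterWeight l i)
  | [] => ⟨Equiv.refl _, fun _ => (map_one f).symm⟩
  | a :: l => by
    obtain ⟨e, he⟩ := pfisterWeight_map f l
    refine ⟨Equiv.sumCongr e e, ?_⟩
    rintro (i | i)
    · exact he i
    · change -f a * pfisterWeight (l.map f) (e i) = f (-a * pfisterWeight l i)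
      rw [he, map_mul, map_neg]

theorem isotropic_pfisterWeight_map_iff {K L : Type*} [CommRing K] [CommRing L] (f : K →+* L)
    (l : List K) : Isotropic (pfisterWeight (l.map f)) ↔
      ∃ v : PfisterIndex l.length → L, v ≠ 0 ∧ ∑ i, f (pfisterWeight l i) * v i ^ 2 = 0 := by
  obtain ⟨e, he⟩ := pfisterWeight_map f l
  constructor
  · rintro ⟨x, hx, hx'⟩
    refine ⟨x ∘ e, fun h => hx ?_, ?_⟩
    · ext i; simpa using congrFun h (e.symm i)
    · rw [← hx', diagForm, ← e.sum_comp]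
      simp only [he, Function.comp_apply]
  · rintro ⟨v, hv, hv'⟩
    refine ⟨v ∘ e.symm, fun h => hv ?_, ?_⟩
    · ext i; simpa using congrFun h (e i)
    · rw [← hv', diagForm, ← e.sum_comp]
      simp only [he, Function.comp_apply, Equiv.symm_apply_apply]

theorem QuadraticSystemsSolvable.of_ringEquiv {N : ℕ} {F K : Type*} [Field F] [Field K]
    (e : F ≃+* K) (h : QuadraticSystemsSolvable N F) : QuadraticSystemsSolvable N K := by
  intro ρ ι _ _ hc Q
  obtain ⟨x, hx, hx'⟩ := h ρ ι hc fun j a b => e.symm (Q j a b)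
  refine ⟨e ∘ x, fun h0 => hx ?_, fun j => ?_⟩
  · ext a; simpa using congrFun h0 a
  · simpa using congrArg e (hx' j)

open IntermediateField in
theorem QuadraticSystemsSolvable.adjoin_simple {N : ℕ} {F K : Type*} [Field F] [Field K]
    [Algebra F K] (h : QuadraticSystemsSolvable N F) (x : K) :
    QuadraticSystemsSolvable (N * 2) F⟮x⟯ := by
  by_cases hx : Transcendental F x
  · exact (h.of_isFractionRing (K := RatFunc F)).of_ringEquiv
      (RatFunc.algEquivOfTranscendental x hx).toRingEquiv
  · have := isAlgebraic_adjoin_simple (not_not.1 hx).isIntegral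
    exact (h.of_isAlgebraic (L := F⟮x⟯)).mono (by omega)

open IntermediateField in
theorem QuadraticSystemsSolvable.adjoin_finset {N : ℕ} {F K : Type*} [Field F] [Field K]
    [Algebra F K] (h : QuadraticSystemsSolvable N F) (S : Finset K) :
    QuadraticSystemsSolvable (N * 2 ^ S.card) (adjoin F (S : Set K)) := by
  classical
  induction S using Finset.induction_on with
  | empty =>
    have : Algebra.IsAlgebraic F (adjoin F ((∅ : Finset K) : Set K)) := isAlgebraic_adjoin (by simp)
    exact (h.of_isAlgebraic (L := adjoin F _)).mono (by simp)
  | insert x S hx ih =>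
    have h1 := ih.adjoin_simple x
    have h2 : adjoin F ((insert x S : Finset K) : Set K) =
        ((adjoin (adjoin F (S : Set K)) {x}).restrictScalars F) := by
      rw [adjoin_adjoin_left, Finset.coe_insert, Set.union_singleton]
    rw [h2, Finset.card_insert_of_notMem hx, pow_succ, ← mul_assoc]
    exact h1

open Polynomial IntermediateField in
/-- A Pfister form in more slots than the transcendence degree becomes isotropic after adjoining
finitely many algebraic numbers. -/
theorem exists_polynomial_splits_isotropic {K : Type u} [Field K] [CharZero K] {d : ℕ}
    {x : Fin d → K} (hx : IsTranscendenceBasis ℚ x) {l : List K} (hl : d < l.length) :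
    ∃ P : ℚ[X], P ≠ 0 ∧ ∀ (E : Type u) [Field E] (ι : K →+* E),
      (P.map (ι.comp (algebraMap ℚ K))).Splits → Isotropic (pfisterWeight (l.map ι)) := by
  classical
  let Ω := AlgebraicClosure K
  let C₀ := algebraicClosure ℚ Ω
  have : IsAlgClosed C₀ := (algebraicClosure.isAlgClosure ℚ Ω).isAlgClosed
  let S : Finset Ω := Finset.univ.image (algebraMap K Ω ∘ x)
  let M := adjoin C₀ (S : Set Ω)
  let L := adjoin M (Set.range (algebraMap K Ω))
  have hM : QuadraticSystemsSolvable (2 ^ d) M := by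
    refine ((quadraticSystemsSolvable_of_isAlgClosed C₀).adjoin_finset S).mono ?_
    rw [one_mul]
    exact Nat.pow_le_pow_right (by norm_num) (Finset.card_image_le.trans (by simp))
  have halg : ∀ z ∈ Set.range (algebraMap K Ω), IsIntegral M z := by
    rintro _ ⟨z, rfl⟩
    have := hx.isAlgebraic_field
    have h1 : IsIntegral (adjoin ℚ (Set.range x)) z :=
      (Algebra.IsAlgebraic.isAlgebraic z).isIntegral
    have hle : ∀ w ∈ adjoin ℚ (Set.range x), algebraMap K Ω w ∈ M := by
      intro w hw
      have : adjoin ℚ (Set.range x) ≤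
          (M.restrictScalars ℚ).comap (IsScalarTower.toAlgHom ℚ K Ω) := by
        rw [adjoin_le_iff]
        rintro _ ⟨i, rfl⟩
        exact subset_adjoin C₀ (S : Set Ω) (by simp [S])
      exact this hw
    let g : adjoin ℚ (Set.range x) →+* M :=
      ((algebraMap K Ω).comp (algebraMap (adjoin ℚ (Set.range x)) K)).codRestrict M
        fun w => hle w w.2
    exact h1.map_of_comp_eq g (algebraMap K Ω) (by ext; rfl)
  have : Algebra.IsAlgebraic M L := isAlgebraic_adjoin halg
  have hL : QuadraticSystemsSolvable (2 ^ d) L := hM.of_isAlgebraic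
  have hKL : ∀ z : K, algebraMap K Ω z ∈ L := fun z => subset_adjoin M _ ⟨z, rfl⟩
  obtain ⟨v, hv, hv'⟩ := hL Unit (PfisterIndex l.length)
    (by rw [PfisterIndex.card]; simpa using Nat.pow_lt_pow_right (by norm_num) hl)
    (fun _ a b => if a = b then ⟨algebraMap K Ω (pfisterWeight l a), hKL _⟩ else 0)
  have hsum : ∑ i, algebraMap K Ω (pfisterWeight l i) * (v i : Ω) ^ 2 = 0 := by
    have := congrArg (algebraMap L Ω) (hv' ())
    simpa [ite_mul, pow_two, IntermediateField.algebraMap_apply] using this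
  have hLle : ∀ z ∈ L, z ∈ adjoin K (C₀ : Set Ω) := by
    intro z hz
    have h0 : M.toSubfield ≤ (adjoin K (C₀ : Set Ω)).toSubfield := by
      rw [adjoin_toSubfield, Subfield.closure_le, Set.union_subset_iff]
      refine ⟨?_, ?_⟩
      · rintro _ ⟨w, rfl⟩; exact subset_adjoin K _ w.2
      · intro w hw
        obtain ⟨i, -, rfl⟩ := Finset.mem_image.1 hw
        exact (adjoin K (C₀ : Set Ω)).algebraMap_mem _
    have h1 : L.toSubfield ≤ (adjoin K (C₀ : Set Ω)).toSubfield := by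
      rw [adjoin_toSubfield, Subfield.closure_le, Set.union_subset_iff]
      refine ⟨?_, ?_⟩
      · rintro _ ⟨w, rfl⟩; exact h0 w.2
      · rintro _ ⟨w, rfl⟩; exact (adjoin K (C₀ : Set Ω)).algebraMap_mem _
    exact h1 hz
  choose T hTS hTv using fun i => exists_finset_of_mem_adjoin (hLle _ (v i).2)
  let U : Finset Ω := Finset.univ.biUnion T
  have hU : ∀ s ∈ U, IsIntegral ℚ s := by
    intro s hs
    obtain ⟨i, -, hi⟩ := Finset.mem_biUnion.1 hs
    exact ((mem_algebraicClosure_iff (F := ℚ) (E := Ω)).1 (hTS i hi)).isIntegral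
  refine ⟨∏ s ∈ U, minpoly ℚ s, Finset.prod_ne_zero_iff.2 fun s hs => minpoly.ne_zero (hU s hs), ?_⟩
  intro E _ ι hsp
  let := ι.toAlgebra
  have hspl : ∀ s ∈ (U : Set Ω), IsIntegral K s ∧ ((minpoly K s).map (algebraMap K E)).Splits := by
    intro s hs
    refine ⟨(hU s hs).tower_top, ?_⟩
    have h1 : (minpoly K s).map ι ∣ (∏ s ∈ U, minpoly ℚ s).map (ι.comp (algebraMap ℚ K)) := by
      rw [← Polynomial.map_map]
      refine Polynomial.map_dvd _ ((minpoly.dvd_map_of_isScalarTower ℚ K s).trans ?_)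
      exact Polynomial.map_dvd _ (Finset.dvd_prod_of_mem _ hs)
    refine hsp.of_dvd ?_ h1
    exact (Polynomial.map_ne_zero_iff (RingHom.injective _)).2
      (Finset.prod_ne_zero_iff.2 fun s hs => minpoly.ne_zero (hU s hs))
  obtain ⟨φ⟩ := nonempty_algHom_adjoin_of_splits hspl
  rw [isotropic_pfisterWeight_map_iff]
  have hvU : ∀ i, (v i : Ω) ∈ adjoin K (U : Set Ω) := fun i =>
    adjoin.mono K _ _ (by exact_mod_cast Finset.subset_biUnion_of_mem T (Finset.mem_univ i)) (hTv i)
  refine ⟨fun i => φ ⟨v i, hvU i⟩, fun h0 => hv ?_, ?_⟩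
  · ext i
    have := congrFun h0 i
    simp only [Pi.zero_apply, map_eq_zero] at this
    simpa using congrArg (algebraMap _ Ω) this
  · have h1 : ∑ i, algebraMap K (adjoin K (U : Set Ω)) (pfisterWeight l i) *
        (⟨v i, hvU i⟩ : adjoin K (U : Set Ω)) ^ 2 = 0 := by
      apply (algebraMap (adjoin K (U : Set Ω)) Ω).injective
      simpa [map_sum, IntermediateField.algebraMap_apply] using hsum
    have h2 := congrArg φ h1
    simp only [map_sum, map_mul, map_pow, map_zero, AlgHom.commutes] at h2
    exact h2

open scoped Pointwise in
/-- In a Dedekind domain with `(π) = P ^ |H| * J`, where `H` fixes `P` and `π`, some norm from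
the `H`-invariants generates `P ^ |H|` up to an element of `J` prime to `P`. -/
theorem exists_prod_smul_eq_mul {O H : Type*} [CommRing O] [IsDedekindDomain O] [Group H]
    [Fintype H] [MulSemiringAction H O] {P J : Ideal O} [P.IsPrime] (hP0 : P ≠ ⊥) {π : O}
    (hP : ∀ σ : H, σ • P = P) (hπ : ∀ σ : H, σ • π = π)
    (hfac : Ideal.span {π} = P ^ Fintype.card H * J) (hJ : ¬ J ≤ P) :
    ∃ c r : O, ∏ σ : H, σ • c = π * r ∧ r ∈ J ∧ r ∉ P := by
  classical
  have hcard : 0 < Fintype.card H := Fintype.card_pos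
  have hPe : P ^ Fintype.card H ≠ ⊥ := pow_ne_zero _ hP0
  have hsmulπ : ∀ σ : H, σ • Ideal.span {π} = Ideal.span {π} := by
    intro σ
    rw [Ideal.pointwise_smul_def, Ideal.map_span, Set.image_singleton]
    simp [hπ]
  have hJσ : ∀ σ : H, σ • J = J := by
    intro σ
    have h1 := hsmulπ σ
    rw [hfac, Ideal.pointwise_smul_def, Ideal.map_mul, Ideal.map_pow,
      ← Ideal.pointwise_smul_def, ← Ideal.pointwise_smul_def, hP] at h1
    exact mul_left_cancel₀ hPe h1
  have hnle : ¬ P * J ^ 2 ≤ P ^ 2 := by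
    intro h
    rw [pow_two P] at h
    have h2 : J ^ 2 ≤ P := by
      rw [← Ideal.dvd_iff_le] at h ⊢
      exact (mul_dvd_mul_iff_left hP0).1 h
    exact hJ (Ideal.IsPrime.le_of_pow_le h2)
  obtain ⟨c, hc, hc2⟩ := SetLike.not_le_iff_exists.1 hnle
  have hσc : ∀ σ : H, σ • c ∈ P * J ^ 2 := by
    intro σ
    have : σ • (P * J ^ 2) = P * J ^ 2 := by
      rw [Ideal.pointwise_smul_def, Ideal.map_mul, Ideal.map_pow,
        ← Ideal.pointwise_smul_def, ← Ideal.pointwise_smul_def, hP, hJσ]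
    rw [← this]
    exact Ideal.smul_mem_pointwise_smul σ c _ hc
  have hσc2 : ∀ σ : H, σ • c ∉ P ^ 2 := by
    intro σ h
    apply hc2
    have h1 : σ • P ^ 2 = P ^ 2 := by
      rw [Ideal.pointwise_smul_def, Ideal.map_pow, ← Ideal.pointwise_smul_def, hP]
    rw [← h1] at h
    exact (Ideal.smul_mem_pointwise_smul_iff).1 h
  have hprod : ∏ σ : H, σ • c ∈ Ideal.span {π} * J := by
    have h1 : ∏ σ : H, σ • c ∈ ∏ _σ : H, (P * J ^ 2) := Ideal.prod_mem_prod fun σ _ => hσc σ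
    rw [Finset.prod_const, Finset.card_univ, mul_pow] at h1
    rw [hfac, mul_assoc]
    refine Ideal.mul_mono_right ?_ h1
    rw [← pow_mul, ← pow_two]
    exact Ideal.pow_le_pow_right (by omega)
  obtain ⟨r, hr, hcr⟩ := Ideal.mem_span_singleton_mul.1 hprod
  refine ⟨c, r, hcr.symm, hr, fun hrP => ?_⟩
  have hA : ∀ σ : H, ∃ A : Ideal O, Ideal.span {σ • c} = P * A := by
    intro σ
    have : P ∣ Ideal.span {σ • c} := by
      rw [Ideal.dvd_iff_le, Ideal.span_singleton_le_iff_mem]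
      have hle : P * J ^ 2 ≤ P := Ideal.mul_le_left
      exact hle (hσc σ)
    exact this
  choose A hA using hA
  have hAP : ∀ σ, ¬ A σ ≤ P := by
    intro σ h
    apply hσc2 σ
    rw [← Ideal.span_singleton_le_iff_mem, hA, pow_two]
    exact Ideal.mul_mono_right h
  have h1 : Ideal.span {∏ σ : H, σ • c} = P ^ Fintype.card H * ∏ σ, A σ := by
    rw [← Ideal.prod_span_singleton]
    simp only [hA]
    rw [Finset.prod_mul_distrib, Finset.prod_const, Finset.card_univ]
  have h2 : Ideal.span {∏ σ : H, σ • c} ≤ P ^ Fintype.card H * (J * P) := by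
    rw [Ideal.span_singleton_le_iff_mem, ← mul_assoc, ← hfac, ← hcr]
    exact Ideal.mul_mem_mul (Ideal.mem_span_singleton_self π) hrP
  rw [h1, ← Ideal.dvd_iff_le, mul_dvd_mul_iff_left hPe, Ideal.dvd_iff_le] at h2
  obtain ⟨σ, -, hσ⟩ := (Ideal.IsPrime.prod_le ‹P.IsPrime›).1 (h2.trans Ideal.mul_le_right)
  exact hAP σ hσ

section

theorem FiniteField.not_isSquare_norm {F K : Type*} [Field F] [Field K] [Finite K] [Algebra F K]
    (h2 : ringChar K ≠ 2) {x : K} (hx : ¬ IsSquare x) : ¬ IsSquare (Algebra.norm F x) := by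
  have hF : Finite F := Finite.of_injective _ (algebraMap F K).injective
  have := Fintype.ofFinite F
  have := Fintype.ofFinite K
  have hx0 : x ≠ 0 := by rintro rfl; exact hx ⟨0, by simp⟩
  have hr : ringChar F = ringChar K := Algebra.ringChar_eq F K
  intro hs
  apply hx
  rw [FiniteField.isSquare_iff h2 hx0]
  have hn0 : Algebra.norm F x ≠ 0 := Algebra.norm_ne_zero_iff.2 hx0
  rw [FiniteField.isSquare_iff (by rw [hr]; exact h2) hn0] at hs
  have h3 := congrArg (algebraMap F K) hs
  rw [map_pow, FiniteField.algebraMap_norm_eq_pow, map_one, ← pow_mul] at h3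
  rw [← h3]
  congr 1
  have hoF := FiniteField.odd_card_of_char_ne_two (F := F) (by rw [hr]; exact h2)
  have hoK := FiniteField.odd_card_of_char_ne_two h2
  have hdvd : (Nat.card F - 1) ∣ (Nat.card K - 1) := by
    rw [Nat.card_eq_fintype_card, Nat.card_eq_fintype_card,
      Module.card_eq_pow_finrank (K := F) (V := K)]
    simpa using Nat.sub_dvd_pow_sub_pow (Fintype.card F) 1 (Module.finrank F K)
  obtain ⟨m, hm⟩ := hdvd
  have h1F : 1 < Fintype.card F := Fintype.one_lt_card
  rw [Nat.card_eq_fintype_card, Nat.card_eq_fintype_card] at *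
  obtain ⟨a, ha⟩ := Nat.odd_iff.2 hoF
  obtain ⟨b, hb⟩ := Nat.odd_iff.2 hoK
  rw [hm, Nat.mul_div_cancel_left _ (by omega), hb]
  have : (2 * b + 1) / 2 = b := by omega
  rw [this, ha]
  have : (2 * a + 1) / 2 = a := by omega
  rw [this]
  rw [ha, hb] at hm
  simp only [Nat.add_sub_cancel, mul_assoc] at hm
  have := Nat.eq_of_mul_eq_mul_left (by norm_num) hm
  rw [this, mul_comm]

theorem exists_nonsquare_sq_sub_mul_sq {K : Type*} [Field K] [Finite K] (h2 : ringChar K ≠ 2)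
    {r : K} (hr : r ≠ 0) : ∃ s t : K, ¬ IsSquare (s ^ 2 - r * t ^ 2) := by
  have := Fintype.ofFinite K
  obtain ⟨a, ha⟩ := FiniteField.exists_nonsquare h2
  obtain ⟨s, t, hst⟩ := FiniteField.exists_root_sum_quadratic
    (f := Polynomial.X ^ 2) (g := - Polynomial.C r * Polynomial.X ^ 2 - Polynomial.C a)
    (by simp) (by compute_degree!) (FiniteField.odd_card_of_char_ne_two h2)
  refine ⟨s, t, ?_⟩
  simp at hst
  have : s ^ 2 - r * t ^ 2 = a := by linear_combination hst
  rwa [this]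

open scoped Pointwise

theorem Ideal.Quotient.algebraMap_surjective_of_forall_mem_inertia {A B H : Type*} [CommRing A]
    [CommRing B] [Algebra A B] [Group H] [Finite H] [MulSemiringAction H B]
    [Algebra.IsInvariant A B H] [SMulCommClass H A B] (p : Ideal A) (P : Ideal B) [P.LiesOver p]
    [p.IsMaximal] [P.IsMaximal] [Finite (B ⧸ P)]
    (hH : ∀ (h : H) (b : B), h • b - b ∈ P) :
    Function.Surjective (algebraMap (A ⧸ p) (B ⧸ P)) := by
  let _ := Ideal.Quotient.field p
  let _ := Ideal.Quotient.field P
  have hF : Finite (A ⧸ p) := Finite.of_injective _ (algebraMap (A ⧸ p) (B ⧸ P)).injective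
  have : Subsingleton ((B ⧸ P) ≃ₐ[A ⧸ p] (B ⧸ P)) := by
    refine ⟨fun σ τ => ?_⟩
    have key : ∀ σ : (B ⧸ P) ≃ₐ[A ⧸ p] (B ⧸ P), σ = 1 := by
      intro σ
      obtain ⟨g, rfl⟩ := Ideal.Quotient.stabilizerHom_surjective H p P σ
      ext ⟨x⟩
      exact Ideal.Quotient.eq.2 (hH g x)
    rw [key σ, key τ]
  have h1 : Module.finrank (A ⧸ p) (B ⧸ P) = 1 := by
    rw [← IsGalois.card_aut_eq_finrank]
    exact Nat.card_unique
  intro b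
  obtain ⟨c, hc⟩ := (finrank_eq_one_iff_of_nonzero' (1 : B ⧸ P) one_ne_zero).1 h1 b
  exact ⟨c, by rw [← hc, Algebra.smul_def, mul_one]⟩

theorem Ideal.Quotient.mk_prod_out_smul {A B G : Type*} [CommRing A]
    [CommRing B] [Algebra A B] [Group G] [Finite G] [MulSemiringAction G B]
    [Algebra.IsInvariant A B G] [SMulCommClass G A B] (p : Ideal A) (P : Ideal B) [P.LiesOver p]
    [P.IsMaximal] [Fintype (G ⧸ P.inertia G)]
    [Fintype ((B ⧸ P) ≃ₐ[A ⧸ p] (B ⧸ P))] {w : B}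
    (hw : ∀ g ∈ P.inertia G, g • w = w)
    (hw1 : ∀ g ∉ MulAction.stabilizer G P, g • w - 1 ∈ P) :
    Ideal.Quotient.mk P (∏ q : G ⧸ P.inertia G, q.out • w) =
      ∏ τ : (B ⧸ P) ≃ₐ[A ⧸ p] (B ⧸ P), τ (Ideal.Quotient.mk P w) := by
  have hsurj := Ideal.Quotient.stabilizerHom_surjective G p P
  choose d hd using hsurj
  rw [map_prod]
  symm
  have hinj : ∀ g h : MulAction.stabilizer G P,
      Ideal.Quotient.stabilizerHom P p G g = Ideal.Quotient.stabilizerHom P p G h ↔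
      ((g : G) : G ⧸ P.inertia G) = ((h : G) : G ⧸ P.inertia G) := by
    intro g h
    rw [QuotientGroup.eq, ← inv_mul_eq_one, ← map_inv, ← map_mul, ← MonoidHom.mem_ker,
      Ideal.Quotient.ker_stabilizerHom]
    rfl
  refine Fintype.prod_of_injective (fun τ => ((d τ : G) : G ⧸ P.inertia G)) ?_ _ _ ?_ ?_
  · intro τ τ' h
    rw [← hd τ, ← hd τ']
    exact (hinj _ _).2 h
  · intro q hq
    rw [← map_one (Ideal.Quotient.mk P), Ideal.Quotient.eq]
    apply hw1
    intro hs
    apply hq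
    refine ⟨Ideal.Quotient.stabilizerHom P p G ⟨q.out, hs⟩, ?_⟩
    have := (hinj (d (Ideal.Quotient.stabilizerHom P p G ⟨q.out, hs⟩)) ⟨q.out, hs⟩).1 (hd _)
    exact this.trans (QuotientGroup.out_eq' q)
  · intro τ
    obtain ⟨i, hi⟩ := QuotientGroup.mk_out_eq_mul (P.inertia G) (d τ : G)
    show _ = Ideal.Quotient.mk P ((((d τ : G) : G ⧸ P.inertia G)).out • w)
    rw [hi, mul_smul, hw _ i.2]
    conv_lhs => rw [← hd τ]
    rfl

end

section

theorem IntermediateField.algebraMap_norm_fixedField {k L : Type*} [Field k] [Field L] [Algebra k L]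
    [FiniteDimensional k L] [IsGalois k L] (H : Subgroup (L ≃ₐ[k] L))
    [Fintype ((L ≃ₐ[k] L) ⧸ H)] (w : IntermediateField.fixedField H) :
    algebraMap k L (Algebra.norm k w) = ∏ q : (L ≃ₐ[k] L) ⧸ H, q.out (w : L) := by
  classical
  apply (algebraMap L (AlgebraicClosure L)).injective
  rw [← IsScalarTower.algebraMap_apply, Algebra.norm_eq_prod_embeddings, map_prod]
  symm
  let Φ : ((L ≃ₐ[k] L) ⧸ H) → (IntermediateField.fixedField H →ₐ[k] AlgebraicClosure L) :=
    fun q => (IsScalarTower.toAlgHom k L (AlgebraicClosure L)).comp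
      ((q.out : L ≃ₐ[k] L).toAlgHom.comp (IntermediateField.fixedField H).val)
  have hΦ : Function.Bijective Φ := by
    rw [Fintype.bijective_iff_injective_and_card]
    constructor
    · intro q q' h
      rw [← QuotientGroup.out_eq' q, ← QuotientGroup.out_eq' q', QuotientGroup.eq]
      have hle : IntermediateField.fixingSubgroup (IntermediateField.fixedField H) ≤ H :=
        (IntermediateField.fixingSubgroup_fixedField H).le
      apply hle
      rw [IntermediateField.mem_fixingSubgroup_iff]
      intro x hx
      have h1 := DFunLike.congr_fun h ⟨x, hx⟩
      have h2 : q.out x = q'.out x := (algebraMap L (AlgebraicClosure L)).injective h1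
      rw [AlgEquiv.mul_apply, ← h2]
      exact AlgEquiv.symm_apply_apply _ _
    · rw [AlgHom.card, ← Nat.card_eq_fintype_card]
      have h1 := IntermediateField.finrank_fixedField_eq_card H
      have h2 := Subgroup.card_mul_index H
      rw [IsGalois.card_aut_eq_finrank, ← Module.finrank_mul_finrank k
        (IntermediateField.fixedField H) L, h1, mul_comm] at h2
      exact Nat.eq_of_mul_eq_mul_right Nat.card_pos h2
  exact Fintype.prod_bijective Φ hΦ _ _ fun q => rfl


theorem Ideal.exists_fixed_sub_mem {B H : Type*} [CommRing B] [Group H] [Finite H]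
    [MulSemiringAction H B] (P : Ideal B) [P.IsMaximal] [Finite (B ⧸ P)]
    (hH : ∀ (h : H) (b : B), h • b - b ∈ P) (b : B) :
    ∃ a : B, (∀ h : H, h • a = a) ∧ a - b ∈ P := by
  let A := FixedPoints.subring B H
  have hcomm : SMulCommClass H A B := ⟨fun h a x => by
    show h • ((a : B) * x) = (a : B) * (h • x)
    rw [smul_mul', a.2 h]⟩
  have hinv : Algebra.IsInvariant A B H := ⟨fun x hx => ⟨⟨x, hx⟩, rfl⟩⟩
  have hInt := Algebra.IsInvariant.isIntegral A B H
  have hmax : (P.under A).IsMaximal := Ideal.isMaximal_comap_of_isIntegral_of_isMaximal P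
  obtain ⟨⟨a⟩, ha⟩ := Ideal.Quotient.algebraMap_surjective_of_forall_mem_inertia (P.under A) P hH
    (Ideal.Quotient.mk P b)
  exact ⟨a, a.2, Ideal.Quotient.eq.1 ha⟩

open NumberField
open scoped Pointwise in
theorem exists_inertia_data (L : Type*) [Field L] [NumberField L] [IsGalois ℚ L] (p : ℕ)
    [hpf : Fact p.Prime] (hp2 : p ≠ 2) :
    ∃ (k : IntermediateField ℚ L) (c : L) (r s t : k) (u : ℤ),
      Algebra.norm k c = (p : k) * r ∧ r ≠ 0 ∧
      Algebra.norm ℚ (s ^ 2 - r * t ^ 2) = (u : ℚ) ∧ legendreSym p u = -1 := by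
  classical
  have hpp : p.Prime := hpf.out
  let G := L ≃ₐ[ℚ] L
  let p₀ : Ideal ℤ := Ideal.span {(p : ℤ)}
  have hp₀ne : p₀ ≠ ⊥ := by
    rw [Ne, Ideal.span_singleton_eq_bot]
    exact_mod_cast hpp.ne_zero
  have hp₀prime : p₀.IsPrime :=
    (Ideal.span_singleton_prime (by exact_mod_cast hpp.ne_zero)).2 (Nat.prime_iff_prime_int.1 hpp)
  have hp₀max : p₀.IsMaximal := hp₀prime.isMaximal hp₀ne
  obtain ⟨P, hPmax, hPover⟩ := Ideal.exists_maximal_ideal_liesOver_of_isIntegral (S := 𝓞 L) p₀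
  have hP0 : P ≠ ⊥ := Ideal.ne_bot_of_liesOver_of_ne_bot hp₀ne P
  have hPfin : Finite (𝓞 L ⧸ P) := Ideal.finiteQuotientOfFreeOfNeBot P hP0
  have hmap : p₀.map (algebraMap ℤ (𝓞 L)) = Ideal.span {(p : 𝓞 L)} := by
    rw [Ideal.map_span, Set.image_singleton]
    simp
  have hmap0 : p₀.map (algebraMap ℤ (𝓞 L)) ≠ ⊥ := by
    rw [hmap, Ne, Ideal.span_singleton_eq_bot]
    exact_mod_cast hpp.ne_zero
  let I : Subgroup G := P.inertia G
  have hcard : Nat.card I = multiplicity P (Ideal.span {(p : 𝓞 L)}) := by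
    have hperf : PerfectField p₀.ResidueField := by
      have : Finite (ℤ ⧸ p₀) := Ideal.finiteQuotientOfFreeOfNeBot p₀ hp₀ne
      have : Finite p₀.ResidueField :=
        Finite.of_surjective _ (Ideal.bijective_algebraMap_quotient_residueField p₀).2
      infer_instance
    rw [Ideal.card_inertia_eq_ramificationIdxIn (G := G) p₀ P,
      Ideal.ramificationIdxIn_eq_ramificationIdx p₀ P G,
      ← Ideal.ramificationIdx'_eq_ramificationIdx p₀ P hp₀ne,
      Ideal.IsDedekindDomain.ramificationIdx'_eq_multiplicity hmap0 hPmax.isPrime, hmap]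
  obtain ⟨J, hfac, hJ⟩ : ∃ J, Ideal.span {(p : 𝓞 L)} = P ^ Fintype.card I * J ∧ ¬ J ≤ P := by
    have hfm : FiniteMultiplicity P (Ideal.span {(p : 𝓞 L)}) :=
      FiniteMultiplicity.of_prime_left (Ideal.prime_of_isPrime hP0 hPmax.isPrime) (hmap ▸ hmap0)
    obtain ⟨J, h1, h2⟩ := hfm.exists_eq_pow_mul_and_not_dvd
    rw [← hcard, Nat.card_eq_fintype_card] at h1
    exact ⟨J, h1, fun h => h2 (Ideal.dvd_iff_le.2 h)⟩
  have hIst : ∀ σ : I, σ • P = P := fun σ => Ideal.inertia_le_stabilizer P σ.2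
  have hπ : ∀ σ : G, σ • (p : 𝓞 L) = p := fun σ => by
    rw [← MulSemiringAction.toRingHom_apply, map_natCast]
  obtain ⟨c, r, hcr, hrJ, hrP⟩ := exists_prod_smul_eq_mul (H := I) hP0 hIst (fun σ => hπ σ)
    hfac hJ
  have hp0 : (p : 𝓞 L) ≠ 0 := by exact_mod_cast hpp.ne_zero
  have hrI : ∀ σ : I, σ • r = r := by
    intro σ
    apply mul_left_cancel₀ hp0
    have h1 := congrArg (fun x => σ • x) hcr
    simp only [smul_mul'] at h1
    rw [show σ • (p : 𝓞 L) = p from hπ σ, Finset.smul_prod'] at h1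
    rw [← h1, ← hcr]
    simp only [smul_smul]
    exact Fintype.prod_equiv (Equiv.mulLeft σ) _ _ fun τ => rfl
  have hI : ∀ (σ : I) (b : 𝓞 L), σ • b - b ∈ P := fun σ b => σ.2 b
  let _ := Ideal.Quotient.field P
  let _ := Ideal.Quotient.field p₀
  have hchar : ringChar (𝓞 L ⧸ P) ≠ 2 := by
    intro h
    have h1 := ringChar.Nat.cast_ringChar (R := 𝓞 L ⧸ P)
    rw [h] at h1
    have h2 : (2 : ℤ) ∈ P.under ℤ := by
      have h3 : Ideal.Quotient.mk P ((2 : ℕ) : 𝓞 L) = 0 := by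
        rw [map_natCast]
        exact h1
      rw [Ideal.Quotient.eq_zero_iff_mem] at h3
      simpa using h3
    rw [← hPover.over, Ideal.mem_span_singleton] at h2
    exact hp2 ((Nat.prime_dvd_prime_iff_eq hpp Nat.prime_two).1 (by exact_mod_cast h2))
  have hr0 : Ideal.Quotient.mk P r ≠ 0 := by rwa [Ne, Ideal.Quotient.eq_zero_iff_mem]
  obtain ⟨s', t', hst⟩ := exists_nonsquare_sq_sub_mul_sq hchar hr0
  obtain ⟨s₁, hs₁⟩ := Ideal.Quotient.mk_surjective ((s' - 1) / Ideal.Quotient.mk P r)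
  obtain ⟨t₁, ht₁⟩ := Ideal.Quotient.mk_surjective t'
  obtain ⟨s₀, hs₀I, hs₀⟩ := P.exists_fixed_sub_mem hI s₁
  obtain ⟨t₀, ht₀I, ht₀⟩ := P.exists_fixed_sub_mem hI t₁
  let w : 𝓞 L := (1 + r * s₀) ^ 2 - r * t₀ ^ 2
  have hwI : ∀ σ : I, σ • w = w := by
    intro σ
    simp only [w, smul_sub, smul_mul', smul_pow', smul_add, smul_one, hrI, hs₀I, ht₀I]
  have hwmk : Ideal.Quotient.mk P w = s' ^ 2 - Ideal.Quotient.mk P r * t' ^ 2 := by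
    have h1 : Ideal.Quotient.mk P s₀ = (s' - 1) / Ideal.Quotient.mk P r := by
      rw [← hs₁]; exact Ideal.Quotient.eq.2 hs₀
    have h2 : Ideal.Quotient.mk P t₀ = t' := by rw [← ht₁]; exact Ideal.Quotient.eq.2 ht₀
    simp only [w, map_sub, map_pow, map_mul, map_add, map_one, h1, h2]
    rw [mul_div_cancel₀ _ hr0]
    ring
  have hw1 : ∀ g ∉ MulAction.stabilizer G P, g • w - 1 ∈ P := by
    intro g hg
    have hwJ : w - 1 ∈ J := by
      have : w - 1 = r * (2 * s₀ + r * s₀ ^ 2 - t₀ ^ 2) := by simp only [w]; ring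
      rw [this]
      exact J.mul_mem_right _ hrJ
    have hpmem : Ideal.span {(p : 𝓞 L)} ≤ g⁻¹ • P := by
      rw [Ideal.span_singleton_le_iff_mem, Ideal.mem_inv_pointwise_smul_iff, hπ]
      have : (p : ℤ) ∈ P.under ℤ := by
        rw [← hPover.over]
        exact Ideal.mem_span_singleton_self _
      simpa using this
    rw [hfac] at hpmem
    have hgP : (g⁻¹ • P).IsPrime := inferInstance
    have hJg : J ≤ g⁻¹ • P := by
      rcases hgP.mul_le.1 hpmem with h | h
      · exfalso
        apply hg
        have h3 := hPmax.eq_of_le hgP.ne_top (Ideal.IsPrime.le_of_pow_le h)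
        rw [MulAction.mem_stabilizer_iff]
        nth_rewrite 1 [h3]
        exact smul_inv_smul g P
      · exact h
    have h4 := hJg hwJ
    rw [Ideal.mem_inv_pointwise_smul_iff, smul_sub, smul_one] at h4
    exact h4
  let k : IntermediateField ℚ L := IntermediateField.fixedField I
  have hmemk : ∀ x : 𝓞 L, (∀ σ : I, σ • x = x) → (x : L) ∈ k := by
    intro x hx σ
    have := congrArg (fun y : 𝓞 L => (y : L)) (hx σ)
    exact this
  let rk : k := ⟨(r : L), hmemk r hrI⟩
  let sk : k := ⟨((1 + r * s₀ : 𝓞 L) : L), hmemk _ fun σ => by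
    simp only [smul_mul', smul_add, smul_one, hrI, hs₀I]⟩
  let tk : k := ⟨(t₀ : L), hmemk _ ht₀I⟩
  have hwk : ((sk ^ 2 - rk * tk ^ 2 : k) : L) = (w : L) := by
    simp [sk, rk, tk, w]
  obtain ⟨u, hu⟩ : ∃ u : ℤ, (u : ℚ) = Algebra.norm ℚ (sk ^ 2 - rk * tk ^ 2) := by
    have hInt : IsIntegral ℤ (sk ^ 2 - rk * tk ^ 2 : k) := by
      rw [← isIntegral_algebraMap_iff (algebraMap k L).injective]
      show IsIntegral ℤ ((sk ^ 2 - rk * tk ^ 2 : k) : L)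
      rw [hwk]
      exact w.2
    obtain ⟨u, hu⟩ := IsIntegrallyClosed.isIntegral_iff.1 (Algebra.isIntegral_norm ℚ hInt)
    exact ⟨u, hu⟩
  refine ⟨k, c, rk, sk, tk, u, ?_, ?_, hu.symm, ?_⟩
  · apply (algebraMap k L).injective
    rw [Algebra.norm_eq_prod_automorphisms]
    have h1 := congrArg (fun y : 𝓞 L => (y : L)) hcr
    simp only [map_mul, map_prod, map_natCast] at h1 ⊢
    refine Eq.trans ?_ h1
    exact (Fintype.prod_equiv (IntermediateField.subgroupEquivAlgEquiv I).toEquiv _ _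
      fun σ => rfl).symm
  · intro h
    apply hrP
    have h1 : (r : L) = 0 := congrArg (fun y : k => (y : L)) h
    have h2 : r = 0 := by exact_mod_cast h1
    rw [h2]
    exact P.zero_mem
  · have hprod : ((u : ℤ) : 𝓞 L) = ∏ q : G ⧸ I, q.out • w := by
      apply RingOfIntegers.coe_injective
      have h1 : algebraMap ℚ L (Algebra.norm ℚ (sk ^ 2 - rk * tk ^ 2)) =
          ∏ q : G ⧸ I, q.out ((sk ^ 2 - rk * tk ^ 2 : k) : L) :=
        IntermediateField.algebraMap_norm_fixedField I (sk ^ 2 - rk * tk ^ 2)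
      rw [← hu, hwk] at h1
      simp only [map_prod, map_intCast] at h1 ⊢
      exact h1
    have h2 := Ideal.Quotient.mk_prod_out_smul (G := G) p₀ P (fun g hg => hwI ⟨g, hg⟩) hw1
    rw [← hprod] at h2
    have hF : Finite (ℤ ⧸ p₀) :=
      Finite.of_injective _ (algebraMap (ℤ ⧸ p₀) (𝓞 L ⧸ P)).injective
    have h3 := Algebra.norm_eq_prod_automorphisms (ℤ ⧸ p₀) (Ideal.Quotient.mk P w)
    have h4 : Algebra.norm (ℤ ⧸ p₀) (Ideal.Quotient.mk P w) = Ideal.Quotient.mk p₀ u := by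
      apply (algebraMap (ℤ ⧸ p₀) (𝓞 L ⧸ P)).injective
      rw [h3]
      refine Eq.trans ?_ (h2.symm.trans ?_)
      · congr!
      · simp
    have h5 := FiniteField.not_isSquare_norm (F := ℤ ⧸ p₀) hchar (hwmk ▸ hst)
    rw [h4] at h5
    rw [legendreSym.eq_neg_one_iff]
    rintro ⟨a, ha⟩
    apply h5
    refine ⟨Ideal.Quotient.mk p₀ (a.val : ℤ), ?_⟩
    rw [← map_mul, Ideal.Quotient.eq, Ideal.mem_span_singleton, ← ZMod.intCast_zmod_eq_zero_iff_dvd]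
    simp [ha]

end

theorem exists_quadratic_extension {k : Type v} [Field k] {r : k} (hr : ¬ IsSquare r) :
    ∃ (M : Type v) (_ : Field M) (_ : Algebra k M) (_ : FiniteDimensional k M) (ρ : M),
      ρ ^ 2 = algebraMap k M r ∧ ∀ s t : k,
        Algebra.norm k (algebraMap k M s + algebraMap k M t * ρ) = s ^ 2 - r * t ^ 2 := by
  have : Fact (∀ x : k, x ^ 2 ≠ r + 0 * x) := ⟨fun x hx => hr ⟨x, by linear_combination -hx⟩⟩
  refine ⟨QuadraticAlgebra k r 0, inferInstance, inferInstance,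
    FiniteDimensional.of_finrank_pos (by rw [QuadraticAlgebra.finrank_eq_two]; norm_num),
    ⟨0, 1⟩, ?_, fun s t => ?_⟩
  · rw [pow_two]
    ext <;> simp
  · have h : algebraMap k (QuadraticAlgebra k r 0) s +
        algebraMap k (QuadraticAlgebra k r 0) t * ⟨0, 1⟩ = ⟨s, t⟩ := by
      ext <;> simp
    rw [h, Algebra.norm_apply]
    refine (QuadraticAlgebra.det_toLinearMap_eq_norm _).trans ?_
    rw [QuadraticAlgebra.norm_def]
    ring

theorem represents_norm_sq_sub_mul_sq {k L : Type*} {K : Type u} [Field k] [Field L] [Field K]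
    [CharZero K] [Algebra ℚ k] [FiniteDimensional ℚ k] [Algebra k L] [FiniteDimensional k L]
    [Algebra ℚ K] {l : List K} (hl : ∀ a ∈ l, a ≠ 0)
    (H : ∀ (E : Type u) [Field E] (ι : K →+* E), (L →+* E) → Isotropic (pfisterWeight (l.map ι)))
    {p : ℕ} (hp : p ≠ 0) {c : L} {r s t : k} (hc : Algebra.norm k c = p * r) (hr : r ≠ 0) :
    Represents (pfisterWeight ((p : K) :: l))
      (algebraMap ℚ K (Algebra.norm ℚ (s ^ 2 - r * t ^ 2))) := by
  have hk : CharZero k := charZero_of_injective_algebraMap (algebraMap ℚ k).injective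
  have hl' : ∀ a ∈ (p : K) :: l, a ≠ 0 := by
    intro a ha
    rcases List.mem_cons.1 ha with rfl | ha
    · exact_mod_cast hp
    · exact hl a ha
  have key : ∀ (E : Type u) [Field E] (ι : K →+* E) (τ : k →+* E) (ρ : E), ρ ^ 2 = τ r →
      Isotropic (pfisterWeight (((p : K) :: l).map ι)) := by
    intro E _ ι τ ρ hρ
    let _ := τ.toAlgebra
    have h1 : Represents (pfisterWeight (l.map ι)) (algebraMap k E (Algebra.norm k c)) := by
      refine norm_represents (k := k) (M := L) (l.map ι) ?_ ?_ c
      · intro a ha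
        obtain ⟨b, hb, rfl⟩ := List.mem_map.1 ha
        exact (map_ne_zero ι).2 (hl b hb)
      · intro E' _ ι' τ' _
        rw [List.map_map]
        exact H E' (ι'.comp ι) τ'
    have hρ0 : ρ ≠ 0 := by
      rintro rfl
      apply hr
      apply τ.injective
      rw [← hρ, map_zero]
      ring
    have h2 := h1.mul_sq ρ⁻¹
    rw [hc, map_mul, map_natCast, show algebraMap k E r = ρ ^ 2 from hρ.symm,
      show ρ⁻¹ ^ 2 * ((p : E) * ρ ^ 2) = p by field_simp] at h2
    rw [List.map_cons, map_natCast]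
    exact isotropic_pfister_cons_iff.2 (Or.inr h2)
  by_cases hsq : IsSquare r
  · obtain ⟨ρ, hρ⟩ := hsq
    have h1 : ∀ y : k, Represents (pfisterWeight ((p : K) :: l))
        (algebraMap ℚ K (Algebra.norm ℚ y)) :=
      norm_represents (k := ℚ) (M := k) _ hl' fun E _ ι τ _ =>
        key E ι τ (τ ρ) (by rw [hρ, map_mul, pow_two])
    have h2 := (h1 (s + ρ * t)).pfister_mul (h1 (s - ρ * t))
    rwa [← map_mul, ← map_mul, show (s + ρ * t) * (s - ρ * t) = s ^ 2 - r * t ^ 2 by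
      rw [hρ]; ring] at h2
  · obtain ⟨M, _, _, _, ρ, hρ, hN⟩ := exists_quadratic_extension hsq
    let _ : Algebra ℚ M := ((algebraMap k M).comp (algebraMap ℚ k)).toAlgebra
    have : IsScalarTower ℚ k M := IsScalarTower.of_algebraMap_eq fun _ => rfl
    have : FiniteDimensional ℚ M := FiniteDimensional.trans ℚ k M
    have h1 : ∀ y : M, Represents (pfisterWeight ((p : K) :: l))
        (algebraMap ℚ K (Algebra.norm ℚ y)) :=
      norm_represents (k := ℚ) (M := M) _ hl' fun E _ ι τ _ =>
        key E ι (τ.comp (algebraMap k M)) (τ ρ) (by rw [← map_pow, hρ]; rfl)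
    have h2 := h1 (algebraMap k M s + algebraMap k M t * ρ)
    rwa [← Algebra.norm_norm (S := k), hN] at h2

theorem represents_pfister_singleton_of_int {K : Type*} [Field K] [CharZero K] {a q x y z : ℤ}
    {α γ : K} (hα : (a : K) = α) (hγ : (q : K) = γ) (hz : z ≠ 0)
    (h : x ^ 2 - a * y ^ 2 = q * z ^ 2) : Represents (pfisterWeight [α]) γ := by
  subst hα hγ
  have hz' : (z : K) ≠ 0 := by exact_mod_cast hz
  refine represents_pfister_cons.2 ⟨(x / z) ^ 2, (y / z) ^ 2, represents_pfister_nil.2 ⟨_, rfl⟩,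
    represents_pfister_nil.2 ⟨_, rfl⟩, ?_⟩
  have h' : (x : K) ^ 2 - a * y ^ 2 = q * z ^ 2 := by exact_mod_cast h
  field_simp
  linear_combination h'

theorem represents_neg_one {K : Type*} [Field K] [CharZero K] {p : ℕ} (hp : p.Prime)
    (hp4 : p % 4 = 1) (l : List K) : Represents (pfisterWeight ((p : K) :: l)) (-1) := by
  have := Fact.mk hp
  obtain ⟨a, b, hab⟩ := Nat.Prime.sq_add_sq (p := p) (by omega)
  have hb : b ≠ 0 := by
    rintro rfl
    have : Prime (a ^ 2) := by rw [show a ^ 2 = p by simpa using hab]; exact hp.prime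
    exact Nat.Prime.not_prime_pow le_rfl this.nat_prime
  have hb' : (b : K) ≠ 0 := by exact_mod_cast hb
  have h1 : Represents (pfisterWeight ((p : K) :: l)) (-(b : K) ^ 2) := by
    refine represents_pfister_cons.2 ⟨(a : K) ^ 2, 1 ^ 2, represents_pfister_sq _ _,
      represents_pfister_sq _ _, ?_⟩
    have : (a : K) ^ 2 + b ^ 2 = p := by exact_mod_cast hab
    linear_combination this
  have h2 := h1.mul_sq (b : K)⁻¹
  rwa [show (b : K)⁻¹ ^ 2 * -(b : K) ^ 2 = -1 by field_simp] at h2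

theorem exists_galois_numberField_splits (P : Polynomial ℚ) :
    ∃ (L : Type) (_ : Field L) (_ : NumberField L) (_ : IsGalois ℚ L),
      (P.map (algebraMap ℚ L)).Splits := by
  have h0 : CharZero P.SplittingField :=
    charZero_of_injective_algebraMap (algebraMap ℚ P.SplittingField).injective
  have h1 : NumberField P.SplittingField :=
    { to_charZero := h0
      to_finiteDimensional := by
        convert Polynomial.IsSplittingField.finiteDimensional P.SplittingField P
        exact Polynomial.IsSplittingField.splittingField P }
  have h2 : Normal ℚ P.SplittingField := by
    convert Normal.of_isSplittingField (E := P.SplittingField) P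
    exact Polynomial.IsSplittingField.splittingField P
  refine ⟨P.SplittingField, inferInstance, h1, ⟨⟩, ?_⟩
  convert Polynomial.IsSplittingField.splits P.SplittingField P
  exact Polynomial.IsSplittingField.splittingField P

theorem killsPfister_of_trdeg_lt {K : Type u} [Field K] [CharZero K] {d m : ℕ} {x : Fin d → K}
    (hx : IsTranscendenceBasis ℚ x) (hdm : d < m) {p u₁ u₂ : ℕ} [hpf : Fact p.Prime]
    (hp : p % 8 = 1) (hu₁ : u₁.Prime) (hu₂ : u₂.Prime) (h2 : u₁ ≠ 2) (hne : u₁ ≠ u₂)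
    (hl₁ : legendreSym p u₁ = -1) (hl₂ : legendreSym p u₂ = -1) : KillsPfister K p u₁ u₂ m := by
  intro f hf
  have hl : ∀ a ∈ List.ofFn f, a ≠ 0 := by
    intro a ha
    obtain ⟨i, rfl⟩ := (List.mem_ofFn' f a).1 ha
    exact hf i
  obtain ⟨P, hP0, hP⟩ := exists_polynomial_splits_isotropic hx (l := List.ofFn f) (by simpa)
  obtain ⟨L, _, _, _, hL⟩ := exists_galois_numberField_splits P
  obtain ⟨k, c, r, s, t, u, hc, hr, hu, hul⟩ := exists_inertia_data L p (by omega)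
  have hH : ∀ (E : Type u) [Field E] (ι : K →+* E), (L →+* E) →
      Isotropic (pfisterWeight ((List.ofFn f).map ι)) := by
    intro E _ ι τ
    apply hP
    rw [Subsingleton.elim (ι.comp (algebraMap ℚ K)) (τ.comp (algebraMap ℚ L)),
      ← Polynomial.map_map]
    exact hL.map τ
  have hrep := represents_norm_sq_sub_mul_sq hl hH hpf.out.ne_zero (s := s) (t := t) hc hr
  rw [hu, map_intCast] at hrep
  obtain ⟨ε, q, n, hε, hq, hn, ⟨a, b, ha, hb, hab⟩, ⟨x₁, y₁, z₁, hz₁, h₁⟩, ⟨x₂, y₂, z₂, hz₂, h₂⟩,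
    ⟨x₃, y₃, z₃, hz₃, h₃⟩⟩ := exists_certificate hp hu₁ hu₂ h2 hne hl₁ hl₂ hul
  have habs : Represents (pfisterWeight ((p : K) :: List.ofFn f)) ((u.natAbs : ℕ) : K) := by
    rcases Int.natAbs_eq u with h | h
    · rw [h] at hrep
      simpa using hrep
    · have h3 := hrep.pfister_mul (represents_neg_one hpf.out (by omega) (List.ofFn f))
      rw [h] at h3
      simpa using h3
  have hεn : Represents (pfisterWeight ((p : K) :: List.ofFn f)) ((ε : K) * n) := by
    have h3 := habs.mul_sq ((b : K) / a)
    have ha' : (a : K) ≠ 0 := by exact_mod_cast ha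
    have hab' : (ε : K) * n * a ^ 2 = u.natAbs * b ^ 2 := by exact_mod_cast hab
    rwa [show ((b : K) / a) ^ 2 * (u.natAbs : K) = ε * n by
      field_simp
      linear_combination -hab'] at h3
  refine ⟨q, n, ⟨by exact_mod_cast hq.ne', by exact_mod_cast hn.ne', ?_, ?_, ?_⟩, ?_⟩
  · exact represents_pfister_singleton_of_int (a := -(p : ℤ)) (q := q) (x := x₁) (y := y₁)
      (by simp) (by simp) hz₁ (by linear_combination h₁)
  · exact represents_pfister_singleton_of_int (a := -((p : ℤ) * u₁)) (q := q) (x := x₂) (y := y₂)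
      (by simp) (by simp) hz₂ (by linear_combination h₂)
  · exact represents_pfister_singleton_of_int (a := (p : ℤ) * q) (q := n) (x := x₃) (y := y₃)
      (by simp) (by simp) hz₃ h₃
  · rcases hε with rfl | rfl
    · exact Or.inl (isotropic_pfister_cons_iff.2 (Or.inr hεn))
    · exact Or.inr (isotropic_pfister_cons_iff.2 (Or.inr hεn))

section Swap

variable {K : Type*} [Field K]

theorem Represents.pfister_swap {a b : K} {l : List K} {c : K}
    (h : Represents (pfisterWeight (a :: b :: l)) c) :
    Represents (pfisterWeight (b :: a :: l)) c := by
  obtain ⟨_, _, hs, ht, rfl⟩ := represents_pfister_cons.1 h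
  obtain ⟨s₁, s₂, hs₁, hs₂, rfl⟩ := represents_pfister_cons.1 hs
  obtain ⟨t₁, t₂, ht₁, ht₂, rfl⟩ := represents_pfister_cons.1 ht
  exact represents_pfister_cons.2 ⟨s₁ - a * t₁, s₂ - a * t₂,
    represents_pfister_cons.2 ⟨_, _, hs₁, ht₁, rfl⟩,
    represents_pfister_cons.2 ⟨_, _, hs₂, ht₂, rfl⟩, by ring⟩

theorem Isotropic.pfister_swap {a b : K} {l : List K}
    (h : Isotropic (pfisterWeight (a :: b :: l))) :
    Isotropic (pfisterWeight (b :: a :: l)) := by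
  by_cases hl : Isotropic (pfisterWeight l)
  · simp only [isotropic_pfister_cons_iff, hl, true_or]
  by_cases hb : Represents (pfisterWeight l) b
  · exact isotropic_pfister_cons_iff.2 (Or.inr (represents_pfister_cons_of_tail hb))
  have ha : Represents (pfisterWeight (b :: l)) a := by
    rcases isotropic_pfister_cons_iff.1 h with h | h
    · exact absurd (isotropic_pfister_cons_iff.1 h) (by tauto)
    · exact h
  obtain ⟨s, t, hs, ht, e⟩ := represents_pfister_cons.1 ha
  by_cases h0 : t = 0
  · refine isotropic_pfister_cons_iff.2 (Or.inl (isotropic_pfister_cons_iff.2 (Or.inr ?_)))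
    rw [← e, h0, mul_zero, sub_zero]; exact hs
  · refine isotropic_pfister_cons_iff.2 (Or.inr (represents_pfister_cons.2
      ⟨s / t, t⁻¹, hs.pfister_div ht, ht.inv, ?_⟩))
    rw [← e]; field_simp; ring

theorem isotropic_pfister_sq_mul {a d : K} (hd : d ≠ 0) {l : List K}
    (h : Isotropic (pfisterWeight (d ^ 2 * a :: l))) : Isotropic (pfisterWeight (a :: l)) := by
  rcases isotropic_pfister_cons_iff.1 h with h | h
  · exact isotropic_pfister_cons_iff.2 (Or.inl h)
  · refine isotropic_pfister_cons_iff.2 (Or.inr ?_)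
    have := h.mul_sq d⁻¹
    rwa [show d⁻¹ ^ 2 * (d ^ 2 * a) = a by field_simp] at this

theorem isotropic_pfister_singleton {a : K} :
    Isotropic (pfisterWeight [a]) ↔ IsSquare a := by
  rw [isotropic_pfister_cons_iff, represents_pfister_nil, or_iff_right not_isotropic_pfister_nil]
  exact ⟨fun ⟨x, hx⟩ => ⟨x, by rw [← hx]; ring⟩, fun ⟨x, hx⟩ => ⟨x, by rw [hx]; ring⟩⟩

end Swap

section Residue

open IsLocalRing

variable {R K : Type*} [CommRing R] [IsDomain R] [ValuationRing R] [Field K] [Algebra R K]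
  [IsFractionRing R K]

/-- If `d² a = b` with `a`, `b` units of a valuation ring then `d` is a unit as well. -/
theorem exists_residue_of_sq_mul {a b : R} (ha : residue R a ≠ 0)
    (hb : residue R b ≠ 0) {d : K} (h : d ^ 2 * algebraMap R K a = algebraMap R K b) :
    ∃ r : ResidueField R, r ≠ 0 ∧ r ^ 2 * residue R a = residue R b := by
  have inj := IsFractionRing.injective R K
  have ha0 : algebraMap R K a ≠ 0 := fun h0 => ha (by
    rw [(map_eq_zero_iff _ inj).1 h0, map_zero])
  have hb0 : algebraMap R K b ≠ 0 := fun h0 => hb (by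
    rw [(map_eq_zero_iff _ inj).1 h0, map_zero])
  have hd : d ≠ 0 := by rintro rfl; exact hb0 (by rw [← h]; ring)
  rcases ValuationRing.isInteger_or_isInteger R d with ⟨r, hr⟩ | ⟨r, hr⟩
  · have e : r ^ 2 * a = b := inj (by rw [map_mul, map_pow, hr, h])
    have e' : residue R r ^ 2 * residue R a = residue R b := by rw [← e, map_mul, map_pow]
    refine ⟨residue R r, fun h0 => hb ?_, e'⟩
    rw [← e', h0]; ring
  · have e : r ^ 2 * b = a := inj (by
      rw [map_mul, map_pow, hr, ← h]; field_simp)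
    have e' : residue R r ^ 2 * residue R b = residue R a := by rw [← e, map_mul, map_pow]
    have hr0 : residue R r ≠ 0 := fun h0 => ha (by rw [← e', h0]; ring)
    refine ⟨(residue R r)⁻¹, inv_ne_zero hr0, ?_⟩
    rw [← e']; field_simp

/-- A nonzero value of a Pfister form over a valuation ring with anisotropic reduction is, up to
squares, a unit whose residue is a value of the reduction. -/
theorem exists_residue_represents {l : List R}
    (hl : ¬ Isotropic (pfisterWeight (l.map (residue R)))) {c : K} (hc0 : c ≠ 0)
    (hc : Represents (pfisterWeight (l.map (algebraMap R K))) c) :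
    ∃ d : K, d ≠ 0 ∧ ∃ a : R, residue R a ≠ 0 ∧ c = d ^ 2 * algebraMap R K a ∧
      Represents (pfisterWeight (l.map (residue R))) (residue R a) := by
  induction l generalizing c with
  | nil =>
    obtain ⟨x, rfl⟩ := represents_pfister_nil.1 hc
    exact ⟨x, fun h => hc0 (by rw [h]; ring), 1, by simp, by simp, by
      rw [map_one]; exact represents_pfister_one _⟩
  | cons b l ih =>
    rw [List.map_cons, isotropic_pfister_cons_iff, not_or] at hl
    obtain ⟨s, t, hs, ht, rfl⟩ := represents_pfister_cons.1 hc
    rw [List.map_cons]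
    have hb : residue R b ≠ 0 := fun h => hl.2 (by rw [h]; exact represents_zero _)
    have key : ∀ a₁ a₂ : R, Represents (pfisterWeight (l.map (residue R))) (residue R a₁) →
        Represents (pfisterWeight (l.map (residue R))) (residue R a₂) →
        (residue R a₁ ≠ 0 ∨ residue R a₂ ≠ 0) → residue R (a₁ - b * a₂) ≠ 0 ∧
        Represents (pfisterWeight (residue R b :: l.map (residue R)))
          (residue R (a₁ - b * a₂)) := by
      intro a₁ a₂ h₁ h₂ h
      rw [map_sub, map_mul]
      refine ⟨fun h0 => ?_, represents_pfister_cons.2 ⟨_, _, h₁, h₂, rfl⟩⟩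
      have h0 := sub_eq_zero.1 h0
      have h3 : residue R a₂ ≠ 0 := fun h4 => by
        rw [h4, mul_zero] at h0; tauto
      have := h₁.pfister_div h₂
      rw [h0, mul_div_assoc, div_self h3, mul_one] at this
      exact hl.2 this
    by_cases hs0 : s = 0
    · subst hs0
      have ht0 : t ≠ 0 := fun h => hc0 (by rw [h]; ring)
      obtain ⟨d, hd, a, ha, rfl, hr⟩ := ih hl.1 ht0 ht
      have := key 0 a (by rw [map_zero]; exact represents_zero _) hr (Or.inr ha)
      exact ⟨d, hd, _, this.1, by simp only [map_sub, map_mul, map_zero]; ring, this.2⟩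
    obtain ⟨d, hd, a, ha, rfl, hr⟩ := ih hl.1 hs0 hs
    by_cases ht0 : t = 0
    · subst ht0
      have := key a 0 hr (by rw [map_zero]; exact represents_zero _) (Or.inl ha)
      exact ⟨d, hd, _, this.1, by simp only [map_sub, map_mul, map_zero]; ring, this.2⟩
    obtain ⟨e, he, a', ha', rfl, hr'⟩ := ih hl.1 ht0 ht
    rcases ValuationRing.isInteger_or_isInteger R (e / d) with ⟨r, h⟩ | ⟨r, h⟩
    · have := key a (r ^ 2 * a') hr (by rw [map_mul, map_pow]; exact hr'.mul_sq _) (Or.inl ha)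
      refine ⟨d, hd, _, this.1, ?_, this.2⟩
      simp only [map_sub, map_mul, map_pow, h]; field_simp
    · have := key (r ^ 2 * a) a' (by rw [map_mul, map_pow]; exact hr.mul_sq _) hr' (Or.inr ha')
      refine ⟨e, he, _, this.1, ?_, this.2⟩
      simp only [map_sub, map_mul, map_pow, h]; field_simp

theorem not_isotropic_pfister_of_residue {l : List R}
    (hl : ¬ Isotropic (pfisterWeight (l.map (residue R)))) :
    ¬ Isotropic (pfisterWeight (l.map (algebraMap R K))) := by
  induction l with
  | nil => exact not_isotropic_pfister_nil
  | cons b l ih =>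
    rw [List.map_cons, isotropic_pfister_cons_iff, not_or] at hl ⊢
    refine ⟨ih hl.1, fun h => hl.2 ?_⟩
    have hb : residue R b ≠ 0 := fun h => hl.2 (by rw [h]; exact represents_zero _)
    have hb0 : algebraMap R K b ≠ 0 := fun h0 => hb (by
      rw [(map_eq_zero_iff _ (IsFractionRing.injective R K)).1 h0, map_zero])
    obtain ⟨d, hd, a, ha, e, hr⟩ := exists_residue_represents hl.1 hb0 h
    obtain ⟨r, hr0, e'⟩ := exists_residue_of_sq_mul ha hb e.symm
    rw [← e']
    exact hr.mul_sq _

theorem not_represents_irreducible_of_residue {l : List R}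
    (hl : ¬ Isotropic (pfisterWeight (l.map (residue R)))) {π : R} (hπ : Irreducible π) :
    ¬ Represents (pfisterWeight (l.map (algebraMap R K))) (algebraMap R K π) := by
  intro h
  have inj := IsFractionRing.injective R K
  obtain ⟨d, hd, a, ha, e, -⟩ := exists_residue_represents hl
    (fun h0 => hπ.ne_zero ((map_eq_zero_iff _ inj).1 h0)) h
  rcases ValuationRing.isInteger_or_isInteger R d with ⟨r, hr⟩ | ⟨r, hr⟩
  · have e' : π = r * (r * a) := inj (by rw [map_mul, map_mul, hr, e]; ring)
    have hru : IsUnit r := by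
      rcases hπ.isUnit_or_isUnit e' with h | h
      · exact h
      · exact isUnit_of_mul_isUnit_left h
    have hau : IsUnit a := by
      by_contra h; exact ha ((residue_eq_zero_iff a).2 h)
    exact hπ.not_isUnit (e' ▸ hru.mul (hru.mul hau))
  · have e' : r ^ 2 * π = a := inj (by rw [map_mul, map_pow, hr, e]; field_simp)
    apply ha
    rw [← e', map_mul, (residue_eq_zero_iff π).2 hπ.not_isUnit, mul_zero]

end Residue

theorem Represents.pfister_congr {K : Type*} [CommRing K] {l l' : List K} {c : K}
    (h : Represents (pfisterWeight l) c) (e : l = l') : Represents (pfisterWeight l') c :=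
  e ▸ h

theorem Isotropic.pfister_congr {K : Type*} [CommRing K] {l l' : List K}
    (h : Isotropic (pfisterWeight l)) (e : l = l') : Isotropic (pfisterWeight l') :=
  e ▸ h

/-- Some `m`-fold Pfister form stays anisotropic after multiplication by `⟨⟨ε n, p⟩⟩` for all
certified `n` and all `ε` among `u₁, u₂`. -/
def SurvivesPfister (K : Type*) [CommRing K] (p u₁ u₂ : ℕ) (m : ℕ) : Prop :=
  ¬ IsSquare (-(p : K)) ∧ ¬ IsSquare (-((p : K) * u₁)) ∧
    ∃ t : List K, t.length = m ∧ (∀ a ∈ t, a ≠ 0) ∧ ∀ q n : K, Certificate (p : K) u₁ q n →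
      ¬ Isotropic (pfisterWeight ((u₁ : K) * n :: (p : K) :: t)) ∧
        ¬ Isotropic (pfisterWeight ((u₂ : K) * n :: (p : K) :: t))

theorem SurvivesPfister.not_killsPfister {K : Type*} [CommRing K] {p u₁ u₂ m : ℕ}
    (h : SurvivesPfister K p u₁ u₂ m) : ¬ KillsPfister K p u₁ u₂ m := by
  obtain ⟨-, -, t, rfl, ht, H⟩ := h
  intro hk
  obtain ⟨q, n, hc, hi⟩ := hk t.get fun i => ht _ (List.get_mem t i)
  rw [List.ofFn_get] at hi
  exact hi.elim (H q n hc).1 (H q n hc).2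

open IsLocalRing in
/-- A surviving form over the residue field yields one with one more slot, the uniformizer, over
the fraction field. -/
theorem SurvivesPfister.of_residueField {R K : Type*} [CommRing R] [IsDomain R] [ValuationRing R]
    [Field K] [Algebra R K] [IsFractionRing R K] [CharZero (ResidueField R)]
    {π : R} (hπ : Irreducible π) {p u₁ u₂ m : ℕ} (hp : p ≠ 0) (hu₁ : u₁ ≠ 0)
    (h : SurvivesPfister (ResidueField R) p u₁ u₂ m) : SurvivesPfister K p u₁ u₂ (m + 1) := by
  have inj := IsFractionRing.injective R K
  obtain ⟨h₁, h₂, t, rfl, ht, H⟩ := h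
  obtain ⟨t, rfl⟩ : ∃ T : List R, t = T.map (residue R) := by
    have : t ∈ Set.range (List.map (residue R)) := by
      rw [Set.range_list_map]
      exact fun x _ => residue_surjective x
    obtain ⟨T, hT⟩ := this
    exact ⟨T, hT.symm⟩
  have a₁ : ¬ Isotropic (pfisterWeight ([-(p : R)].map (residue R))) := by
    rw [List.map_singleton, isotropic_pfister_singleton]; simpa using h₁
  have a₂ : ¬ Isotropic (pfisterWeight ([-((p : R) * u₁)].map (residue R))) := by
    rw [List.map_singleton, isotropic_pfister_singleton]; simpa using h₂
  have hpk : (p : ResidueField R) ≠ 0 := by exact_mod_cast hp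
  have huk : (u₁ : ResidueField R) ≠ 0 := by exact_mod_cast hu₁
  refine ⟨?_, ?_, algebraMap R K π :: t.map (algebraMap R K), by simp, ?_, ?_⟩
  · have := not_isotropic_pfister_of_residue (K := K) a₁
    rw [List.map_singleton, isotropic_pfister_singleton] at this; simpa using this
  · have := not_isotropic_pfister_of_residue (K := K) a₂
    rw [List.map_singleton, isotropic_pfister_singleton] at this; simpa using this
  · intro a ha
    rcases List.mem_cons.1 ha with rfl | ha
    · exact fun h0 => hπ.ne_zero ((map_eq_zero_iff _ inj).1 h0)
    · obtain ⟨b, hb, rfl⟩ := List.mem_map.1 ha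
      intro h0
      refine ht _ (List.mem_map_of_mem hb) ?_
      rw [(map_eq_zero_iff _ inj).1 h0, map_zero]
  rintro q n ⟨hq, hn, hq₁, hq₂, hqn⟩
  obtain ⟨c, hc, a, ha, rfl, hra⟩ := exists_residue_represents (K := K) a₁ hq
    (hq₁.pfister_congr (by simp))
  obtain ⟨c', hc', a', ha', e, hra'⟩ := exists_residue_represents (K := K) a₂ hq
    (hq₂.pfister_congr (by simp))
  obtain ⟨r, hr0, hr⟩ := exists_residue_of_sq_mul (K := K) ha' ha (d := c' / c) (by
    field_simp; rw [e])
  have hra'' : Represents (pfisterWeight ([-((p : R) * u₁)].map (residue R))) (residue R a) := by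
    rw [← hr]; exact hra'.mul_sq r
  rw [List.map_singleton, map_neg, map_natCast] at hra
  rw [List.map_singleton, map_neg, map_mul, map_natCast, map_natCast] at hra''
  have a₃ : ¬ Isotropic (pfisterWeight ([(p : R) * a].map (residue R))) := by
    intro h0
    refine (H (residue R a) u₁ ⟨ha, huk, hra, hra'', ?_⟩).1 ?_
    · rw [List.map_singleton, map_mul, map_natCast] at h0
      exact h0.pfister_universal two_ne_zero (by
        intro x hx
        rw [List.mem_singleton.1 hx]
        exact mul_ne_zero hpk ha) _
    · rw [isotropic_pfister_cons_iff, ← pow_two]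
      exact Or.inr (represents_pfister_sq _ _)
  have hn' : Represents (pfisterWeight ([(p : R) * a].map (algebraMap R K))) n := by
    obtain ⟨s, t, hs, ht, rfl⟩ := represents_pfister_cons.1 hqn
    rw [List.map_singleton]
    refine represents_pfister_cons.2 ⟨s, c ^ 2 * t, hs, ht.mul_sq c, ?_⟩
    rw [map_mul, map_natCast]; ring
  obtain ⟨d, hd, b, hb, rfl, hrb⟩ := exists_residue_represents a₃ hn hn'
  rw [List.map_singleton, map_mul, map_natCast] at hrb
  have key : ∀ ε : ℕ, ¬ Isotropic (pfisterWeight ((ε : ResidueField R) * residue R b ::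
      (p : ResidueField R) :: t.map (residue R))) →
      ¬ Isotropic (pfisterWeight ((ε : K) * (d ^ 2 * algebraMap R K b) :: (p : K) ::
        algebraMap R K π :: t.map (algebraMap R K))) := by
    intro ε hε hi
    have el : ((ε : R) * b :: (p : R) :: t).map (residue R) =
        (ε : ResidueField R) * residue R b :: (p : ResidueField R) :: t.map (residue R) := by simp
    have el' : ((ε : R) * b :: (p : R) :: t).map (algebraMap R K) =
        (ε : K) * algebraMap R K b :: (p : K) :: t.map (algebraMap R K) := by simp
    rw [← el] at hε
    have n₁ := not_isotropic_pfister_of_residue (K := K) hε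
    have n₂ := not_represents_irreducible_of_residue (K := K) hε hπ
    rw [el'] at n₁ n₂
    rw [mul_left_comm] at hi
    have hi := isotropic_pfister_sq_mul hd hi
    have hi : Isotropic (pfisterWeight (algebraMap R K π :: (ε : K) * algebraMap R K b :: (p : K) ::
        t.map (algebraMap R K))) := by
      refine Isotropic.pfister_swap ?_
      rcases isotropic_pfister_cons_iff.1 hi with h | h
      · exact isotropic_pfister_cons_iff.2 (Or.inl h.pfister_swap)
      · exact isotropic_pfister_cons_iff.2 (Or.inr h.pfister_swap)
    exact (isotropic_pfister_cons_iff.1 hi).elim n₁ n₂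
  have := H _ _ ⟨ha, hb, hra, hra'', hrb⟩
  exact ⟨key _ this.1, key _ this.2⟩

/-- Survival of the empty form descends along field embeddings. -/
theorem SurvivesPfister.of_map {K L : Type*} [Field K] [Field L] (f : K →+* L) {p u₁ u₂ : ℕ}
    (h : SurvivesPfister L p u₁ u₂ 0) : SurvivesPfister K p u₁ u₂ 0 := by
  obtain ⟨h₁, h₂, t, ht, -, H⟩ := h
  obtain rfl := List.length_eq_zero_iff.1 ht
  refine ⟨fun h => h₁ (by simpa using h.map f), fun h => h₂ (by simpa using h.map f), [], rfl,
    by simp, ?_⟩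
  rintro q n ⟨hq, hn, c₁, c₂, c₃⟩
  have := H (f q) (f n) ⟨by simpa using hq, by simpa using hn,
    (c₁.pfister_map f).pfister_congr (by simp),
    (c₂.pfister_map f).pfister_congr (by simp), (c₃.pfister_map f).pfister_congr (by simp)⟩
  exact ⟨fun h => this.1 ((h.pfister_map f).pfister_congr (by simp)),
    fun h => this.2 ((h.pfister_map f).pfister_congr (by simp))⟩

section Padic

open Polynomial

variable {p : ℕ} [Fact p.Prime]

theorem PadicInt.isUnit_natCast_of_coprime {k : ℕ} (h : p.Coprime k) : IsUnit (k : ℤ_[p]) :=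
  PadicInt.isUnit_iff.2 (PadicInt.norm_natCast_eq_one_iff.2 h)

theorem PadicInt.isSquare_one_add_p_mul (hp : p ≠ 2) (r : ℤ_[p]) :
    IsSquare (1 + (p : ℤ_[p]) * r) := by
  have h2 : ‖(2 : ℤ_[p])‖ = 1 := by
    have : p.Coprime 2 := ((Nat.coprime_primes Fact.out Nat.prime_two).2 hp)
    exact_mod_cast PadicInt.norm_natCast_eq_one_iff.2 this
  obtain ⟨z, hz, -⟩ := hensels_lemma (p := p) (R := ℤ_[p]) (a := 1)
    (F := X ^ 2 - C (1 + (p : ℤ_[p]) * r)) (by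
      simp only [coe_aeval_eq_eval, eval_sub, eval_pow, eval_X, eval_C, derivative_sub,
        derivative_X_pow, derivative_C, sub_zero, eval_mul, one_pow]
      rw [show (1 : ℤ_[p]) - (1 + p * r) = p * (-r) by ring]
      simp only [Nat.cast_ofNat, mul_one, h2, one_pow]
      exact (PadicInt.norm_lt_one_iff_dvd _).2 (dvd_mul_right _ _))
  simp only [coe_aeval_eq_eval, eval_sub, eval_pow, eval_X, eval_C] at hz
  exact ⟨z, by rw [← pow_two]; exact (sub_eq_zero.1 hz).symm⟩

/-- Values of the form `x² - p w y²` over `ℚ_[p]` for a unit `w`. -/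
theorem Padic.sq_or_of_represents (hp : p ≠ 2) {w : ℤ_[p]} (hw : IsUnit w) {a q : ℚ_[p]}
    (ha : a = p * w) (h : Represents (pfisterWeight [a]) q) :
    ∃ z : ℚ_[p], q = z ^ 2 ∨ q = -a * z ^ 2 := by
  obtain ⟨_, _, hs, ht, rfl⟩ := represents_pfister_cons.1 h
  obtain ⟨s, rfl⟩ := represents_pfister_nil.1 hs
  obtain ⟨t, rfl⟩ := represents_pfister_nil.1 ht
  obtain ⟨w, rfl⟩ := hw
  have key : ∀ r : ℤ_[p], ∃ z : ℚ_[p], 1 + (p : ℚ_[p]) * r = z ^ 2 := by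
    intro r
    obtain ⟨z, hz⟩ := PadicInt.isSquare_one_add_p_mul hp r
    refine ⟨z, ?_⟩
    have := congrArg (fun x : ℤ_[p] => (x : ℚ_[p])) hz
    simpa [pow_two] using this
  by_cases hs0 : s = 0
  · exact ⟨t, Or.inr (by rw [hs0]; ring)⟩
  by_cases ht0 : ‖t / s‖ ≤ 1
  · obtain ⟨r, hr⟩ : ∃ r : ℤ_[p], (r : ℚ_[p]) = t / s := ⟨⟨t / s, ht0⟩, rfl⟩
    obtain ⟨z, hz⟩ := key (-(w * r ^ 2))
    refine ⟨s * z, Or.inl ?_⟩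
    rw [mul_pow, ← hz, ha]
    push_cast
    rw [hr]
    field_simp
    ring
  · have ht1 : t ≠ 0 := by rintro rfl; simp at ht0
    have h1 : ‖s / t‖ < 1 := by
      rw [not_le] at ht0
      rw [← inv_div, norm_inv]
      exact inv_lt_one_of_one_lt₀ ht0
    obtain ⟨r, hr⟩ := (PadicInt.norm_lt_one_iff_dvd (⟨s / t, h1.le⟩ : ℤ_[p])).1 h1
    have hr : s / t = p * r := congrArg (fun x : ℤ_[p] => (x : ℚ_[p])) hr
    obtain ⟨z, hz⟩ := key (-(((w⁻¹ : ℤ_[p]ˣ) : ℤ_[p]) * r ^ 2))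
    refine ⟨t * z, Or.inr ?_⟩
    have hs : s = p * r * t := by rw [← hr]; field_simp
    have hw : ((w : ℤ_[p]) : ℚ_[p]) * (((w⁻¹ : ℤ_[p]ˣ) : ℤ_[p]) : ℚ_[p]) = 1 := by
      exact_mod_cast congrArg (fun x : ℤ_[p] => (x : ℚ_[p])) w.mul_inv
    rw [mul_pow, ← hz, ha, hs]
    push_cast
    linear_combination (- (p:ℚ_[p]) ^ 2 * r ^ 2 * t ^ 2) * hw

theorem Padic.not_isSquare_p_mul {w : ℤ_[p]} (hw : IsUnit w) {a : ℚ_[p]} (ha : a = p * w) :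
    ¬ IsSquare a := by
  rintro ⟨x, hx⟩
  refine not_represents_irreducible_of_residue (R := ℤ_[p]) (K := ℚ_[p]) (l := [])
    not_isotropic_pfister_nil (π := p * w) ?_ (represents_pfister_nil.2 ⟨x, ?_⟩)
  · exact (irreducible_mul_isUnit hw).2 PadicInt.irreducible_p
  · rw [pow_two, ← hx, ha]; simp

theorem Padic.not_isSquare_of_legendreSym {k : ℕ} (h : legendreSym p k = -1) :
    ¬ IsSquare (k : ℚ_[p]) := by
  rintro ⟨x, hx⟩
  rw [legendreSym.eq_neg_one_iff] at h
  have hx1 : ‖x‖ ≤ 1 := by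
    have : ‖x‖ * ‖x‖ ≤ 1 := by
      rw [← norm_mul, ← hx]
      exact (k : ℤ_[p]).2
    nlinarith [norm_nonneg x]
  obtain ⟨y, hy⟩ : ∃ y : ℤ_[p], (y : ℚ_[p]) = x := ⟨⟨x, hx1⟩, rfl⟩
  have : (k : ℤ_[p]) = y * y := Subtype.ext (by simpa [hy] using hx)
  refine h ⟨PadicInt.toZMod y, ?_⟩
  rw [← map_mul, ← this]; simp

theorem survivesPfister_padic (hp : p ≠ 2) {u₁ u₂ : ℕ} (h₁ : legendreSym p u₁ = -1)
    (h₂ : legendreSym p u₂ = -1) : SurvivesPfister ℚ_[p] p u₁ u₂ 0 := by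
  have hcop : ∀ u : ℕ, legendreSym p u = -1 → IsUnit (u : ℤ_[p]) := by
    intro u hu
    refine PadicInt.isUnit_natCast_of_coprime ((Nat.Prime.coprime_iff_not_dvd Fact.out).2 ?_)
    intro hd
    have : legendreSym p u = 0 := by
      rw [legendreSym.eq_zero_iff]
      exact_mod_cast (ZMod.natCast_eq_zero_iff u p).2 hd
    omega
  have hp0 : (p : ℚ_[p]) ≠ 0 := by exact_mod_cast (Fact.out : p.Prime).ne_zero
  refine ⟨?_, ?_, [], rfl, by simp, ?_⟩
  · exact Padic.not_isSquare_p_mul (w := -1) (by simp) (by simp)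
  · exact Padic.not_isSquare_p_mul (w := -u₁) (hcop _ h₁).neg (by simp)
  rintro q n ⟨hq, hn, hq₁, hq₂, hqn⟩
  obtain ⟨z, rfl⟩ : ∃ z : ℚ_[p], q = z ^ 2 := by
    obtain ⟨z, h | h⟩ := Padic.sq_or_of_represents hp (w := -1) (by simp) (by simp) hq₁
    · exact ⟨z, h⟩
    obtain ⟨z', h' | h'⟩ := Padic.sq_or_of_represents hp (w := -u₁) (hcop _ h₁).neg (by simp) hq₂
    · exact ⟨z', h'⟩
    exfalso
    refine Padic.not_isSquare_of_legendreSym h₁ ⟨z / z', ?_⟩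
    have hz' : z' ≠ 0 := by rintro rfl; exact hq (by rw [h']; ring)
    rw [h] at h'
    have : z ^ 2 = u₁ * z' ^ 2 := by
      refine mul_left_cancel₀ hp0 ?_
      linear_combination h'
    field_simp
    rw [this]
  have hz : z ≠ 0 := by rintro rfl; exact hq (by ring)
  have hn' : Represents (pfisterWeight [(p : ℚ_[p])]) n := by
    obtain ⟨s, t, hs, ht, rfl⟩ := represents_pfister_cons.1 hqn
    exact represents_pfister_cons.2 ⟨s, z ^ 2 * t, hs, ht.mul_sq z, by ring⟩
  have key : ∀ u : ℕ, legendreSym p u = -1 →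
      ¬ Isotropic (pfisterWeight [(u : ℚ_[p]) * n, (p : ℚ_[p])]) := by
    intro u hu hi
    rcases isotropic_pfister_cons_iff.1 hi with hi | hi
    · exact Padic.not_isSquare_p_mul (w := 1) (by simp) (by simp)
        (isotropic_pfister_singleton.1 hi)
    · have := hi.pfister_div hn'
      rw [mul_div_assoc, div_self hn, mul_one] at this
      obtain ⟨y, h | h⟩ := Padic.sq_or_of_represents hp (w := 1) (by simp) (by simp) this
      · exact Padic.not_isSquare_of_legendreSym hu ⟨y, by rw [h]; ring⟩
      · refine Padic.not_isSquare_p_mul (w := -u) (hcop _ hu).neg rfl ⟨p * y, ?_⟩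
        push_cast
        linear_combination (-(p : ℚ_[p])) * h
  exact ⟨key _ h₁, key _ h₂⟩

end Padic

section PrimeDivisors

open Polynomial

/-- A nonconstant integer polynomial has prime divisors outside any given finite set. -/
theorem Polynomial.exists_prime_dvd_eval {F : ℤ[X]} (hF : 0 < F.natDegree) {N : ℕ} (hN : N ≠ 0) :
    ∃ p : ℕ, p.Prime ∧ ¬ p ∣ N ∧ ∃ n : ℤ, (p : ℤ) ∣ F.eval n := by
  by_cases h0 : F.eval 0 = 0
  · obtain ⟨p, hp, hpp⟩ := Nat.exists_infinite_primes (N + 1)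
    exact ⟨p, hpp, fun h => by have := Nat.le_of_dvd (Nat.pos_of_ne_zero hN) h; omega, 0,
      by rw [h0]; exact dvd_zero _⟩
  set c := F.eval 0 with hc
  have hFc : F.coeff 0 = c := by rw [hc, coeff_zero_eq_eval_zero]
  set M : ℤ → ℤ := fun k => N * k * F.divX.eval (c * N * k) + 1 with hM
  have hev : ∀ k : ℤ, F.eval (c * N * k) = c * M k := by
    intro k
    conv_lhs => rw [← divX_mul_X_add F]
    simp only [eval_add, eval_mul, eval_X, eval_C, hFc, hM]
    ring
  obtain ⟨k, hk⟩ : ∃ k, (M k).natAbs ≠ 1 := by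
    by_contra! hall
    have hz : (F - C c) * (F + C c) = 0 := by
      refine eq_zero_of_infinite_isRoot _ ((Set.infinite_range_of_injective
        (f := fun k : ℤ => c * N * k) ?_).mono ?_)
      · intro a b hab
        exact mul_left_cancel₀ (mul_ne_zero h0 (by exact_mod_cast hN)) hab
      · rintro _ ⟨k, rfl⟩
        simp only [Set.mem_ofPred_eq, IsRoot.def, eval_mul, eval_sub, eval_add, eval_C, hev]
        rcases Int.natAbs_eq_iff.1 (hall k) with h | h <;> rw [h] <;> push_cast <;> ring
    have hne : ∀ d : ℤ, F ≠ C d := by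
      rintro d h; rw [h, natDegree_C] at hF; exact hF.false
    rcases mul_eq_zero.1 hz with h | h
    · exact hne c (sub_eq_zero.1 h)
    · exact hne (-c) (by rw [C_neg]; exact eq_neg_of_add_eq_zero_left h)
  obtain ⟨p, hp, hpd⟩ := Nat.exists_prime_and_dvd hk
  have hpd' : (p : ℤ) ∣ M k := Int.natCast_dvd.2 hpd
  refine ⟨p, hp, fun h => ?_, _, (hev k) ▸ hpd'.mul_left c⟩
  have h1 : (p : ℤ) ∣ N * k * F.divX.eval (c * N * k) :=
    ((Int.natCast_dvd_natCast.2 h).mul_right k).mul_right _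
  have := (dvd_add_right h1).1 hpd'
  exact hp.one_lt.ne' (by exact_mod_cast Int.eq_one_of_dvd_one (by positivity) this)

theorem exists_int_bezout {f : ℚ[X]} (hf : f.Separable) (hd : 0 < f.natDegree) :
    ∃ F A B : ℤ[X], ∃ c D : ℤ, c ≠ 0 ∧ D ≠ 0 ∧ 0 < F.natDegree ∧
      F.map (Int.castRingHom ℚ) = C (c : ℚ) * f ∧ A * F + B * derivative F = C D := by
  have clear : ∀ g : ℚ[X], ∃ c : ℤ, c ≠ 0 ∧ ∃ G : ℤ[X],
      G.map (Int.castRingHom ℚ) = C (c : ℚ) * g := by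
    intro g
    obtain ⟨b, hb0, hb⟩ := IsLocalization.integerNormalization_spec (nonZeroDivisors ℤ) g
    refine ⟨b, nonZeroDivisors.ne_zero hb0, _, hb.trans ?_⟩
    ext n
    simp
  obtain ⟨c, hc, F, hF⟩ := clear f
  obtain ⟨a, b, hab⟩ := hf
  obtain ⟨c₁, hc₁, A, hA⟩ := clear a
  obtain ⟨c₂, hc₂, B, hB⟩ := clear b
  refine ⟨F, C c₂ * A, C c₁ * B, c, c₁ * c₂ * c, hc, by positivity, ?_, hF, ?_⟩
  · have : (F.map (Int.castRingHom ℚ)).natDegree = F.natDegree :=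
      natDegree_map_eq_of_injective (RingHom.injective_int _) F
    rw [← this, hF, natDegree_C_mul (by exact_mod_cast hc)]; exact hd
  · apply map_injective (Int.castRingHom ℚ) (RingHom.injective_int _)
    simp only [Polynomial.map_add, Polynomial.map_mul, map_C, ← derivative_map, hF, hA, hB,
      derivative_C_mul]
    simp only [map_mul, eq_intCast]
    linear_combination (C (c₁ : ℚ) * C (c₂ : ℚ) * C (c : ℚ)) * hab

/-- A number field embeds into `ℚ_[p]` for some prime `p` not dividing a given integer. -/
theorem NumberField.exists_ringHom_padic (L : Type*) [Field L] [NumberField L] {N : ℕ}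
    (hN : N ≠ 0) : ∃ (p : ℕ) (_ : Fact p.Prime), ¬ p ∣ N ∧ Nonempty (L →+* ℚ_[p]) := by
  let pb := Field.powerBasisOfFiniteOfSeparable ℚ L
  have hInt := pb.isIntegral_gen
  obtain ⟨F, A, B, c, D, hc, hD, hdeg, hF, hAB⟩ := exists_int_bezout
    (Algebra.IsSeparable.isSeparable ℚ pb.gen) (minpoly.natDegree_pos hInt)
  obtain ⟨p, hp, hpN, n, hn⟩ := Polynomial.exists_prime_dvd_eval hdeg
    (mul_ne_zero hN (Int.natAbs_ne_zero.2 hD))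
  have := Fact.mk hp
  have hpD : ¬ (p : ℤ) ∣ D := fun h => hpN ((Int.natCast_dvd.1 h).mul_left N)
  have hpF' : ¬ (p : ℤ) ∣ (derivative F).eval n := fun h => hpD (by
    have := congrArg (eval n) hAB
    simp only [eval_add, eval_mul, eval_C] at this
    rw [← this]
    exact dvd_add (hn.mul_left _) (h.mul_left _))
  have hev : ∀ G : ℤ[X], aeval (n : ℤ_[p]) G = ((G.eval n : ℤ) : ℤ_[p]) := fun G => by
    have := aeval_algebraMap_apply ℤ_[p] n G
    simpa [coe_aeval_eq_eval] using this
  obtain ⟨z, hz, -⟩ := hensels_lemma (p := p) (R := ℤ) (F := F) (a := (n : ℤ_[p])) (by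
    rw [hev, hev]
    have h1 : ‖(((derivative F).eval n : ℤ) : ℤ_[p])‖ = 1 := by
      refine le_antisymm (PadicInt.norm_le_one _) (not_lt.1 fun h => hpF' ?_)
      exact (PadicInt.norm_int_lt_one_iff_dvd _).1 h
    rw [h1, one_pow]
    exact (PadicInt.norm_int_lt_one_iff_dvd _).2 hn)
  refine ⟨p, ⟨hp⟩, fun h => hpN (h.mul_right _), ⟨(pb.lift (z : ℚ_[p]) ?_).toRingHom⟩⟩
  have h1 : aeval (z : ℚ_[p]) F = 0 := by
    have := aeval_algebraMap_apply ℚ_[p] z F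
    rw [hz, map_zero] at this
    exact this
  have h2 : aeval (z : ℚ_[p]) (F.map (Int.castRingHom ℚ)) = 0 := by
    rw [← h1]; exact aeval_map_algebraMap ℚ _ F
  rw [hF, map_mul, aeval_C] at h2
  refine (mul_eq_zero.1 h2).resolve_left ?_
  simpa using hc

theorem NumberField.exists_ringHom_padic_mod_eight (K : Type*) [Field K] [NumberField K] :
    ∃ (p : ℕ) (_ : Fact p.Prime), p % 8 = 1 ∧ Nonempty (K →+* ℚ_[p]) := by
  let L := CyclotomicField 8 K
  have : CharZero L := charZero_of_injective_algebraMap (algebraMap K L).injective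
  have : FiniteDimensional K L := IsCyclotomicExtension.finiteDimensional {8} K L
  have : FiniteDimensional ℚ L := FiniteDimensional.trans ℚ K L
  have : NumberField L := ⟨⟩
  obtain ⟨p, hp, hp2, ⟨f⟩⟩ := NumberField.exists_ringHom_padic L two_ne_zero
  refine ⟨p, hp, ?_, ⟨f.comp (algebraMap K L)⟩⟩
  have hζ := IsCyclotomicExtension.zeta_spec 8 K L
  set ζ := IsCyclotomicExtension.zeta 8 K L
  have h4 : ζ ^ 4 = -1 := by
    have h8 := hζ.pow_eq_one
    have h4 : ζ ^ 4 ≠ 1 := hζ.pow_ne_one_of_pos_of_lt (by norm_num) (by norm_num)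
    have : (ζ ^ 4 - 1) * (ζ ^ 4 + 1) = 0 := by linear_combination h8
    rcases mul_eq_zero.1 this with h | h
    · exact absurd (sub_eq_zero.1 h) h4
    · exact eq_neg_of_add_eq_zero_left h
  have hn : ‖f ζ‖ ≤ 1 := by
    have : ‖f ζ‖ ^ 4 = 1 := by rw [← norm_pow, ← map_pow, h4]; simp
    exact le_of_eq ((pow_eq_one_iff_of_nonneg (norm_nonneg _) (by norm_num)).1 this)
  obtain ⟨y, hy⟩ : ∃ y : ℤ_[p], (y : ℚ_[p]) = f ζ := ⟨⟨f ζ, hn⟩, rfl⟩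
  have hy4 : y ^ 4 = -1 := Subtype.ext (by
    push_cast
    rw [hy, ← map_pow, h4]; simp)
  have hx4 : (PadicInt.toZMod y) ^ 4 = -1 := by rw [← map_pow, hy4]; simp
  have hp2' : p ≠ 2 := by rintro rfl; exact hp2 dvd_rfl
  have : Fact (2 < p) := ⟨lt_of_le_of_ne hp.out.two_le hp2'.symm⟩
  have hord : orderOf (PadicInt.toZMod y) = 2 ^ (2 + 1) := by
    refine orderOf_eq_prime_pow ?_ ?_
    · norm_num
      rw [hx4]
      exact ZMod.neg_one_ne_one
    · norm_num
      rw [show 8 = 4 * 2 from rfl, pow_mul, hx4]; ring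
  have hx0 : PadicInt.toZMod y ≠ 0 := by
    intro h; rw [h] at hx4; simp at hx4
  have := orderOf_dvd_of_pow_eq_one (ZMod.pow_card_sub_one_eq_one hx0)
  rw [hord] at this
  have := hp.out.two_le
  omega

end PrimeDivisors

/-- Suitable auxiliary primes exist for every number field. -/
theorem exists_survivesPfister_numberField (K : Type*) [Field K] [NumberField K] :
    ∃ (p u₁ u₂ : ℕ) (_ : Fact p.Prime), p % 8 = 1 ∧ u₁.Prime ∧ u₂.Prime ∧ u₁ ≠ 2 ∧ u₁ ≠ u₂ ∧
      legendreSym p u₁ = -1 ∧ legendreSym p u₂ = -1 ∧ SurvivesPfister K p u₁ u₂ 0 := by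
  obtain ⟨p, hp, hp8, ⟨f⟩⟩ := NumberField.exists_ringHom_padic_mod_eight K
  have hp2 : p ≠ 2 := by rintro rfl; omega
  obtain ⟨a, ha⟩ := FiniteField.exists_nonsquare (F := ZMod p) (by rwa [ZMod.ringChar_zmod_n])
  have ha0 : IsUnit a := by
    rw [isUnit_iff_ne_zero]; rintro rfl; exact ha (IsSquare.zero)
  have key : ∀ N : ℕ, ∃ u : ℕ, N < u ∧ u.Prime ∧ legendreSym p u = -1 := by
    intro N
    obtain ⟨u, hu, hup, hua⟩ := Nat.forall_exists_prime_gt_and_eq_mod ha0 N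
    exact ⟨u, hu, hup, (legendreSym.eq_neg_one_iff p).2 (by simpa [hua] using ha)⟩
  obtain ⟨u₁, h1, hu₁, hl₁⟩ := key 2
  obtain ⟨u₂, h2, hu₂, hl₂⟩ := key u₁
  exact ⟨p, u₁, u₂, hp, hp8, hu₁, hu₂, h1.ne', h2.ne, hl₁, hl₂,
    (survivesPfister_padic hp2 hl₁ hl₂).of_map f⟩

section Place

open Polynomial IsLocalRing

/-- A finite extension `K` of the rational function field `M` of `F` carries a discrete valuation
ring whose residue field is finite over `F`. -/
theorem exists_dvr_residueField_finite (F : Type u) [Field F] [CharZero F] (M K : Type u) [Field M]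
    [Algebra F[X] M] [IsFractionRing F[X] M] [Field K] [Algebra F[X] K] [Algebra M K]
    [IsScalarTower F[X] M K] [FiniteDimensional M K] :
    ∃ (R : Type u) (_ : CommRing R) (_ : IsDomain R) (_ : IsDiscreteValuationRing R)
      (_ : Algebra R K) (_ : IsFractionRing R K) (_ : Algebra F (ResidueField R)),
      FiniteDimensional F (ResidueField R) := by
  have hM : CharZero M :=
    charZero_of_injective_algebraMap (IsFractionRing.injective F[X] M)
  let C := integralClosure F[X] K
  have hC : IsDedekindDomain C := integralClosure.isDedekindDomain F[X] M K
  have hCK : IsFractionRing C K := integralClosure.isFractionRing_of_finite_extension M K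
  have hfin : Module.Finite F[X] C := IsIntegralClosure.finite F[X] M K C
  have hinj : Function.Injective (algebraMap F[X] C) := by
    have h1 : Function.Injective (algebraMap F[X] K) := by
      rw [IsScalarTower.algebraMap_eq F[X] M K]
      exact (algebraMap M K).injective.comp (IsFractionRing.injective F[X] M)
    rw [IsScalarTower.algebraMap_eq F[X] C K] at h1
    exact Function.Injective.of_comp (f := algebraMap C K) h1
  have hX : algebraMap F[X] C X ∈ nonunits C := by
    intro hu
    have := (algebraMap_isIntegral_iff.2
      (inferInstance : Algebra.IsIntegral F[X] C)).isLocalHom hinj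
    exact not_isUnit_X (isUnit_of_map_unit (algebraMap F[X] C) X hu)
  obtain ⟨Q, hQ, hXQ⟩ := exists_max_ideal_of_mem_nonunits hX
  have hQ0 : Q ≠ ⊥ := by
    rintro rfl
    exact X_ne_zero (hinj (by rw [map_zero]; exact hXQ))
  have hle : Q.primeCompl ≤ nonZeroDivisors C := Q.primeCompl_le_nonZeroDivisors
  let R := Localization.subalgebra.ofField K Q.primeCompl hle
  have hR : IsLocalization.AtPrime R Q :=
    Localization.subalgebra.isLocalization_ofField K Q.primeCompl hle
  have hdvr : IsDiscreteValuationRing R :=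
    IsLocalization.AtPrime.isDiscreteValuationRing_of_dedekind_domain C hQ0 R
  let g : C →+* ResidueField R := (residue R).comp (algebraMap C R)
  have hg : Function.Surjective g := by
    intro z
    obtain ⟨w, rfl⟩ := (IsLocalization.AtPrime.equivQuotMaximalIdeal Q R).surjective z
    obtain ⟨w, rfl⟩ := Ideal.Quotient.mk_surjective w
    exact ⟨w, rfl⟩
  have hgX : g (algebraMap F[X] C X) = 0 := by
    refine (residue_eq_zero_iff _).2 ?_
    exact ((IsLocalization.AtPrime.to_map_mem_maximal_iff R Q _).2 hXQ)
  let h : F[X] →+* ResidueField R := g.comp (algebraMap F[X] C)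
  have hh : h.Finite := RingHom.Finite.comp (RingHom.Finite.of_surjective g hg)
    (RingHom.finite_algebraMap.2 hfin)
  have hev : h = (h.comp Polynomial.C).comp (evalRingHom 0) := by
    refine Polynomial.ringHom_ext (fun a => by simp) ?_
    simpa [h] using hgX
  rw [hev] at hh
  refine ⟨R, inferInstance, inferInstance, hdvr, inferInstance, inferInstance,
    (h.comp Polynomial.C).toAlgebra, ?_⟩
  exact RingHom.Finite.of_comp_finite hh

theorem isFractionRing_of_transcendental {F E : Type*} [Field F] [Field E] [Algebra F E] {x : E}
    (hx : Transcendental F x) (htop : IntermediateField.adjoin F {x} = ⊤) :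
    letI := (aeval (R := F) x).toRingHom.toAlgebra
    IsFractionRing F[X] E := by
  let := (aeval (R := F) x).toRingHom.toAlgebra
  have hinj : Function.Injective (algebraMap F[X] E) := transcendental_iff_injective.1 hx
  have : FaithfulSMul F[X] E := (faithfulSMul_iff_algebraMap_injective _ _).2 hinj
  refine IsFractionRing.of_field F[X] E fun z => ?_
  have hz : z ∈ IntermediateField.adjoin F {x} := htop ▸ IntermediateField.mem_top
  obtain ⟨r, s, hrs⟩ := (IntermediateField.mem_adjoin_simple_iff F z).1 hz
  exact ⟨r, s, hrs⟩

end Place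

/-- A purely transcendental extension in `m + 1` variables is a simple transcendental extension of
one in `m` variables. -/
theorem exists_intermediateField_tail {k E : Type*} [Field k] [Field E] [Algebra k E] {m : ℕ}
    {y : Fin (m + 1) → E} (hy : AlgebraicIndependent k y)
    (htop : IntermediateField.adjoin k (Set.range y) = ⊤) :
    ∃ (F : IntermediateField k E) (y' : Fin m → F), AlgebraicIndependent k y' ∧
      IntermediateField.adjoin k (Set.range y') = ⊤ ∧ Transcendental F (y 0) ∧
      IntermediateField.adjoin F {y 0} = ⊤ := by
  have hr : Set.range (Fin.tail y) = y '' Set.range Fin.succ := by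
    rw [← Set.range_comp]; rfl
  let F := IntermediateField.adjoin k (Set.range (Fin.tail y))
  let y' : Fin m → F := fun i => ⟨y i.succ, IntermediateField.subset_adjoin _ _ ⟨i, rfl⟩⟩
  have hy't : Fin.tail y = F.val ∘ y' := rfl
  refine ⟨F, y', ?_, ?_, ?_, ?_⟩
  · exact AlgebraicIndependent.of_comp F.val (hy.comp Fin.succ (Fin.succ_injective m))
  · apply IntermediateField.lift_injective F
    rw [IntermediateField.lift_adjoin, IntermediateField.lift_top, ← Set.range_comp]
    rfl
  · rw [IntermediateField.transcendental_adjoin_iff, hr]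
    exact hy.transcendental_adjoin (by simp)
  · rw [← IntermediateField.restrictScalars_eq_top_iff (K := k),
      IntermediateField.adjoin_adjoin_left, ← htop]
    congr 1
    rw [Set.union_singleton, ← Fin.range_cons, Fin.cons_self_tail]

/-- Function fields over number fields have surviving Pfister forms with as many slots as their
transcendence degree. -/
theorem exists_survivesPfister (k : Type*) [Field k] [NumberField k] (m : ℕ) :
    ∀ (E K : Type u) [Field E] [Field K] [Algebra k E] [Algebra E K] [FiniteDimensional E K]
      (y : Fin m → E), AlgebraicIndependent k y → IntermediateField.adjoin k (Set.range y) = ⊤ →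
    ∃ (p u₁ u₂ : ℕ) (_ : Fact p.Prime), p % 8 = 1 ∧ u₁.Prime ∧ u₂.Prime ∧ u₁ ≠ 2 ∧ u₁ ≠ u₂ ∧
      legendreSym p u₁ = -1 ∧ legendreSym p u₂ = -1 ∧ SurvivesPfister K p u₁ u₂ m := by
  induction m with
  | zero =>
    intro E K _ _ _ _ _ y _ htop
    have hE : CharZero E := charZero_of_injective_algebraMap (algebraMap k E).injective
    have hK : CharZero K := charZero_of_injective_algebraMap (algebraMap E K).injective
    rw [Set.range_eq_empty, IntermediateField.adjoin_empty] at htop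
    have h1 : FiniteDimensional k E := by
      have : Module.rank k E = 1 := by
        rw [← IntermediateField.rank_top' (F := k) (E := E), ← htop, IntermediateField.rank_bot]
      exact Module.rank_lt_aleph0_iff.1 (by rw [this]; exact Cardinal.one_lt_aleph0)
    have h2 : FiniteDimensional ℚ E := FiniteDimensional.trans ℚ k E
    have h3 : FiniteDimensional ℚ K := FiniteDimensional.trans ℚ E K
    have : NumberField K := ⟨⟩
    exact exists_survivesPfister_numberField K
  | succ m ih =>
    intro E K _ _ _ _ _ y hy htop
    have hE : CharZero E := charZero_of_injective_algebraMap (algebraMap k E).injective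
    obtain ⟨F, y', hy', htop', hx, hxtop⟩ := exists_intermediateField_tail hy htop
    let := (Polynomial.aeval (R := F) (y 0)).toRingHom.toAlgebra
    have := isFractionRing_of_transcendental hx hxtop
    let : Algebra (Polynomial F) K :=
      ((algebraMap E K).comp (algebraMap (Polynomial F) E)).toAlgebra
    have : IsScalarTower (Polynomial F) E K := IsScalarTower.of_algebraMap_eq fun _ => rfl
    obtain ⟨R, _, _, _, _, _, _, _⟩ := exists_dvr_residueField_finite F E K
    obtain ⟨p, u₁, u₂, hp, hp8, hu₁, hu₂, h2, hne, hl₁, hl₂, hs⟩ :=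
      ih F (IsLocalRing.ResidueField R) y' hy' htop'
    obtain ⟨π, hπ⟩ := IsDiscreteValuationRing.exists_irreducible R
    have : CharZero (IsLocalRing.ResidueField R) :=
      charZero_of_injective_algebraMap (algebraMap F _).injective
    exact ⟨p, u₁, u₂, hp, hp8, hu₁, hu₂, h2, hne, hl₁, hl₂,
      hs.of_residueField hπ hp.out.ne_zero hu₁.ne_zero⟩

section PowBasis

open Polynomial

/-- `v` is a basis of `K` over the subring of `p`-th powers. -/
def IsPowBasis {K ι : Type*} [CommRing K] [Fintype ι] (p : ℕ) (v : ι → K) : Prop :=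
  (∀ x, ∃ c : ι → K, ∑ i, c i ^ p * v i = x) ∧ ∀ c : ι → K, ∑ i, c i ^ p * v i = 0 → c = 0

theorem inPowSpan_ofFn_iff {p : ℕ} {K : Type*} [CommRing K] {N : ℕ} {b : Fin N → K} {x : K} :
    InPowSpan p (List.ofFn b) x ↔ ∃ c : Fin N → K, ∑ i, c i ^ p * b i = x := by
  induction N generalizing x with
  | zero => simp [InPowSpan, eq_comm]
  | succ N ih =>
    rw [List.ofFn_succ]
    simp only [InPowSpan, ih]
    constructor
    · rintro ⟨a, c, hc⟩
      exact ⟨Fin.cons a c, by simp [Fin.sum_univ_succ, hc]⟩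
    · rintro ⟨c, hc⟩
      exact ⟨c 0, fun i => c i.succ, by rw [← hc, Fin.sum_univ_succ]; ring⟩

variable {p : ℕ} [Fact p.Prime]

theorem Polynomial.coeff_pow_mul_C_mul_X_pow {F : Type*} [Field F] [CharP F p] (d : F[X]) (a : F)
    (j j₀ : Fin p) (k : ℕ) :
    (d ^ p * (C a * X ^ (j : ℕ))).coeff (p * k + j₀) =
      if j = j₀ then d.coeff k ^ p * a else 0 := by
  have hp : 0 < p := (Fact.out : p.Prime).pos
  rw [← mul_assoc, coeff_mul_X_pow', coeff_mul_C, ← map_frobenius_expand, coeff_map,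
    coeff_expand hp, frobenius_def]
  have h1 := j.2
  have h2 := j₀.2
  by_cases hj : j = j₀
  · subst hj
    simp [Nat.mul_div_cancel_left k hp]
  · rw [if_neg hj]
    split_ifs with h3 h4
    · exfalso
      have hne : (j : ℕ) ≠ j₀ := fun h => hj (Fin.ext h)
      obtain ⟨t, ht⟩ := h4
      have : p * k + j₀ = p * t + j := by omega
      have h5 := congrArg (· % p) this
      simp only [Nat.mul_add_mod, Nat.mod_eq_of_lt h1, Nat.mod_eq_of_lt h2] at h5
      exact hne h5.symm
    · simp [(Fact.out : p.Prime).ne_zero]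
    · rfl

/-- Adjoining a variable multiplies the size of a basis over the `p`-th powers by `p`. -/
theorem IsPowBasis.fractionRing_polynomial {F E ι : Type*} [Field F] [CharP F p] [Field E]
    [CharP E p] [Algebra F[X] E] [IsFractionRing F[X] E] [Fintype ι] {v : ι → F}
    (hv : IsPowBasis p v) : IsPowBasis p (fun ij : ι × Fin p =>
      algebraMap F[X] E (C (v ij.1) * X ^ (ij.2 : ℕ))) := by
  have hp0 : p ≠ 0 := (Fact.out : p.Prime).ne_zero
  constructor
  · have hpoly : ∀ f : F[X], ∃ c : ι × Fin p → E, ∑ ij, c ij ^ p *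
        algebraMap F[X] E (C (v ij.1) * X ^ (ij.2 : ℕ)) = algebraMap F[X] E f := by
      intro f
      induction f using Polynomial.induction_on' with
      | add f g hf hg =>
        obtain ⟨c, hc⟩ := hf
        obtain ⟨d, hd⟩ := hg
        refine ⟨c + d, ?_⟩
        simp only [Pi.add_apply, add_pow_char, add_mul, Finset.sum_add_distrib, hc, hd, map_add]
      | monomial n a =>
        obtain ⟨c, hc⟩ := hv.1 a
        have hn : n % p < p := Nat.mod_lt _ (Fact.out : p.Prime).pos
        refine ⟨fun ij => if ij.2 = ⟨n % p, hn⟩ then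
          algebraMap F[X] E (C (c ij.1) * X ^ (n / p)) else 0, ?_⟩
        rw [Fintype.sum_prod_type]
        simp only [ite_pow, zero_pow hp0, ite_mul, zero_mul, Finset.sum_ite_eq', Finset.mem_univ,
          if_true, ← map_pow, ← map_mul, ← map_sum]
        congr 1
        rw [← hc, ← C_mul_X_pow_eq_monomial, map_sum, Finset.sum_mul]
        refine Finset.sum_congr rfl fun i _ => ?_
        rw [C_mul, C_pow, mul_pow, ← pow_mul]
        conv_rhs => rw [← Nat.div_add_mod n p, pow_add, mul_comm p]
        ring
    intro z
    obtain ⟨f, g, hg, rfl⟩ := IsFractionRing.div_surjective F[X] z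
    obtain ⟨c, hc⟩ := hpoly (f * g ^ (p - 1))
    have hg0 : algebraMap F[X] E g ≠ 0 := fun h =>
      nonZeroDivisors.ne_zero hg ((map_eq_zero_iff _ (IsFractionRing.injective F[X] E)).1 h)
    refine ⟨fun ij => c ij / algebraMap F[X] E g, ?_⟩
    simp only [div_pow, div_mul_eq_mul_div, ← Finset.sum_div]
    rw [hc, map_mul, map_pow, div_eq_div_iff (pow_ne_zero _ hg0) hg0, mul_assoc, ← pow_succ,
      Nat.sub_add_cancel (Fact.out : p.Prime).one_le]
  · intro c hc
    obtain ⟨⟨b, hb⟩, hInt⟩ := IsLocalization.exist_integer_multiples_of_finite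
      (nonZeroDivisors F[X]) c
    choose d hd using hInt
    have inj := IsFractionRing.injective F[X] E
    have hb0 : algebraMap F[X] E b ≠ 0 := fun h =>
      nonZeroDivisors.ne_zero hb ((map_eq_zero_iff _ inj).1 h)
    simp only [Algebra.smul_def] at hd
    have hz : ∑ ij, d ij ^ p * (C (v ij.1) * X ^ (ij.2 : ℕ)) = 0 := by
      apply inj
      rw [map_zero, map_sum, ← mul_zero (algebraMap F[X] E b ^ p), ← hc, Finset.mul_sum]
      refine Finset.sum_congr rfl fun ij _ => ?_
      rw [map_mul, map_pow, hd]
      ring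
    have hd0 : ∀ ij, d ij = 0 := by
      rintro ⟨i₀, j₀⟩
      ext k
      have h := congrArg (fun f : F[X] => f.coeff (p * k + j₀)) hz
      simp only [finsetSum_coeff, coeff_zero, coeff_pow_mul_C_mul_X_pow] at h
      rw [Fintype.sum_prod_type] at h
      simp only [Finset.sum_ite_eq', Finset.mem_univ, if_true] at h
      exact congrFun (hv.2 (fun i => (d (i, j₀)).coeff k) h) i₀
    funext ij
    have := hd ij
    rw [hd0 ij, map_zero] at this
    exact (mul_eq_zero.1 this.symm).resolve_left hb0

theorem exists_isPowBasis (m : ℕ) : ∀ (E : Type u) [Field E] [Algebra (ZMod p) E]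
    (y : Fin m → E), AlgebraicIndependent (ZMod p) y →
    IntermediateField.adjoin (ZMod p) (Set.range y) = ⊤ →
    ∃ (ι : Type) (_ : Fintype ι) (v : ι → E), Fintype.card ι = p ^ m ∧ IsPowBasis p v := by
  induction m with
  | zero =>
    intro E _ _ y _ htop
    rw [Set.range_eq_empty, IntermediateField.adjoin_empty] at htop
    refine ⟨Unit, inferInstance, fun _ => 1, by simp, fun x => ⟨fun _ => x, ?_⟩, fun c hc => ?_⟩
    · obtain ⟨a, rfl⟩ := IntermediateField.mem_bot.1 (htop ▸ IntermediateField.mem_top (x := x))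
      simp [← map_pow]
    · funext i
      simpa [(Fact.out : p.Prime).ne_zero] using hc
  | succ m ih =>
    intro E _ _ y hy htop
    obtain ⟨F, y', hy', htop', hx, hxtop⟩ := exists_intermediateField_tail hy htop
    obtain ⟨ι, _, v, hι, hv⟩ := ih F y' hy' htop'
    have : CharP F p := charP_of_injective_algebraMap (algebraMap (ZMod p) F).injective p
    have : CharP E p := charP_of_injective_algebraMap (algebraMap (ZMod p) E).injective p
    let := (Polynomial.aeval (R := F) (y 0)).toRingHom.toAlgebra
    have := isFractionRing_of_transcendental hx hxtop
    exact ⟨ι × Fin p, inferInstance, _, by simp [hι, pow_succ], hv.fractionRing_polynomial (E := E)⟩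

theorem IsPowBasis.finrank_frobenius {K ι : Type*} [Field K] [CharP K p] [Fintype ι] {v : ι → K}
    (hv : IsPowBasis p v) :
    Module.finrank (frobenius K p).fieldRange K = Fintype.card ι := by
  have hli : LinearIndependent (frobenius K p).fieldRange v := by
    rw [Fintype.linearIndependent_iff]
    intro g hg i
    choose c hc using fun i => (g i).2
    have := congrFun (hv.2 c (by
      rw [← hg]
      refine Finset.sum_congr rfl fun i _ => ?_
      rw [Subfield.smul_def, ← hc, frobenius_def, smul_eq_mul])) i
    apply Subtype.ext
    rw [← hc, this, Pi.zero_apply, map_zero]; rfl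
  have hsp : ⊤ ≤ Submodule.span (frobenius K p).fieldRange (Set.range v) := by
    rintro x -
    obtain ⟨c, rfl⟩ := hv.1 x
    refine Submodule.sum_mem _ fun i _ => ?_
    exact Submodule.smul_mem _ (⟨c i ^ p, c i, rfl⟩ : (frobenius K p).fieldRange)
      (Submodule.subset_span ⟨i, rfl⟩)
  rw [Module.finrank_eq_card_basis (Module.Basis.mk hli hsp)]

/-- The degree of a field over its `p`-th powers is invariant under finite extensions. -/
theorem finrank_frobenius_eq (E K : Type*) [Field E] [Field K] [CharP E p] [CharP K p]
    [Algebra E K] [FiniteDimensional E K] :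
    Module.finrank (frobenius K p).fieldRange K = Module.finrank (frobenius E p).fieldRange E := by
  let i := algebraMap E K
  have hK : (frobenius K p).fieldRange = (⊤ : Subfield K).map (frobenius K p) :=
    RingHom.fieldRange_eq_map _
  have hE : (frobenius E p).fieldRange = (⊤ : Subfield E).map (frobenius E p) :=
    RingHom.fieldRange_eq_map _
  have hcomm : (((⊤ : Subfield E).map (frobenius E p)).map i) =
      ((⊤ : Subfield E).map i).map (frobenius K p) := by
    rw [Subfield.map_map, Subfield.map_map]
    congr 1
    exact RingHom.ext fun x => by simp [frobenius_def, i]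
  have h1 : Module.finrank (frobenius E p).fieldRange E =
      Subfield.relfinrank (((⊤ : Subfield E).map i).map (frobenius K p))
        ((⊤ : Subfield E).map i) := by
    rw [← hcomm, Subfield.relfinrank_map_map, Subfield.relfinrank_top_right, hE]
  have h2 : Module.finrank (frobenius K p).fieldRange K =
      Subfield.relfinrank ((⊤ : Subfield K).map (frobenius K p)) ⊤ := by
    rw [Subfield.relfinrank_top_right, hK]
  have h3 : Subfield.relfinrank ((⊤ : Subfield E).map i) ⊤ ≠ 0 := by
    rw [Subfield.relfinrank_top_right, ← RingHom.fieldRange_eq_map]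
    have e := Algebra.finrank_eq_of_equiv_equiv (R₀ := E) (S₀ := K) (R₁ := i.fieldRange) (S₁ := K)
      (RingEquiv.ofBijective i.rangeRestrictField i.rangeRestrictField_bijective)
      (RingEquiv.refl K) rfl
    rw [← e]
    exact Module.finrank_pos.ne'
  rw [h1, h2]
  have e1 := Subfield.relfinrank_mul_relfinrank
    (A := ((⊤ : Subfield E).map i).map (frobenius K p)) (B := (⊤ : Subfield E).map i) (C := ⊤)
    (by
      rw [← hcomm]; exact (Subfield.gc_map_comap i).monotone_l le_top) le_top
  have e2 := Subfield.relfinrank_mul_relfinrank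
    (A := ((⊤ : Subfield E).map i).map (frobenius K p))
    (B := (⊤ : Subfield K).map (frobenius K p)) (C := ⊤)
    ((Subfield.gc_map_comap _).monotone_l le_top) le_top
  rw [Subfield.relfinrank_map_map] at e2
  exact mul_left_cancel₀ h3 (by rw [e2, ← e1, mul_comm])

/-- The size of spanning families over the `p`-th powers. -/
theorem exists_powSpan_iff {K : Type*} [Field K] [CharP K p] {M N : ℕ} (hM : M ≠ 0)
    (h : Module.finrank (frobenius K p).fieldRange K = M) :
    (∃ b : Fin N → K, ∀ x, InPowSpan p (List.ofFn b) x) ↔ M ≤ N := by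
  simp only [inPowSpan_ofFn_iff]
  have hfin : FiniteDimensional (frobenius K p).fieldRange K :=
    Module.finite_of_finrank_pos (by omega)
  constructor
  · rintro ⟨b, hb⟩
    have hsp : Submodule.span (frobenius K p).fieldRange (Set.range b) = ⊤ := by
      refine eq_top_iff.2 ?_
      rintro x -
      obtain ⟨c, rfl⟩ := hb x
      refine Submodule.sum_mem _ fun i _ => ?_
      exact Submodule.smul_mem _ (⟨c i ^ p, c i, rfl⟩ : (frobenius K p).fieldRange)
        (Submodule.subset_span ⟨i, rfl⟩)
    have := finrank_range_le_card (R := (frobenius K p).fieldRange) b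
    rw [Set.finrank, hsp, finrank_top, h, Fintype.card_fin] at this
    exact this
  · intro hMN
    let B := Module.finBasisOfFinrankEq (frobenius K p).fieldRange K h
    refine ⟨fun i => if hi : (i : ℕ) < M then B ⟨i, hi⟩ else 0, fun x => ?_⟩
    choose c hc using fun i => (B.repr x i).2
    refine ⟨fun i => if hi : (i : ℕ) < M then c ⟨i, hi⟩ else 0, ?_⟩
    obtain ⟨t, rfl⟩ := Nat.exists_eq_add_of_le hMN
    rw [Fin.sum_univ_add]
    simp only [Fin.val_castAdd, Fin.is_lt, dif_pos, Fin.val_natAdd, not_lt.2 (Nat.le_add_right _ _),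
      dif_neg, not_false_eq_true, mul_zero, Finset.sum_const_zero, add_zero]
    conv_rhs => rw [← B.sum_repr x]
    refine Finset.sum_congr rfl fun i _ => ?_
    rw [Subfield.smul_def, ← hc, frobenius_def, smul_eq_mul]

end PowBasis

section ElementaryEquivalence

open FirstOrder IntermediateField

theorem algebraicIndependent_fieldRange_iff {k K ι : Type*} [Field k] [Field K] [Algebra k K]
    {x : ι → K} :
    AlgebraicIndependent (algebraMap k K).fieldRange x ↔ AlgebraicIndependent k x :=
  algebraicIndependent_ringHom_iff_of_comp_eq
    (RingEquiv.ofBijective _ (algebraMap k K).rangeRestrictField_bijective) (RingHom.id K)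
    Function.injective_id rfl

theorem isTranscendenceBasis_bot_iff {k K ι : Type*} [Field k] [Field K] [Algebra k K]
    (h : (⊥ : Subfield K) = (algebraMap k K).fieldRange) {x : ι → K} :
    IsTranscendenceBasis (⊥ : Subfield K) x ↔ IsTranscendenceBasis k x := by
  rw [h]
  simp only [IsTranscendenceBasis, AlgebraicIndepOn, algebraicIndependent_fieldRange_iff]

theorem IntermediateField.adjoin_eq_top_of_closure_eq_top (k : Type*) {K : Type*} [Field k]
    [Field K] [Algebra k K] {s : Set K} (hs : Subfield.closure s = ⊤) : adjoin k s = ⊤ :=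
  toSubfield_injective (top_le_iff.1 (hs ▸ Subfield.closure_le.2 (subset_adjoin k s)))

theorem FieldFG.finiteDimensional {E K : Type*} [Field E] [Field K] [Algebra E K]
    [Algebra.IsAlgebraic E K] (hK : FieldFG K) : FiniteDimensional E K := by
  obtain ⟨s, hs⟩ := hK
  have := finiteDimensional_adjoin (K := E) (S := (s : Set K))
    fun x _ => (Algebra.IsAlgebraic.isAlgebraic x).isIntegral
  rw [adjoin_eq_top_of_closure_eq_top E hs] at this
  exact Module.Finite.equiv topEquiv.toLinearEquiv

/-- A finitely generated field is finite over the field generated by a suitable finite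
transcendence basis. -/
theorem FieldFG.exists_isTranscendenceBasis {k K : Type*} [Field k] [Field K] [Algebra k K]
    (hK : FieldFG K) : ∃ (d : ℕ) (x : Fin d → K), IsTranscendenceBasis k x ∧
      FiniteDimensional (adjoin k (Set.range x)) K := by
  have hess : Algebra.EssFiniteType k K :=
    fg_top_iff.1 (hK.imp fun s hs => adjoin_eq_top_of_closure_eq_top k hs)
  obtain ⟨t, ht⟩ := exists_finset_isTranscendenceBasis k K
  have hx := (isTranscendenceBasis_equiv t.equivFin.symm).2 ht
  have := hx.isAlgebraic_field
  exact ⟨_, _, hx, hK.finiteDimensional⟩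

/-- A generating family of a purely transcendental extension, viewed inside that extension. -/
theorem AlgebraicIndependent.exists_adjoin_eq_top {k K ι : Type*} [Field k] [Field K] [Algebra k K]
    {x : ι → K} (hx : AlgebraicIndependent k x) :
    ∃ y : ι → adjoin k (Set.range x), AlgebraicIndependent k y ∧ adjoin k (Set.range y) = ⊤ := by
  refine ⟨fun i => ⟨x i, subset_adjoin k _ ⟨i, rfl⟩⟩, ?_, ?_⟩
  · exact AlgebraicIndependent.of_comp (adjoin k (Set.range x)).val hx
  · apply IntermediateField.map_injective (adjoin k (Set.range x)).val
    rw [adjoin_map, ← AlgHom.fieldRange_eq_map, fieldRange_val, ← Set.range_comp]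
    rfl

theorem ElemEquivRing.realize_iff {K₁ K₂ : Type*} [CommRing K₁] [CommRing K₂]
    (h : ElemEquivRing K₁ K₂) {P₁ P₂ : Prop} (φ : Language.ring.Sentence)
    (h₁ : letI := Ring.compatibleRingOfRing K₁; K₁ ⊨ φ ↔ P₁)
    (h₂ : letI := Ring.compatibleRingOfRing K₂; K₂ ⊨ φ ↔ P₂) : P₁ ↔ P₂ := by
  let := Ring.compatibleRingOfRing K₁
  let := Ring.compatibleRingOfRing K₂
  exact h₁.symm.trans ((Language.elementarilyEquivalent_iff.1 h φ).trans h₂)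

theorem ElemEquivRing.symm {K₁ K₂ : Type*} [CommRing K₁] [CommRing K₂]
    (h : ElemEquivRing K₁ K₂) : ElemEquivRing K₂ K₁ :=
  Eq.symm h

theorem realize_natCast_eq_zero {K : Type*} [Field K] [Ring.CompatibleRing K] (n : ℕ) :
    K ⊨ (Language.Term.bdEqual (RingTerm.nat n) 0 : Language.ring.Sentence) ↔ (n : K) = 0 := by
  rw [Language.Sentence.Realize, Language.Formula.Realize, Language.BoundedFormula.realize_bdEqual,
    RingTerm.realize_nat, Ring.realize_zero]

theorem ElemEquivRing.natCast_eq_zero_iff {K₁ K₂ : Type*} [Field K₁] [Field K₂]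
    (h : ElemEquivRing K₁ K₂) (n : ℕ) : (n : K₁) = 0 ↔ (n : K₂) = 0 :=
  h.realize_iff _ (letI := Ring.compatibleRingOfRing K₁; realize_natCast_eq_zero n)
    (letI := Ring.compatibleRingOfRing K₂; realize_natCast_eq_zero n)

theorem ElemEquivRing.card_le_of_charZero {K₁ : Type u} {K₂ : Type v} [Field K₁] [Field K₂]
    [CharZero K₁] [CharZero K₂] (h : ElemEquivRing K₁ K₂) {d₁ d₂ : ℕ} {x : Fin d₁ → K₁}
    {y : Fin d₂ → K₂} (hx : IsTranscendenceBasis ℚ x) (hy : IsTranscendenceBasis ℚ y)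
    [FiniteDimensional (adjoin ℚ (Set.range y)) K₂] : d₂ ≤ d₁ := by
  by_contra! hlt
  obtain ⟨z, hz, hztop⟩ := hy.1.exists_adjoin_eq_top
  obtain ⟨p, u₁, u₂, _, hp, hu₁, hu₂, h2, hne, hl₁, hl₂, hs⟩ :=
    exists_survivesPfister ℚ d₂ (adjoin ℚ (Set.range y)) K₂ z hz hztop
  exact hs.not_killsPfister ((h.realize_iff (killsPfisterSentence p u₁ u₂ d₂)
    (letI := Ring.compatibleRingOfRing K₁; realize_killsPfisterSentence p u₁ u₂ d₂)
    (letI := Ring.compatibleRingOfRing K₂; realize_killsPfisterSentence p u₁ u₂ d₂)).1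
      (killsPfister_of_trdeg_lt hx hlt hp hu₁ hu₂ h2 hne hl₁ hl₂))

theorem finrank_frobenius_eq_pow {p : ℕ} [Fact p.Prime] {K : Type u} [Field K] [Algebra (ZMod p) K]
    [CharP K p] {d : ℕ} {x : Fin d → K} (hx : IsTranscendenceBasis (ZMod p) x)
    [FiniteDimensional (adjoin (ZMod p) (Set.range x)) K] :
    Module.finrank (frobenius K p).fieldRange K = p ^ d := by
  obtain ⟨z, hz, hztop⟩ := hx.1.exists_adjoin_eq_top
  obtain ⟨ι, _, w, hw, hb⟩ := exists_isPowBasis d _ z hz hztop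
  have : CharP (adjoin (ZMod p) (Set.range x)) p :=
    charP_of_injective_algebraMap (algebraMap (ZMod p) _).injective p
  rw [finrank_frobenius_eq (adjoin (ZMod p) (Set.range x)) K, hb.finrank_frobenius, hw]

theorem ElemEquivRing.card_le_of_charP {p : ℕ} [Fact p.Prime] {K₁ : Type u} {K₂ : Type v}
    [Field K₁] [Field K₂] [Algebra (ZMod p) K₁] [Algebra (ZMod p) K₂] (h : ElemEquivRing K₁ K₂)
    {d₁ d₂ : ℕ} {x : Fin d₁ → K₁} {y : Fin d₂ → K₂} (hx : IsTranscendenceBasis (ZMod p) x)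
    (hy : IsTranscendenceBasis (ZMod p) y) [FiniteDimensional (adjoin (ZMod p) (Set.range x)) K₁]
    [FiniteDimensional (adjoin (ZMod p) (Set.range y)) K₂] : d₂ ≤ d₁ := by
  have hp : p.Prime := Fact.out
  have : CharP K₁ p := charP_of_injective_algebraMap (algebraMap (ZMod p) K₁).injective p
  have : CharP K₂ p := charP_of_injective_algebraMap (algebraMap (ZMod p) K₂).injective p
  have key := h.realize_iff (powSpanSentence p (p ^ d₁))
    (letI := Ring.compatibleRingOfRing K₁; realize_powSpanSentence p (p ^ d₁))
    (letI := Ring.compatibleRingOfRing K₂; realize_powSpanSentence p (p ^ d₁))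
  rw [exists_powSpan_iff (pow_ne_zero _ hp.ne_zero) (finrank_frobenius_eq_pow hx),
    exists_powSpan_iff (pow_ne_zero _ hp.ne_zero) (finrank_frobenius_eq_pow hy)] at key
  exact (Nat.pow_le_pow_iff_right hp.one_lt).1 (key.1 le_rfl)

end ElementaryEquivalence

theorem stmt_1 (K₁ : Type u) (K₂ : Type v) [Field K₁] [Field K₂]
    (hfg₁ : FieldFG K₁) (hfg₂ : FieldFG K₂) (heq : ElemEquivRing K₁ K₂) :
    ∃ n : ℕ, (∃ x : Fin n → K₁, IsTranscendenceBasis (⊥ : Subfield K₁) x) ∧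
      (∃ y : Fin n → K₂, IsTranscendenceBasis (⊥ : Subfield K₂) y) := by
  obtain ⟨p, hp⟩ := CharP.exists K₁
  have hp₂ : CharP K₂ p := ⟨fun n => by rw [← heq.natCast_eq_zero_iff, CharP.cast_eq_zero_iff K₁ p]⟩
  rcases CharP.char_is_prime_or_zero K₁ p with hprime | rfl
  · have : Fact p.Prime := ⟨hprime⟩
    let := ZMod.algebra K₁ p
    let := ZMod.algebra K₂ p
    obtain ⟨d₁, x, hx, _⟩ := hfg₁.exists_isTranscendenceBasis (k := ZMod p)
    obtain ⟨d₂, y, hy, _⟩ := hfg₂.exists_isTranscendenceBasis (k := ZMod p)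
    obtain rfl : d₁ = d₂ := le_antisymm (heq.symm.card_le_of_charP hy hx)
      (heq.card_le_of_charP hx hy)
    exact ⟨d₁, ⟨x, (isTranscendenceBasis_bot_iff (Subfield.bot_eq_of_zMod_algebra p)).2 hx⟩,
      ⟨y, (isTranscendenceBasis_bot_iff (Subfield.bot_eq_of_zMod_algebra p)).2 hy⟩⟩
  · have := CharP.charP_to_charZero K₁
    have := CharP.charP_to_charZero K₂
    obtain ⟨d₁, x, hx, _⟩ := hfg₁.exists_isTranscendenceBasis (k := ℚ)
    obtain ⟨d₂, y, hy, _⟩ := hfg₂.exists_isTranscendenceBasis (k := ℚ)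
    obtain rfl : d₁ = d₂ := le_antisymm (heq.symm.card_le_of_charZero hy hx)
      (heq.card_le_of_charZero hx hy)
    exact ⟨d₁, ⟨x, (isTranscendenceBasis_bot_iff Subfield.bot_eq_of_charZero).2 hx⟩,
      ⟨y, (isTranscendenceBasis_bot_iff Subfield.bot_eq_of_charZero).2 hy⟩⟩

end
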